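/- For every dimension d ≥ 1 and every t ∈ (0, 1/2], there exists a constant C_{d,t} > 0 with the following property: if A ⊆ ℝ^d is a measurable set of positive finite volume with δ := δ_t(A, A) < t^d, then |co(A) \ A| ≤ C_{d,t}·δ·|A|. -/

import Mathlib

open MeasureTheory Pointwise

namespace TDoubling

open Set
open scoped ENNReal

theorem volume_add_le_of_isCompact {X Y : Set ℝ} (hX : IsCompact X) (hY : IsCompact Y)
    (hX0 : X.Nonempty) (hY0 : Y.Nonempty) : volume X + volume Y ≤ volume (X + Y) := by
  obtain ⟨a, ha, hamax⟩ := hX.exists_isGreatest hX0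
  obtain ⟨b, hb, hbmin⟩ := hY.exists_isLeast hY0
  set P := (fun x => x + b) '' X with hP
  set Q := (fun y => a + y) '' Y with hQ
  have hPc : IsCompact P := hX.image (by fun_prop)
  have hQc : IsCompact Q := hY.image (by fun_prop)
  have hPX : volume P = volume X := by
    rw [hP, Set.image_add_right, measure_preimage_add_right]
  have hQY : volume Q = volume Y := by
    rw [hQ, Set.image_add_left, measure_preimage_add]
  have hPQ : volume (P ∩ Q) = 0 := by
    refine measure_mono_null (t := {a + b}) ?_ (by simp)
    rintro z ⟨⟨x, hx, rfl⟩, ⟨y, hy, hxy⟩⟩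
    have h1 := hamax hx
    have h2 := hbmin hy
    simp only [mem_singleton_iff]
    simp only at hxy
    linarith
  have hsub : P ∪ Q ⊆ X + Y := by
    rintro z (⟨x, hx, rfl⟩ | ⟨y, hy, rfl⟩)
    · exact Set.add_mem_add hx hb
    · exact Set.add_mem_add ha hy
  have := measure_union_add_inter (μ := volume) P hQc.measurableSet
  rw [hPQ, add_zero, hPX, hQY] at this
  rw [← this]
  exact measure_mono hsub

theorem volume_add_le {X Y : Set ℝ} (hX : MeasurableSet X) (hY : MeasurableSet Y)
    (hX0 : X.Nonempty) (hY0 : Y.Nonempty) : volume X + volume Y ≤ volume (X + Y) := by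
  obtain ⟨x₀, hx₀⟩ := hX0
  obtain ⟨y₀, hy₀⟩ := hY0
  have key : ∀ K ⊆ X, IsCompact K → ∀ L ⊆ Y, IsCompact L →
      volume K + volume L ≤ volume (X + Y) := by
    intro K hK hKc L hL hLc
    calc volume K + volume L ≤ volume (insert x₀ K) + volume (insert y₀ L) := by
          gcongr <;> exact subset_insert _ _
      _ ≤ volume (insert x₀ K + insert y₀ L) :=
          volume_add_le_of_isCompact (hKc.insert _) (hLc.insert _)
            (insert_nonempty _ _) (insert_nonempty _ _)
      _ ≤ volume (X + Y) := measure_mono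
          (Set.add_subset_add (insert_subset hx₀ hK) (insert_subset hy₀ hL))
  rw [hX.measure_eq_iSup_isCompact, hY.measure_eq_iSup_isCompact]
  refine ENNReal.iSup_add_iSup_le fun K L => ?_
  by_cases h1 : K ⊆ X <;> by_cases h2 : L ⊆ Y <;> by_cases h3 : IsCompact K <;>
    by_cases h4 : IsCompact L <;> simp [h1, h2, h3, h4]
  · exact key K h1 h3 L h2 h4
  all_goals first
    | exact (le_self_add).trans (key K h1 h3 ∅ (by simp) isCompact_empty)
    | exact (le_add_self).trans (key ∅ (by simp) isCompact_empty L h2 h4)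

theorem rpow_mul_rpow_le_add {t : ℝ} (ht0 : 0 < t) (ht1 : t < 1) (x y : ℝ≥0∞) :
    x ^ t * y ^ (1 - t) ≤ ENNReal.ofReal t * x + ENNReal.ofReal (1 - t) * y := by
  have hs : 0 < 1 - t := by linarith
  have hpq : (t⁻¹).HolderConjugate (1 - t)⁻¹ := by
    refine (Real.holderConjugate_iff).2 ⟨(one_lt_inv₀ ht0).2 ht1, by simp⟩
  have := ENNReal.young_inequality (x ^ t) (y ^ (1 - t)) hpq
  rw [← ENNReal.rpow_mul, ← ENNReal.rpow_mul, mul_inv_cancel₀ ht0.ne', mul_inv_cancel₀ hs.ne',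
    ENNReal.rpow_one, ENNReal.rpow_one] at this
  refine this.trans (le_of_eq ?_)
  rw [div_eq_mul_inv, div_eq_mul_inv, ENNReal.ofReal_inv_of_pos ht0, ENNReal.ofReal_inv_of_pos hs,
    inv_inv, inv_inv, mul_comm, mul_comm y]

theorem volume_real_smul {r : ℝ} (hr : 0 ≤ r) (s : Set ℝ) :
    volume (r • s) = ENNReal.ofReal r * volume s := by
  rw [Measure.addHaar_smul]; simp [abs_of_nonneg hr]

/-- One-dimensional Prékopa–Leindler inequality for functions whose supremum is one. -/
theorem prekopa_leindler_normalized {t : ℝ} (ht0 : 0 < t) (ht1 : t < 1) {f g h : ℝ → ℝ}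
    (hf : Measurable f) (hg : Measurable g) (hh : Measurable h) (hf0 : ∀ x, 0 ≤ f x)
    (hg0 : ∀ x, 0 ≤ g x) (hh0 : ∀ x, 0 ≤ h x) (hf1 : IsLUB (range f) 1) (hg1 : IsLUB (range g) 1)
    (H : ∀ x y, f x ^ t * g y ^ (1 - t) ≤ h (t * x + (1 - t) * y)) :
    (∫⁻ x, ENNReal.ofReal (f x)) ^ t * (∫⁻ x, ENNReal.ofReal (g x)) ^ (1 - t) ≤
      ∫⁻ x, ENNReal.ofReal (h x) := by
  have hs : 0 < 1 - t := by linarith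
  refine (rpow_mul_rpow_le_add ht0 ht1 _ _).trans ?_
  rw [lintegral_eq_lintegral_meas_lt _ (.of_forall hf0) hf.aemeasurable,
    lintegral_eq_lintegral_meas_lt _ (.of_forall hg0) hg.aemeasurable,
    lintegral_eq_lintegral_meas_lt _ (.of_forall hh0) hh.aemeasurable]
  rw [← lintegral_const_mul' _ _ (by simp), ← lintegral_const_mul' _ _ (by simp)]
  have hmeas : Measurable fun s : ℝ => ENNReal.ofReal t * volume {a | s < f a} := by
    refine Measurable.const_mul (Antitone.measurable fun a b hab => measure_mono fun x hx => ?_) _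
    exact lt_of_le_of_lt hab hx
  rw [← lintegral_add_left hmeas]
  refine lintegral_mono_ae ?_
  filter_upwards [ae_restrict_mem measurableSet_Ioi] with s hs0
  rw [mem_Ioi] at hs0
  rcases lt_or_ge s 1 with hs1 | hs1
  · obtain ⟨_, ⟨x₀, rfl⟩, hx₀⟩ := (lt_isLUB_iff hf1).1 hs1
    obtain ⟨_, ⟨y₀, rfl⟩, hy₀⟩ := (lt_isLUB_iff hg1).1 hs1
    rw [← volume_real_smul ht0.le, ← volume_real_smul hs.le]
    refine (volume_add_le ((measurableSet_lt measurable_const hf).const_smul₀ t)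
      ((measurableSet_lt measurable_const hg).const_smul₀ _) ⟨t • x₀, x₀, hx₀, rfl⟩
      ⟨(1 - t) • y₀, y₀, hy₀, rfl⟩).trans (measure_mono ?_)
    rintro _ ⟨_, ⟨x, hx, rfl⟩, _, ⟨y, hy, rfl⟩, rfl⟩
    refine lt_of_lt_of_le ?_ (H x y)
    calc s = s ^ t * s ^ (1 - t) := by
          rw [← Real.rpow_add hs0]; simp
      _ < f x ^ t * g y ^ (1 - t) := by
          apply mul_lt_mul'' (Real.rpow_lt_rpow hs0.le hx ht0) (Real.rpow_lt_rpow hs0.le hy hs)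
            <;> positivity
  · have e1 : {a | s < f a} = ∅ := by
      ext a; simp only [mem_ofPred_eq, mem_empty_iff_false, iff_false, not_lt]
      exact (hf1.1 ⟨a, rfl⟩).trans hs1
    have e2 : {a | s < g a} = ∅ := by
      ext a; simp only [mem_ofPred_eq, mem_empty_iff_false, iff_false, not_lt]
      exact (hg1.1 ⟨a, rfl⟩).trans hs1
    simp [e1, e2]

theorem isLUB_div_iSup {f : ℝ → ℝ} (hb : BddAbove (range f)) (hpos : 0 < ⨆ x, f x) :
    IsLUB (range fun x => f x / ⨆ x, f x) 1 := by
  constructor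
  · rintro _ ⟨x, rfl⟩
    exact (div_le_one hpos).2 (le_ciSup hb x)
  · intro b hb'
    have : (⨆ x, f x) ≤ b * ⨆ x, f x := ciSup_le fun x =>
      (div_le_iff₀ hpos).1 (hb' ⟨x, rfl⟩)
    by_contra! hlt
    nlinarith

theorem prekopa_leindler {t : ℝ} (ht0 : 0 < t) (ht1 : t < 1) {f g h : ℝ → ℝ}
    (hf : Measurable f) (hg : Measurable g) (hh : Measurable h) (hf0 : ∀ x, 0 ≤ f x)
    (hg0 : ∀ x, 0 ≤ g x) (hh0 : ∀ x, 0 ≤ h x) (hf1 : BddAbove (range f)) (hg1 : BddAbove (range g))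
    (H : ∀ x y, f x ^ t * g y ^ (1 - t) ≤ h (t * x + (1 - t) * y)) :
    (∫⁻ x, ENNReal.ofReal (f x)) ^ t * (∫⁻ x, ENNReal.ofReal (g x)) ^ (1 - t) ≤
      ∫⁻ x, ENNReal.ofReal (h x) := by
  have hs : 0 < 1 - t := by linarith
  set F := ⨆ x, f x with hF
  set G := ⨆ x, g x with hG
  have hFle : ∀ x, f x ≤ F := fun x => le_ciSup hf1 x
  have hGle : ∀ x, g x ≤ G := fun x => le_ciSup hg1 x
  rcases eq_or_lt_of_le ((hf0 0).trans (hFle 0)) with hF0 | hF0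
  · have : ∀ x, f x = 0 := fun x => le_antisymm ((hFle x).trans hF0.ge) (hf0 x)
    simp [this, ht0]
  rcases eq_or_lt_of_le ((hg0 0).trans (hGle 0)) with hG0 | hG0
  · have : ∀ x, g x = 0 := fun x => le_antisymm ((hGle x).trans hG0.ge) (hg0 x)
    simp [this, hs]
  have hM : 0 < F ^ t * G ^ (1 - t) := by positivity
  have key := prekopa_leindler_normalized ht0 ht1 (hf.div_const F) (hg.div_const G)
    (hh.div_const (F ^ t * G ^ (1 - t))) (fun x => div_nonneg (hf0 x) hF0.le)
    (fun x => div_nonneg (hg0 x) hG0.le) (fun x => div_nonneg (hh0 x) hM.le)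
    (isLUB_div_iSup hf1 hF0) (isLUB_div_iSup hg1 hG0) (by
      intro x y
      rw [Real.div_rpow (hf0 x) hF0.le, Real.div_rpow (hg0 y) hG0.le, div_mul_div_comm]
      gcongr
      exact H x y)
  have e : ∀ (φ : ℝ → ℝ) (c : ℝ), 0 < c → ∫⁻ x, ENNReal.ofReal (φ x) =
      ENNReal.ofReal c * ∫⁻ x, ENNReal.ofReal (φ x / c) := by
    intro φ c hc
    rw [← lintegral_const_mul' _ _ (by simp)]
    refine lintegral_congr fun x => ?_
    rw [← ENNReal.ofReal_mul hc.le, mul_div_cancel₀ _ hc.ne']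
  rw [e f F hF0, e g G hG0, e h _ hM, ENNReal.mul_rpow_of_nonneg _ _ ht0.le,
    ENNReal.mul_rpow_of_nonneg _ _ hs.le, ENNReal.ofReal_rpow_of_nonneg hF0.le ht0.le,
    ENNReal.ofReal_rpow_of_nonneg hG0.le hs.le, mul_mul_mul_comm,
        ← ENNReal.ofReal_mul (by positivity)]
  gcongr

/-- The multiplicative Brunn–Minkowski inequality with weight `t` for compact sets in `E`. -/
def MulBrunnMinkowski (E : Type*) [AddCommGroup E] [Module ℝ E] [TopologicalSpace E]
    [MeasureSpace E] (t : ℝ) : Prop :=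
  ∀ X Y : Set E, IsCompact X → IsCompact Y →
    volume X ^ t * volume Y ^ (1 - t) ≤ volume (t • X + (1 - t) • Y)

theorem isCompact_combo {E : Type*} [AddCommGroup E] [Module ℝ E] [TopologicalSpace E]
    [ContinuousAdd E] [ContinuousConstSMul ℝ E] {X Y : Set E} (hX : IsCompact X) (hY : IsCompact Y)
    (t : ℝ) : IsCompact (t • X + (1 - t) • Y) := (hX.smul t).add (hY.smul _)

theorem mulBrunnMinkowski_prod {n : ℕ} {t : ℝ} (ht0 : 0 < t) (ht1 : t < 1)
    (hα : MulBrunnMinkowski (Fin n → ℝ) t) : MulBrunnMinkowski (ℝ × (Fin n → ℝ)) t := by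
  intro X Y hX hY
  have hs : 0 < 1 - t := by linarith
  have fib : ∀ {X : Set (ℝ × (Fin n → ℝ))}, IsCompact X →
      (∀ s, IsCompact (Prod.mk s ⁻¹' X)) ∧
      Measurable (fun s => (volume (Prod.mk s ⁻¹' X)).toReal) ∧
      (∀ s, volume (Prod.mk s ⁻¹' X) ≠ ⊤) ∧
      BddAbove (range fun s => (volume (Prod.mk s ⁻¹' X)).toReal) ∧
      volume X = ∫⁻ s, ENNReal.ofReal (volume (Prod.mk s ⁻¹' X)).toReal := by
    intro X hX
    have hsub : ∀ s, Prod.mk s ⁻¹' X ⊆ Prod.snd '' X := fun s y hy => ⟨_, hy, rfl⟩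
    have hc : IsCompact (Prod.snd '' X) := hX.image continuous_snd
    have hfin : ∀ s, volume (Prod.mk s ⁻¹' X) ≠ ⊤ := fun s =>
      ((measure_mono (hsub s)).trans_lt hc.measure_lt_top).ne
    refine ⟨fun s => hc.of_isClosed_subset (hX.isClosed.preimage (by fun_prop)) (hsub s),
      (measurable_measure_prodMk_left hX.measurableSet).ennreal_toReal, hfin,
      ⟨(volume (Prod.snd '' X)).toReal, ?_⟩, ?_⟩
    · rintro _ ⟨s, rfl⟩
      exact ENNReal.toReal_mono hc.measure_lt_top.ne (measure_mono (hsub s))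
    · rw [Measure.volume_eq_prod, Measure.prod_apply hX.measurableSet]
      exact lintegral_congr fun s => (ENNReal.ofReal_toReal (hfin s)).symm
  obtain ⟨cX, mX, fX, bX, vX⟩ := fib hX
  obtain ⟨cY, mY, fY, bY, vY⟩ := fib hY
  obtain ⟨-, mZ, fZ, -, vZ⟩ := fib (isCompact_combo hX hY t)
  rw [vX, vY, vZ]
  refine prekopa_leindler ht0 ht1 mX mY mZ (fun _ => ENNReal.toReal_nonneg)
    (fun _ => ENNReal.toReal_nonneg) (fun _ => ENNReal.toReal_nonneg) bX bY fun x y => ?_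
  rw [ENNReal.toReal_rpow, ENNReal.toReal_rpow, ← ENNReal.toReal_mul]
  refine ENNReal.toReal_mono (fZ _) ((hα _ _ (cX x) (cY y)).trans (measure_mono ?_))
  rintro _ ⟨_, ⟨a, ha, rfl⟩, _, ⟨b, hb, rfl⟩, rfl⟩
  exact ⟨_, ⟨_, ha, rfl⟩, _, ⟨_, hb, rfl⟩, rfl⟩

/-- The measure-preserving linear identification of `ℝ × ℝⁿ` with `ℝⁿ⁺¹` that inserts the first
factor as the `k`-th coordinate. -/
noncomputable def insertEquiv {n : ℕ} (k : Fin (n + 1)) :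
    (ℝ × (Fin n → ℝ)) ≃ₗ[ℝ] (Fin (n + 1) → ℝ) :=
  { toFun := fun p => k.insertNth p.1 p.2
    invFun := fun x => (x k, k.removeNth x)
    left_inv := fun p => by simp
    right_inv := fun x => by simp
    map_add' := fun p q => by
      ext i; refine Fin.succAboveCases k ?_ (fun j => ?_) i <;> simp
    map_smul' := fun c p => by
      ext i; refine Fin.succAboveCases k ?_ (fun j => ?_) i <;> simp }

theorem insertEquiv_apply {n : ℕ} (k : Fin (n + 1)) (p : ℝ × (Fin n → ℝ)) :
    insertEquiv k p = k.insertNth p.1 p.2 := rfl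

theorem continuous_insertEquiv {n : ℕ} (k : Fin (n + 1)) : Continuous (insertEquiv k) :=
  LinearMap.continuous_of_finiteDimensional (insertEquiv k).toLinearMap

theorem continuous_insertEquiv_symm {n : ℕ} (k : Fin (n + 1)) :
    Continuous (insertEquiv (n := n) k).symm :=
  LinearMap.continuous_of_finiteDimensional (insertEquiv k).symm.toLinearMap

theorem volume_insertEquiv_preimage {n : ℕ} (k : Fin (n + 1)) (A : Set (Fin (n + 1) → ℝ)) :
    volume (insertEquiv k ⁻¹' A) = volume A :=
  (volume_preserving_piFinSuccAbove (fun _ : Fin (n + 1) => ℝ) k).symm.measure_preimage_equiv A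

theorem isCompact_insertEquiv_preimage {n : ℕ} (k : Fin (n + 1)) {A : Set (Fin (n + 1) → ℝ)}
    (hA : IsCompact A) : IsCompact (insertEquiv k ⁻¹' A) := by
  have : insertEquiv k ⁻¹' A = (insertEquiv k).symm '' A :=
    ((insertEquiv k).toEquiv.symm.image_eq_preimage_symm A).symm
  rw [this]
  exact hA.image (continuous_insertEquiv_symm k)

theorem preimage_combo {E F : Type*} [AddCommGroup E] [Module ℝ E] [AddCommGroup F] [Module ℝ F]
    (e : E ≃ₗ[ℝ] F) (t s : ℝ) (X Y : Set F) :
    e ⁻¹' (t • X + s • Y) = t • (e ⁻¹' X) + s • (e ⁻¹' Y) := by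
  ext z
  constructor
  · rintro ⟨_, ⟨x, hx, rfl⟩, _, ⟨y, hy, rfl⟩, h⟩
    refine ⟨_, ⟨e.symm x, by simpa using hx, rfl⟩, _, ⟨e.symm y, by simpa using hy, rfl⟩, ?_⟩
    apply e.injective
    simpa using h
  · rintro ⟨_, ⟨x, hx, rfl⟩, _, ⟨y, hy, rfl⟩, rfl⟩
    refine ⟨_, ⟨e x, hx, rfl⟩, _, ⟨e y, hy, rfl⟩, ?_⟩
    simp

theorem mulBrunnMinkowski_pi {t : ℝ} (ht0 : 0 < t) (ht1 : t < 1) (n : ℕ) :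
    MulBrunnMinkowski (Fin n → ℝ) t := by
  induction n with
  | zero =>
    intro X Y _ _
    rcases X.eq_empty_or_nonempty with rfl | ⟨x, hx⟩
    · simp [ht0]
    rcases Y.eq_empty_or_nonempty with rfl | ⟨y, hy⟩
    · simp [ht1]
    have h1 : ∀ Z : Set (Fin 0 → ℝ), Z.Nonempty → volume Z = 1 := by
      intro Z hZ
      have : Z = univ := Subsingleton.eq_univ_of_nonempty hZ
      subst this
      rw [volume_pi, Measure.pi_of_empty]
      simp
    rw [h1 X ⟨x, hx⟩, h1 Y ⟨y, hy⟩, h1]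
    · simp
    · exact ⟨_, _, ⟨x, hx, rfl⟩, _, ⟨y, hy, rfl⟩, rfl⟩
  | succ n ih =>
    intro X Y hX hY
    have := mulBrunnMinkowski_prod ht0 ht1 ih _ _ (isCompact_insertEquiv_preimage 0 hX)
      (isCompact_insertEquiv_preimage 0 hY)
    rwa [← preimage_combo, volume_insertEquiv_preimage, volume_insertEquiv_preimage,
      volume_insertEquiv_preimage] at this

/-- If `E` satisfies the multiplicative Brunn–Minkowski inequality, then a Minkowski combination
of two measurable sets is at least as large as the smaller of the two. -/
theorem MulBrunnMinkowski.le_volume {E : Type*} [AddCommGroup E] [Module ℝ E] [TopologicalSpace E]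
    [MeasureSpace E] [(volume : Measure E).InnerRegular] {t : ℝ} (ht0 : 0 < t) (ht1 : t < 1)
    (hE : MulBrunnMinkowski E t) {X Y : Set E} (hX : MeasurableSet X) (hY : MeasurableSet Y)
    {c : ℝ≥0∞} (hcX : c ≤ volume X) (hcY : c ≤ volume Y) :
    c ≤ volume (t • X + (1 - t) • Y) := by
  refine le_of_forall_lt fun r hr => ?_
  obtain ⟨K, hKX, hK, hrK⟩ := hX.exists_lt_isCompact (hr.trans_le hcX)
  obtain ⟨L, hLY, hL, hrL⟩ := hY.exists_lt_isCompact (hr.trans_le hcY)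
  obtain ⟨r', hr', hr'K⟩ := exists_between (lt_min hrK hrL)
  refine hr'.trans_le ?_
  calc r' = r' ^ t * r' ^ (1 - t) := by
        rw [← ENNReal.rpow_add_of_nonneg _ _ ht0.le (by linarith)]; simp
    _ ≤ volume K ^ t * volume L ^ (1 - t) := by
        gcongr
        · exact hr'K.le.trans (min_le_left _ _)
        · exact hr'K.le.trans (min_le_right _ _)
    _ ≤ _ := (hE K L hK hL).trans (measure_mono (by gcongr))

instance isProbabilityMeasure_unitAddCircle :
    IsProbabilityMeasure (volume : Measure UnitAddCircle) := ⟨UnitAddCircle.measure_univ⟩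

theorem continuous_volume_inter_preimage_add {X Y : Set UnitAddCircle} (hX : IsClosed X) :
    Continuous fun g : UnitAddCircle => (volume (Y ∩ (fun x => g + x) ⁻¹' X)).toReal := by
  rw [continuous_iff_continuousAt]
  intro g₀
  have h0 : Filter.Tendsto (fun g : UnitAddCircle =>
      volume (symmDiff ((fun x => g + x) ⁻¹' X) ((fun x => g₀ + x) ⁻¹' X)))
      (nhds g₀) (nhds 0) := by
    refine tendsto_measure_symmDiff_preimage_nhds_zero
      (f := fun g : UnitAddCircle => (⟨fun x => g + x, by fun_prop⟩ :
        C(UnitAddCircle, UnitAddCircle)))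
      (g := ⟨fun x => g₀ + x, by fun_prop⟩) (ν := volume) ?_
      (.of_forall fun g => measurePreserving_add_left volume g)
        (measurePreserving_add_left volume g₀)
      hX.measurableSet.nullMeasurableSet (measure_ne_top _ _)
    have : Continuous fun g : UnitAddCircle =>
        (⟨fun x => g + x, by fun_prop⟩ : C(UnitAddCircle, UnitAddCircle)) :=
      ContinuousMap.continuous_of_continuous_uncurry _ (by
        simp only [Function.uncurry_def, ContinuousMap.coe_mk]; fun_prop)
    exact this.tendsto g₀
  have h1 := (ENNReal.tendsto_toReal ENNReal.zero_ne_top).comp h0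
  rw [ENNReal.toReal_zero] at h1
  refine tendsto_iff_dist_tendsto_zero.2 (squeeze_zero (fun _ => dist_nonneg) (fun g => ?_) h1)
  have aux : ∀ P Q : Set UnitAddCircle, (volume (Y ∩ P)).toReal ≤
      (volume (Y ∩ Q)).toReal + (volume (symmDiff P Q)).toReal := by
    intro P Q
    rw [← ENNReal.toReal_add (measure_ne_top _ _) (measure_ne_top _ _)]
    refine ENNReal.toReal_mono (by finiteness) ((measure_mono ?_).trans (measure_union_le _ _))
    rintro x ⟨hx, hP⟩
    by_cases hQ : x ∈ Q
    · exact Or.inl ⟨hx, hQ⟩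
    · exact Or.inr (Or.inl ⟨hP, hQ⟩)
  rw [Real.dist_eq, abs_le]
  constructor
  · have := aux ((fun x => g₀ + x) ⁻¹' X) ((fun x => g + x) ⁻¹' X)
    rw [symmDiff_comm] at this
    simp only [Function.comp]
    linarith
  · have := aux ((fun x => g + x) ⁻¹' X) ((fun x => g₀ + x) ⁻¹' X)
    simp only [Function.comp]
    linarith

theorem lintegral_volume_inter_preimage_add {X Y : Set UnitAddCircle} (hX : IsClosed X)
    (hY : IsClosed Y) :
    ∫⁻ g : UnitAddCircle, volume (Y ∩ (fun x => g + x) ⁻¹' X) = volume X * volume Y := by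
  set S : Set (UnitAddCircle × UnitAddCircle) := {p | p.2 ∈ Y ∧ p.1 + p.2 ∈ X} with hS
  have hSc : IsClosed S := (hY.preimage continuous_snd).inter (hX.preimage continuous_add)
  have h1 := Measure.prod_apply (μ := volume) (ν := volume) hSc.measurableSet
  have h2 := Measure.prod_apply_symm (μ := volume) (ν := volume) hSc.measurableSet
  calc _ = ∫⁻ x, volume ((fun g => (g, x)) ⁻¹' S) := by rw [← h2, h1]; rfl
    _ = ∫⁻ x, Y.indicator (fun _ => volume X) x := by
        refine lintegral_congr fun x => ?_
        by_cases hx : x ∈ Y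
        · rw [indicator_of_mem hx]
          have : (fun g => (g, x)) ⁻¹' S = (fun g => g + x) ⁻¹' X := by
            ext g; simp [hS, hx]
          rw [this, measure_preimage_add_right]
        · rw [indicator_of_notMem hx]
          have : (fun g => (g, x)) ⁻¹' S = ∅ := by
            ext g; simp [hS, hx]
          rw [this, measure_empty]
    _ = _ := by rw [lintegral_indicator_const hY.measurableSet]

/-- One step of the Dyson transform on the circle. -/
theorem exists_dyson_transform {X Y : Set UnitAddCircle} (hX : IsClosed X) (hY : IsClosed Y) :
    ∃ X' Y' : Set UnitAddCircle, IsClosed X' ∧ IsClosed Y' ∧ X' + Y' ⊆ X + Y ∧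
      (volume Y').toReal = (volume X).toReal * (volume Y).toReal ∧
      (volume X').toReal + (volume Y').toReal = (volume X).toReal + (volume Y).toReal := by
  set φ := fun g : UnitAddCircle => volume (Y ∩ (fun x => g + x) ⁻¹' X) with hφ
  have hcont : Continuous fun g => (φ g).toReal := continuous_volume_inter_preimage_add hX
  have h_int : ∫⁻ g, φ g = volume X * volume Y := lintegral_volume_inter_preimage_add hX hY
  have hmeas : AEMeasurable φ volume := by
    have : φ = fun g => ENNReal.ofReal (φ g).toReal := by
      ext g; rw [ENNReal.ofReal_toReal (measure_ne_top _ _)]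
    rw [this]
    exact hcont.measurable.ennreal_ofReal.aemeasurable
  obtain ⟨g₁, hg₁⟩ := exists_le_lintegral hmeas
  obtain ⟨g₂, hg₂⟩ := exists_lintegral_le (f := φ) (μ := volume) (by rw [h_int]; finiteness)
  rw [h_int] at hg₁ hg₂
  have := mem_range_of_exists_le_of_exists_ge (c := (volume X * volume Y).toReal) hcont
    ⟨g₁, ENNReal.toReal_mono (by finiteness) hg₁⟩ ⟨g₂, ENNReal.toReal_mono (measure_ne_top _ _) hg₂⟩
  obtain ⟨g, hg⟩ := this
  have hXg : IsClosed ((fun x => g + x) ⁻¹' X) := hX.preimage (by fun_prop)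
  refine ⟨X ∪ (fun y => -g + y) ⁻¹' Y, Y ∩ (fun x => g + x) ⁻¹' X,
    hX.union (hY.preimage (by fun_prop)), hY.inter hXg, ?_, ?_, ?_⟩
  · rintro _ ⟨x, hx, y, ⟨hyY, hyX⟩, rfl⟩
    rcases hx with hx | hx
    · exact ⟨x, hx, y, hyY, rfl⟩
    · refine ⟨g + y, hyX, -g + x, hx, ?_⟩
      simp only
      abel
  · rw [← ENNReal.toReal_mul]; exact hg
  · have e1 := measure_union_add_inter (μ := volume) X
      ((hY.preimage (f := fun y => -g + y) (by fun_prop)).measurableSet)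
    rw [measure_preimage_add] at e1
    have e2 : volume (X ∩ (fun y => -g + y) ⁻¹' Y) = volume (Y ∩ (fun x => g + x) ⁻¹' X) := by
      rw [← measure_preimage_add volume g]
      congr 1
      ext x
      simp [and_comm]
    rw [e2] at e1
    rw [← ENNReal.toReal_add (measure_ne_top _ _) (measure_ne_top _ _), e1,
      ENNReal.toReal_add (measure_ne_top _ _) (measure_ne_top _ _)]

theorem volume_add_circle_of_lt {X Y : Set UnitAddCircle} (hX : IsClosed X) (hY : IsClosed Y)
    (hX0 : volume X ≠ 0) (hY0 : volume Y ≠ 0)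
    (h1 : (volume X).toReal + (volume Y).toReal < 1) :
    (volume X).toReal + (volume Y).toReal ≤ (volume (X + Y)).toReal := by
  set r := (volume X).toReal + (volume Y).toReal with hr
  have hr0 : 0 ≤ r := by positivity
  have key : ∀ n : ℕ, ∃ X' Y' : Set UnitAddCircle, IsClosed X' ∧ IsClosed Y' ∧ X' + Y' ⊆ X + Y ∧
      0 < (volume X').toReal ∧ 0 < (volume Y').toReal ∧ (volume Y').toReal ≤ r ^ n ∧
      (volume X').toReal + (volume Y').toReal = r := by
    intro n
    induction n with
    | zero =>
      refine ⟨X, Y, hX, hY, Subset.rfl, ENNReal.toReal_pos hX0 (measure_ne_top _ _),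
        ENNReal.toReal_pos hY0 (measure_ne_top _ _), ?_, rfl⟩
      have : 0 ≤ (volume X).toReal := ENNReal.toReal_nonneg
      simp only [pow_zero]; linarith
    | succ n ih =>
      obtain ⟨P, Q, hP, hQ, hsub, hP0, hQ0, hQn, hs⟩ := ih
      obtain ⟨P', Q', hP', hQ', hsub', hmul, hadd⟩ := exists_dyson_transform hP hQ
      refine ⟨P', Q', hP', hQ', hsub'.trans hsub, ?_, ?_, ?_, hadd.trans hs⟩
      · nlinarith
      · rw [hmul]; positivity
      · rw [hmul, pow_succ]
        nlinarith
  refine le_of_forall_pos_le_add fun ε hε => ?_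
  obtain ⟨n, hn⟩ := exists_pow_lt_of_lt_one hε h1
  obtain ⟨P, Q, hP, hQ, hsub, hP0, hQ0, hQn, hs⟩ := key n
  have hne : Q.Nonempty := by
    by_contra h
    rw [not_nonempty_iff_eq_empty] at h
    simp [h] at hQ0
  obtain ⟨q, hq⟩ := hne
  have : (volume P).toReal ≤ (volume (X + Y)).toReal := by
    refine ENNReal.toReal_mono (measure_ne_top _ _) ?_
    calc volume P = volume ((fun x => x + -q) ⁻¹' P) := (measure_preimage_add_right _ _ _).symm
      _ ≤ _ := measure_mono fun z hz => hsub ⟨z + -q, hz, q, hq, by simp⟩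
  linarith

/-- Raikov's inequality on the circle. -/
theorem min_le_volume_add_circle {X Y : Set UnitAddCircle} (hX : IsClosed X) (hY : IsClosed Y)
    (hX0 : X.Nonempty) (hY0 : Y.Nonempty) :
    min 1 (volume X + volume Y) ≤ volume (X + Y) := by
  obtain ⟨x₀, hx₀⟩ := hX0
  obtain ⟨y₀, hy₀⟩ := hY0
  have hXle : volume X ≤ volume (X + Y) := by
    calc volume X = volume ((fun x => x + -y₀) ⁻¹' X) := (measure_preimage_add_right _ _ _).symm
      _ ≤ volume (X + Y) := measure_mono fun z hz => ⟨z + -y₀, hz, y₀, hy₀, by simp⟩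
  have hYle : volume Y ≤ volume (X + Y) := by
    calc volume Y = volume ((fun x => -x₀ + x) ⁻¹' Y) := (measure_preimage_add _ _ _).symm
      _ ≤ volume (X + Y) := measure_mono fun z hz => ⟨x₀, hx₀, -x₀ + z, hz, by simp⟩
  by_cases hX1 : volume X = 0
  · rw [hX1, zero_add]; exact (min_le_right _ _).trans hYle
  by_cases hY1 : volume Y = 0
  · rw [hY1, add_zero]; exact (min_le_right _ _).trans hXle
  rcases lt_or_ge ((volume X).toReal + (volume Y).toReal) 1 with h | h
  · refine (min_le_right _ _).trans ?_
    have := volume_add_circle_of_lt hX hY hX1 hY1 h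
    rw [← ENNReal.toReal_add (measure_ne_top _ _) (measure_ne_top _ _)] at this
    exact (ENNReal.toReal_le_toReal (by finiteness) (measure_ne_top _ _)).1 this
  · refine (min_le_left _ _).trans ?_
    suffices X + Y = univ by rw [this]; simp
    refine eq_univ_of_forall fun z => ?_
    by_contra hz
    set Q := (fun y => z - y) ⁻¹' Y with hQ
    have hQc : IsClosed Q := hY.preimage (by fun_prop)
    have hQv : volume Q = volume Y := (Measure.measurePreserving_sub_left volume z).measure_preimage
      hY.measurableSet.nullMeasurableSet
    have hdisj : Disjoint X Q := by
      rw [Set.disjoint_left]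
      intro x hx hxQ
      exact hz ⟨x, hx, z - x, hxQ, by simp⟩
    have hun : volume (X ∪ Q) = volume X + volume Y := by
      rw [measure_union hdisj hQc.measurableSet, hQv]
    have h1 : (1 : ℝ≥0∞) ≤ volume (X ∪ Q) := by
      rw [hun]
      rw [← ENNReal.toReal_add (measure_ne_top _ _) (measure_ne_top _ _)] at h
      simpa using (ENNReal.le_ofReal_iff_toReal_le (a := 1)
          (by simp) (zero_le_one.trans h)).2 (by simpa using h) |>.trans
        (ENNReal.ofReal_toReal_le)
    have hcompl : volume (X ∪ Q)ᶜ = 0 := by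
      rw [prob_compl_eq_zero_iff (hX.union hQc).measurableSet]
      exact le_antisymm prob_le_one h1
    have hu : X ∪ Q = univ := by
      have := ((hX.union hQc).isOpen_compl.measure_eq_zero_iff volume).1 hcompl
      rwa [compl_empty_iff] at this
    have hXQ : Xᶜ = Q := by
      ext w
      have := hu.ge (mem_univ w)
      constructor
      · intro hw; exact this.resolve_left hw
      · intro hw hwX; exact Set.disjoint_left.1 hdisj hwX hw
    have hclopen : IsClopen X := ⟨hX, by rw [← isClosed_compl_iff, hXQ]; exact hQc⟩
    rcases isClopen_iff.1 hclopen with h' | h'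
    · rw [h'] at hx₀; exact hx₀
    · have : z - y₀ ∈ X := by rw [h']; trivial
      exact hz ⟨z - y₀, this, y₀, hy₀, by simp⟩

theorem volume_le_volume_image_circle {S : Set ℝ} (hS : S ⊆ Icc 0 1) (hSc : IsCompact S) :
    volume S ≤ volume ((fun x : ℝ => (x : UnitAddCircle)) '' S) := by
  have hc : IsClosed ((fun x : ℝ => (x : UnitAddCircle)) '' S) :=
    (hSc.image (AddCircle.continuous_mk' 1)).isClosed
  rw [← (UnitAddCircle.measurePreserving_mk 0).measure_preimage
    hc.measurableSet.nullMeasurableSet, Measure.restrict_apply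
    ((AddCircle.measurable_mk' (a := (1 : ℝ))) hc.measurableSet)]
  calc volume S ≤ volume ((S ∩ Ioc 0 1) ∪ {0}) := measure_mono fun x hx => by
        rcases eq_or_lt_of_le (hS hx).1 with h | h
        · exact Or.inr h.symm
        · exact Or.inl ⟨hx, h, (hS hx).2⟩
    _ ≤ volume (S ∩ Ioc 0 1) + volume {(0 : ℝ)} := measure_union_le _ _
    _ = volume (S ∩ Ioc 0 1) := by simp
    _ ≤ _ := measure_mono fun x hx => by
        refine ⟨⟨x, hx.1, rfl⟩, by simpa using hx.2⟩

theorem min_le_volume_wrapped_combo {t : ℝ} (ht0 : 0 < t) (ht2 : t ≤ 1 / 2) {P Q : Set ℝ}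
    (hP : IsCompact P) (hQ : IsCompact Q) (hP1 : P ⊆ Icc 0 1) (hQ1 : Q ⊆ Icc 0 1)
    (hP0 : P.Nonempty) (hQ0 : Q.Nonempty) :
    min (ENNReal.ofReal (1 - t)) (ENNReal.ofReal t * volume P + ENNReal.ofReal (1 - t) * volume Q) ≤
      volume {w : ℝ | (0 ≤ w ∧ w ≤ 1 - t) ∧ (w ∈ t • P + (1 - t) • Q ∨
        w + (1 - t) ∈ t • P + (1 - t) • Q)} := by
  set r := 1 - t with hr
  have hr0 : 0 < r := by linarith
  have htr : t / r ≤ 1 := (div_le_one hr0).2 (by linarith)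
  set m := fun x : ℝ => (x : UnitAddCircle) with hm
  have hmc : Continuous m := AddCircle.continuous_mk' 1
  have hP1' : (t / r) • P ⊆ Icc 0 1 := by
    rintro _ ⟨p, hp, rfl⟩
    have h0 := (hP1 hp).1
    have h1 := (hP1 hp).2
    have : 0 ≤ t / r := by positivity
    simp only [smul_eq_mul, mem_Icc]
    constructor
    · positivity
    · nlinarith
  have hX := volume_le_volume_image_circle hP1' (hP.smul _)
  have hY := volume_le_volume_image_circle hQ1 hQ
  have hXc : IsClosed (m '' ((t / r) • P)) := ((hP.smul _).image hmc).isClosed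
  have hYc : IsClosed (m '' Q) := (hQ.image hmc).isClosed
  have key := min_le_volume_add_circle hXc hYc ((hP0.smul_set).image _) (hQ0.image _)
  set W := {w : ℝ | (0 ≤ w ∧ w ≤ r) ∧ (w ∈ t • P + r • Q ∨ w + r ∈ t • P + r • Q)} with hW
  have hXYc : IsClosed (m '' ((t / r) • P) + m '' Q) :=
    (((hP.smul _).image hmc).add (hQ.image hmc)).isClosed
  rw [← (UnitAddCircle.measurePreserving_mk 0).measure_preimage
    hXYc.measurableSet.nullMeasurableSet, Measure.restrict_apply
    ((AddCircle.measurable_mk' (a := (1 : ℝ))) hXYc.measurableSet)] at key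
  set Z := ((fun x : ℝ => (x : UnitAddCircle)) ⁻¹' (m '' ((t / r) • P) + m '' Q)) ∩ Ioc 0 (0 + 1)
    with hZ
  have hZW : r • Z ⊆ W ∪ {r} := by
    rintro _ ⟨s, ⟨⟨_, ⟨_, ⟨p, hp, rfl⟩, rfl⟩, _, ⟨q, hq, rfl⟩, hs⟩, hs0, hs1⟩, rfl⟩
    rw [zero_add] at hs1
    rcases eq_or_lt_of_le hs1 with rfl | hs1
    · right; simp
    left
    simp only [hm, smul_eq_mul, ← AddCircle.coe_add] at hs
    rw [← sub_eq_zero, ← AddCircle.coe_sub, AddCircle.coe_eq_zero_iff] at hs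
    obtain ⟨n, hn⟩ := hs
    rw [zsmul_eq_mul, mul_one] at hn
    have hp' := hP1' ⟨p, hp, rfl⟩
    simp only [smul_eq_mul, mem_Icc] at hp'
    have hq' := hQ1 hq
    have n0 : (-1 : ℝ) < n := by rw [hn]; linarith [hq'.1]
    have n1 : (n : ℝ) < 2 := by rw [hn]; linarith [hq'.2]
    have n0' : -1 < n := by exact_mod_cast n0
    have n1' : n < 2 := by exact_mod_cast n1
    have hmem : t * p + r * q ∈ t • P + r • Q := ⟨_, ⟨p, hp, rfl⟩, _, ⟨q, hq, rfl⟩, rfl⟩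
    have e : t * p + r * q = r * (t / r * p + q) := by field_simp
    refine ⟨⟨by simp only [smul_eq_mul]; positivity, by simp only [smul_eq_mul]; nlinarith⟩, ?_⟩
    interval_cases n
    · left
      have : s = t / r * p + q := by push_cast at hn; linarith
      rw [this]
      rwa [e] at hmem
    · right
      have : t / r * p + q = s + 1 := by push_cast at hn; linarith
      rw [e, this, mul_add, mul_one] at hmem
      exact hmem
  calc min (ENNReal.ofReal r) (ENNReal.ofReal t * volume P + ENNReal.ofReal r * volume Q)
      ≤ ENNReal.ofReal r * min 1 (volume (m '' ((t / r) • P)) + volume (m '' Q)) := by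
        rw [mul_min, mul_one, mul_add]
        refine min_le_min_left _ (add_le_add ?_ (by gcongr))
        calc ENNReal.ofReal t * volume P = ENNReal.ofReal r * volume ((t / r) • P) := by
              rw [volume_real_smul (by positivity), ← mul_assoc, ← ENNReal.ofReal_mul hr0.le,
                mul_div_cancel₀ _ hr0.ne']
          _ ≤ _ := by gcongr
    _ ≤ ENNReal.ofReal r * volume Z := by gcongr
    _ = volume (r • Z) := (volume_real_smul hr0.le _).symm
    _ ≤ volume (W ∪ {r}) := measure_mono hZW
    _ ≤ volume W + volume {r} := measure_union_le _ _
    _ = volume W := by simp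

theorem volume_eq_union_add_inter_translate {E : Type*} [AddCommGroup E] [MeasurableSpace E]
    [MeasurableAdd E] (μ : Measure E) [μ.IsAddLeftInvariant] {D H : Set E} (hD : MeasurableSet D)
    (hH : MeasurableSet H) (e : E) :
    μ D = μ ((D ∩ H) ∪ (fun x => e + x) ⁻¹' (D \ H)) +
      μ ((D ∩ H) ∩ (fun x => e + x) ⁻¹' (D \ H)) := by
  rw [measure_union_add_inter _ ((measurable_const_add e) (hD.diff hH)), measure_preimage_add,
    measure_inter_add_sdiff _ hH]

theorem volume_le_volume_unit_combo {t : ℝ} (ht0 : 0 < t) (ht2 : t ≤ 1 / 2) {R : Set ℝ}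
    (hR : IsCompact R) (hR1 : R ⊆ Icc 0 1) (h0 : (0 : ℝ) ∈ R) (h1 : (1 : ℝ) ∈ R) :
    min (ENNReal.ofReal (1 - t)) (volume R) + ENNReal.ofReal t * volume R ≤
      volume (t • R + (1 - t) • R) := by
  have hD : IsCompact (t • R + (1 - t) • R) := isCompact_combo hR hR t
  rw [volume_eq_union_add_inter_translate volume hD.measurableSet
    (measurableSet_Iio (a := 1 - t)) (1 - t)]
  have hnull : ∀ S T : Set ℝ, S ⊆ T ∪ {1 - t} → volume S ≤ volume T := fun S T h =>
    (measure_mono h).trans ((measure_union_le _ _).trans (by simp))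
  refine add_le_add ?_ ?_
  · have := min_le_volume_wrapped_combo ht0 ht2 hR hR hR1 hR1 ⟨0, h0⟩ ⟨0, h0⟩
    rw [← add_mul, ← ENNReal.ofReal_add ht0.le (by linarith), add_sub_cancel, ENNReal.ofReal_one,
      one_mul] at this
    refine this.trans (hnull _ _ ?_)
    rintro w ⟨⟨hw0, hw1⟩, hw | hw⟩
    · rcases eq_or_lt_of_le hw1 with h | h
      · exact Or.inr h
      · exact Or.inl (Or.inl ⟨hw, h⟩)
    · refine Or.inl (Or.inr ?_)
      refine ⟨by rwa [add_comm w] at hw, ?_⟩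
      simpa using hw0
  · rw [← volume_real_smul ht0.le]
    refine hnull _ _ ?_
    rintro _ ⟨p, hp, rfl⟩
    have hp1 := hR1 hp
    by_cases h : t • p = 1 - t
    · exact Or.inr h
    left
    simp only [smul_eq_mul] at h ⊢
    have hlt : t * p < 1 - t := lt_of_le_of_ne (by nlinarith [hp1.2]) h
    refine ⟨⟨⟨_, ⟨p, hp, rfl⟩, _, ⟨0, h0, rfl⟩, by simp⟩, hlt⟩,
      ⟨⟨_, ⟨p, hp, rfl⟩, _, ⟨1, h1, rfl⟩, by simp [add_comm]⟩, ?_⟩⟩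
    simp only [mem_Iio, not_lt]
    nlinarith [hp1.1]

theorem volume_add_min_le_volume_combo {t : ℝ} (ht0 : 0 < t) (ht2 : t ≤ 1 / 2) {R : Set ℝ}
    (hR : IsCompact R) {a b : ℝ} (ha : IsLeast R a) (hb : IsGreatest R b) :
    volume R + min (ENNReal.ofReal t * volume R)
      (ENNReal.ofReal (1 - t) * (ENNReal.ofReal (b - a) - volume R)) ≤
      volume (t • R + (1 - t) • R) := by
  have hab : a ≤ b := ha.2 hb.1
  have hRab : R ⊆ Icc a b := fun x hx => ⟨ha.2 hx, hb.2 hx⟩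
  rcases eq_or_lt_of_le hab with rfl | hlt
  · have : volume R = 0 := measure_mono_null hRab (by simp)
    simp [this]
  set L := b - a with hL
  have hL0 : 0 < L := by linarith
  set S := (fun x => a + L * x) ⁻¹' R with hS
  have himg : R = (fun x => a + x) '' (L • S) := by
    ext x
    constructor
    · intro hx
      refine ⟨x - a, ⟨(x - a) / L, ?_, ?_⟩, by ring⟩
      · simp only [hS, mem_preimage]
        rwa [mul_div_cancel₀ _ hL0.ne', add_sub_cancel]
      · simp only [smul_eq_mul]; field_simp
    · rintro ⟨_, ⟨y, hy, rfl⟩, rfl⟩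
      exact hy
  have hS1 : S ⊆ Icc 0 1 := by
    intro x hx
    have := hRab hx
    simp only [mem_Icc] at this ⊢
    constructor <;> nlinarith
  have hSc : IsCompact S := isCompact_Icc.of_isClosed_subset
    (hR.isClosed.preimage (by fun_prop)) hS1
  have h0 : (0 : ℝ) ∈ S := by simpa [hS] using ha.1
  have h1 : (1 : ℝ) ∈ S := by simpa [hS, hL] using hb.1
  have key := volume_le_volume_unit_combo ht0 ht2 hSc hS1 h0 h1
  have hvR : volume R = ENNReal.ofReal L * volume S := by
    conv_lhs => rw [himg]
    rw [image_add_left, measure_preimage_add, volume_real_smul hL0.le]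
  have hD : (fun x => a + x) '' (L • (t • S + (1 - t) • S)) ⊆ t • R + (1 - t) • R := by
    rintro _ ⟨_, ⟨_, ⟨_, ⟨x, hx, rfl⟩, _, ⟨y, hy, rfl⟩, rfl⟩, rfl⟩, rfl⟩
    refine ⟨_, ⟨_, hx, rfl⟩, _, ⟨_, hy, rfl⟩, ?_⟩
    simp only [smul_eq_mul]; ring
  have hvS : volume S ≤ 1 := (measure_mono hS1).trans (by simp)
  refine le_trans ?_ (measure_mono hD)
  rw [image_add_left, measure_preimage_add, volume_real_smul hL0.le]
  refine le_trans ?_ (mul_le_mul_right key _)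
  rw [hvR]
  lift volume S to NNReal using (hvS.trans_lt ENNReal.one_lt_top).ne with s
  have hs : s ≤ 1 := by exact_mod_cast hvS
  have hsr : (s : ℝ) ≤ 1 := by exact_mod_cast hs
  have hs0 : (0 : ℝ) ≤ s := s.2
  have e : (s : ℝ≥0∞) = ENNReal.ofReal s := by simp
  have ht1 : 0 ≤ 1 - t := by linarith
  rw [e, ← ENNReal.ofReal_mul hL0.le, ← ENNReal.ofReal_sub _ (by positivity),
    ← ENNReal.ofReal_mul ht0.le, ← ENNReal.ofReal_mul ht0.le, ← ENNReal.ofReal_mul ht1,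
    ← ENNReal.ofReal_min, ← ENNReal.ofReal_min,
    ← ENNReal.ofReal_add (by positivity) (le_min (by positivity)
      (mul_nonneg ht1 (by nlinarith))), ← ENNReal.ofReal_add (by positivity) (by positivity),
    ← ENNReal.ofReal_mul hL0.le]
  refine ENNReal.ofReal_le_ofReal ?_
  rcases le_total (1 - t) (s : ℝ) with h | h
  · rw [min_eq_left h]
    have := min_le_right (t * (L * s)) ((1 - t) * (L - L * s))
    nlinarith
  · rw [min_eq_right h]
    have := min_le_left (t * (L * s)) ((1 - t) * (L - L * s))
    nlinarith

instance isAddHaarMeasure_prod_pi {n : ℕ} :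
    (volume : Measure (ℝ × (Fin n → ℝ))).IsAddHaarMeasure :=
  inferInstanceAs (Measure.IsAddHaarMeasure ((volume : Measure ℝ).prod
    (volume : Measure (Fin n → ℝ))))

/-- The measure of the fibre over `y` of a set in `ℝ × ℝⁿ`. -/
noncomputable def fibreVolume {n : ℕ} (A : Set (ℝ × (Fin n → ℝ))) (y : Fin n → ℝ) : ℝ≥0∞ :=
  volume ((fun s : ℝ => (s, y)) ⁻¹' A)

theorem measurable_fibreVolume {n : ℕ} {A : Set (ℝ × (Fin n → ℝ))} (hA : MeasurableSet A) :
    Measurable (fibreVolume A) := measurable_measure_prodMk_right hA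

theorem lintegral_fibreVolume {n : ℕ} {A : Set (ℝ × (Fin n → ℝ))} (hA : MeasurableSet A) :
    ∫⁻ y, fibreVolume A y = volume A := by
  rw [Measure.volume_eq_prod, Measure.prod_apply_symm hA]; rfl

theorem volume_prod_hyperplane {n : ℕ} (c : ℝ) :
    volume {p : ℝ × (Fin n → ℝ) | p.1 = c} = 0 := by
  have : {p : ℝ × (Fin n → ℝ) | p.1 = c} = {c} ×ˢ univ := by ext; simp
  rw [this, Measure.volume_eq_prod, Measure.prod_prod]; simp

/-- The hypograph of the fibre measure. -/
def fibreHypograph {n : ℕ} (B : Set (Fin n → ℝ)) (A : Set (ℝ × (Fin n → ℝ))) :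
    Set (ℝ × (Fin n → ℝ)) := {p | p.2 ∈ B ∧ 0 ≤ p.1 ∧ ENNReal.ofReal p.1 ≤ fibreVolume A p.2}

theorem measurableSet_fibreHypograph {n : ℕ} {B : Set (Fin n → ℝ)} (hB : MeasurableSet B)
    {A : Set (ℝ × (Fin n → ℝ))} (hA : MeasurableSet A) : MeasurableSet (fibreHypograph B A) := by
  refine (measurable_snd hB).inter ((measurableSet_le measurable_const measurable_fst).inter
    (measurableSet_le (by fun_prop) ((measurable_fibreVolume hA).comp measurable_snd)))

theorem volume_setOf_ofReal_le (c : ℝ≥0∞) : volume {s : ℝ | 0 ≤ s ∧ ENNReal.ofReal s ≤ c} = c := by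
  rcases eq_or_ne c ⊤ with rfl | hc
  · have : {s : ℝ | 0 ≤ s ∧ ENNReal.ofReal s ≤ ⊤} = Ici 0 := by ext; simp
    rw [this]; simp
  · have : {s : ℝ | 0 ≤ s ∧ ENNReal.ofReal s ≤ c} = Icc 0 c.toReal := by
      ext s
      simp [ENNReal.ofReal_le_iff_le_toReal hc]
    rw [this]; simp [hc]

theorem volume_fibreHypograph {n : ℕ} {B : Set (Fin n → ℝ)} (hB : MeasurableSet B)
    {A : Set (ℝ × (Fin n → ℝ))} (hA : MeasurableSet A) :
    volume (fibreHypograph B A) = ∫⁻ y in B, fibreVolume A y := by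
  rw [Measure.volume_eq_prod, Measure.prod_apply_symm (measurableSet_fibreHypograph hB hA),
    ← lintegral_indicator hB]
  refine lintegral_congr fun y => ?_
  by_cases hy : y ∈ B
  · rw [indicator_of_mem hy]
    have : (fun s : ℝ => (s, y)) ⁻¹' fibreHypograph B A =
        {s : ℝ | 0 ≤ s ∧ ENNReal.ofReal s ≤ fibreVolume A y} := by
      ext s; simp [fibreHypograph, hy]
    rw [this, volume_setOf_ofReal_le]
  · rw [indicator_of_notMem hy]
    have : (fun s : ℝ => (s, y)) ⁻¹' fibreHypograph B A = ∅ := by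
      ext s; simp [fibreHypograph, hy]
    rw [this, measure_empty]

theorem finrank_prod_pi (n : ℕ) : Module.finrank ℝ (ℝ × (Fin n → ℝ)) = n + 1 := by
  rw [Module.finrank_prod]; simp [add_comm]

/-- If a set contains a full-length chord but all of its parallel fibres are short, then it has
large doubling. -/
theorem volume_combo_ge_of_short_fibres {n : ℕ} {t : ℝ} (ht0 : 0 < t) (ht2 : t ≤ 1 / 2)
    {A : Set (ℝ × (Fin n → ℝ))} (hA : IsCompact A) (hA1 : ∀ p ∈ A, p.1 ∈ Icc (0 : ℝ) 1)
    {b : Fin n → ℝ} (h0 : ((0 : ℝ), b) ∈ A) (h1 : ((1 : ℝ), b) ∈ A)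
    (hfib : ∀ y, fibreVolume A y ≤ ENNReal.ofReal (1 - t)) :
    volume A + ENNReal.ofReal (t ^ (n + 1)) * volume A ≤ volume (t • A + (1 - t) • A) := by
  have hr0 : 0 < 1 - t := by linarith
  have hD : IsCompact (t • A + (1 - t) • A) := isCompact_combo hA hA t
  set D := t • A + (1 - t) • A with hDdef
  set H : Set (ℝ × (Fin n → ℝ)) := {p | p.1 < 1 - t} with hH
  have hHm : MeasurableSet H := measurableSet_lt measurable_fst measurable_const
  set e : ℝ × (Fin n → ℝ) := (1 - t, 0) with he
  set N : Set (ℝ × (Fin n → ℝ)) := {p | p.1 = 1 - t} with hN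
  have hnull : ∀ S T : Set (ℝ × (Fin n → ℝ)), S ⊆ T ∪ N → volume S ≤ volume T := fun S T h =>
    (measure_mono h).trans ((measure_union_le _ _).trans (by
      rw [volume_prod_hyperplane, add_zero]))
  rw [volume_eq_union_add_inter_translate volume hD.measurableSet hHm e]
  refine add_le_add ?_ ?_
  · set W := (D ∩ H) ∪ (fun x => e + x) ⁻¹' (D \ H) with hW
    have hWm : MeasurableSet W := (hD.measurableSet.inter hHm).union
      ((measurable_const_add e) (hD.measurableSet.diff hHm))
    set B := Prod.snd '' A with hB
    have hBm : MeasurableSet B := (hA.image continuous_snd).measurableSet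
    have hAH : volume (fibreHypograph B A) = volume A := by
      rw [volume_fibreHypograph hBm hA.measurableSet, ← lintegral_fibreVolume hA.measurableSet,
        ← lintegral_indicator hBm]
      refine lintegral_congr fun y => ?_
      by_cases hy : y ∈ B
      · rw [indicator_of_mem hy]
      · rw [indicator_of_notMem hy]
        have : (fun s : ℝ => (s, y)) ⁻¹' A = ∅ := by
          ext s
          simp only [mem_preimage, mem_empty_iff_false, iff_false]
          exact fun h => hy ⟨_, h, rfl⟩
        rw [fibreVolume, this, measure_empty]
    have hWH : volume (fibreHypograph univ W) = volume W := by
      rw [volume_fibreHypograph .univ hWm, setLIntegral_univ, lintegral_fibreVolume hWm]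
    have hAHm := measurableSet_fibreHypograph hBm hA.measurableSet
    rw [← hAH, ← hWH]
    refine ((mulBrunnMinkowski_prod ht0 (by linarith)
      (mulBrunnMinkowski_pi ht0 (by linarith) n)).le_volume ht0 (by linarith) hAHm hAHm
      le_rfl le_rfl).trans (measure_mono ?_)
    rintro _ ⟨_, ⟨⟨s₁, _⟩, ⟨⟨⟨x₁, y₁⟩, hx₁, rfl⟩, hs₁0, hs₁⟩, rfl⟩, _,
      ⟨⟨s₂, _⟩, ⟨⟨⟨x₂, y₂⟩, hx₂, rfl⟩, hs₂0, hs₂⟩, rfl⟩, rfl⟩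
    simp only at hs₁0 hs₁ hs₂0 hs₂ hx₁ hx₂
    simp only [fibreHypograph, mem_univ, true_and, mem_ofPred_eq, Prod.fst_add, Prod.smul_fst,
      Prod.snd_add, Prod.smul_snd, smul_eq_mul]
    refine ⟨by positivity, ?_⟩
    have hfc : ∀ y, IsCompact ((fun s : ℝ => (s, y)) ⁻¹' A) := fun y =>
      isCompact_Icc.of_isClosed_subset (hA.isClosed.preimage (by fun_prop))
        (fun s hs => hA1 _ hs)
    have key := min_le_volume_wrapped_combo ht0 ht2 (hfc y₁) (hfc y₂) (fun s hs => hA1 _ hs)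
      (fun s hs => hA1 _ hs) ⟨x₁, hx₁⟩ ⟨x₂, hx₂⟩
    change min _ (ENNReal.ofReal t * fibreVolume A y₁ + ENNReal.ofReal (1 - t) * fibreVolume A y₂)
      ≤ _ at key
    rw [min_eq_right] at key
    · calc ENNReal.ofReal (t * s₁ + (1 - t) * s₂) =
          ENNReal.ofReal t * ENNReal.ofReal s₁ + ENNReal.ofReal (1 - t) * ENNReal.ofReal s₂ := by
            rw [← ENNReal.ofReal_mul ht0.le, ← ENNReal.ofReal_mul hr0.le,
              ← ENNReal.ofReal_add (by positivity) (by positivity)]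
        _ ≤ _ := by gcongr
        _ ≤ _ := key
        _ ≤ volume (((fun s : ℝ => (s, t • y₁ + (1 - t) • y₂)) ⁻¹' W) ∪ {1 - t}) := by
            refine measure_mono ?_
            have hmem : ∀ w ∈ t • ((fun s : ℝ => (s, y₁)) ⁻¹' A) +
                (1 - t) • ((fun s : ℝ => (s, y₂)) ⁻¹' A), (w, t • y₁ + (1 - t) • y₂) ∈ D := by
              rintro _ ⟨_, ⟨u, hu, rfl⟩, _, ⟨v, hv, rfl⟩, rfl⟩
              exact ⟨_, ⟨_, hu, rfl⟩, _, ⟨_, hv, rfl⟩, rfl⟩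
            rintro w ⟨⟨hw0, hw1⟩, hw | hw⟩
            · rcases eq_or_lt_of_le hw1 with h | h
              · exact Or.inr h
              · exact Or.inl (Or.inl ⟨hmem _ hw, h⟩)
            · refine Or.inl (Or.inr ⟨?_, ?_⟩)
              · have := hmem _ hw
                rw [add_comm] at this
                simpa [he] using this
              · simpa [he, hH] using hw0
        _ ≤ _ := (measure_union_le _ _).trans (by simp [fibreVolume])
    · calc _ ≤ ENNReal.ofReal t * ENNReal.ofReal (1 - t) +
          ENNReal.ofReal (1 - t) * ENNReal.ofReal (1 - t) := by gcongr <;> exact hfib _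
        _ = _ := by
          rw [← add_mul, ← ENNReal.ofReal_add ht0.le hr0.le, add_sub_cancel, ENNReal.ofReal_one,
            one_mul]
  · have hv : volume (((1 - t) • ((0 : ℝ), b)) +ᵥ (t • A)) =
        ENNReal.ofReal (t ^ (n + 1)) * volume A := by
      rw [measure_vadd, Measure.addHaar_smul, finrank_prod_pi, abs_of_pos (by positivity)]
    rw [← hv]
    refine hnull _ _ ?_
    rintro _ ⟨_, ⟨p, hp, rfl⟩, rfl⟩
    have hp1 := hA1 p hp
    by_cases hpN : ((1 - t) • ((0 : ℝ), b)) +ᵥ t • p ∈ N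
    · exact Or.inr hpN
    left
    simp only [hN, vadd_eq_add, mem_ofPred_eq, Prod.fst_add, Prod.smul_fst, smul_eq_mul, mul_zero,
      zero_add] at hpN
    refine ⟨⟨⟨_, ⟨p, hp, rfl⟩, _, ⟨_, h0, rfl⟩, ?_⟩, ?_⟩,
      ⟨⟨_, ⟨p, hp, rfl⟩, _, ⟨_, h1, rfl⟩, ?_⟩, ?_⟩⟩
    · simp [add_comm]
    · simp only [hH, vadd_eq_add, mem_ofPred_eq, Prod.fst_add, Prod.smul_fst, smul_eq_mul, mul_zero,
        zero_add]
      exact lt_of_le_of_ne (by nlinarith [hp1.2]) hpN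
    · ext <;> simp [he, add_comm]
    · simp only [hH, he, vadd_eq_add, mem_ofPred_eq, Prod.fst_add, Prod.smul_fst, smul_eq_mul,
        mul_zero, zero_add, not_lt]
      nlinarith [hp1.1]

theorem subset_combo {E : Type*} [AddCommGroup E] [Module ℝ E] (t : ℝ) (A : Set E) :
    A ⊆ t • A + (1 - t) • A := fun x hx =>
  ⟨_, ⟨x, hx, rfl⟩, _, ⟨x, hx, rfl⟩, by
    simp only [← add_smul, add_sub_cancel, one_smul]⟩

theorem volume_shadow_le {n : ℕ} {t : ℝ} (ht0 : 0 < t) (ht1 : t < 1)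
    {A : Set (ℝ × (Fin n → ℝ))} (hA : IsCompact A) {y₀ : Fin n → ℝ}
    (hy₀ : ENNReal.ofReal (1 - t) ≤ fibreVolume A y₀) :
    ENNReal.ofReal (t * (1 - t) ^ (n + 1)) * volume (Prod.snd '' A) ≤
      volume (t • A + (1 - t) • A) := by
  have hr0 : 0 < 1 - t := by linarith
  have hD : IsCompact (t • A + (1 - t) • A) := isCompact_combo hA hA t
  set B := Prod.snd '' A with hB
  have hBc : IsCompact B := hA.image continuous_snd
  set S : Set (Fin n → ℝ) := (t • y₀) +ᵥ ((1 - t) • B) with hS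
  have hSm : MeasurableSet S := ((hBc.smul (1 - t)).vadd (t • y₀)).measurableSet
  have hSv : volume S = ENNReal.ofReal ((1 - t) ^ n) * volume B := by
    rw [hS, measure_vadd, Measure.addHaar_smul, abs_of_pos (by positivity)]; simp
  rw [← lintegral_fibreVolume hD.measurableSet]
  calc ENNReal.ofReal (t * (1 - t) ^ (n + 1)) * volume B
      = ∫⁻ y in S, ENNReal.ofReal (t * (1 - t)) := by
        rw [setLIntegral_const, hSv, ← mul_assoc, ← ENNReal.ofReal_mul (by positivity)]
        congr 2; ring
    _ ≤ ∫⁻ y in S, fibreVolume (t • A + (1 - t) • A) y := by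
        refine setLIntegral_mono' hSm ?_
        rintro _ ⟨_, ⟨_, ⟨⟨x₁, y₁⟩, h₁, rfl⟩, rfl⟩, rfl⟩
        calc ENNReal.ofReal (t * (1 - t)) ≤ ENNReal.ofReal t * fibreVolume A y₀ := by
              rw [ENNReal.ofReal_mul ht0.le]; gcongr
          _ = volume (((1 - t) * x₁) +ᵥ (t • ((fun s : ℝ => (s, y₀)) ⁻¹' A))) := by
              rw [measure_vadd, volume_real_smul ht0.le]; rfl
          _ ≤ _ := by
              refine measure_mono ?_
              rintro _ ⟨_, ⟨s, hs, rfl⟩, rfl⟩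
              refine ⟨_, ⟨_, hs, rfl⟩, _, ⟨_, h₁, rfl⟩, ?_⟩
              ext <;> simp [add_comm]
    _ ≤ _ := setLIntegral_le_lintegral _ _

theorem fibreVolume_le_one {n : ℕ} {A : Set (ℝ × (Fin n → ℝ))}
    (hA1 : ∀ p ∈ A, p.1 ∈ Icc (0 : ℝ) 1) (y : Fin n → ℝ) : fibreVolume A y ≤ 1 :=
  (measure_mono (t := Icc (0 : ℝ) 1) fun s hs => hA1 _ hs).trans (by simp)

theorem exists_nearly_full_fibre {n : ℕ} {t : ℝ} (ht0 : 0 < t) (ht2 : t ≤ 1 / 2)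
    {A : Set (ℝ × (Fin n → ℝ))} (hA : IsCompact A) (hA1 : ∀ p ∈ A, p.1 ∈ Icc (0 : ℝ) 1)
    (hA2 : ∀ p ∈ A, p.2 ∈ Icc (0 : Fin n → ℝ) 1) {c κ : ℝ} (hc : 0 < c) (hκ : 0 < κ)
    (hcA : ENNReal.ofReal (2 * c) ≤ volume A)
    (hm : volume ((t • A + (1 - t) • A) \ A) <
      ENNReal.ofReal (c * min (t * c) ((1 - t) * κ))) :
    ∃ (y : Fin n → ℝ) (a b : ℝ), IsLeast ((fun s : ℝ => (s, y)) ⁻¹' A) a ∧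
      IsGreatest ((fun s : ℝ => (s, y)) ⁻¹' A) b ∧ ENNReal.ofReal c ≤ fibreVolume A y ∧
      ENNReal.ofReal (b - a) - fibreVolume A y < ENNReal.ofReal κ := by
  by_contra! hcon
  have hr0 : 0 < 1 - t := by linarith
  have hD : IsCompact (t • A + (1 - t) • A) := isCompact_combo hA hA t
  set S : Set (Fin n → ℝ) := {y | ENNReal.ofReal c ≤ fibreVolume A y} with hS
  have hSm : MeasurableSet S := measurableSet_le measurable_const
    (measurable_fibreVolume hA.measurableSet)
  set δ := min (t * c) ((1 - t) * κ) with hδ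
  have hδ0 : 0 < δ := by positivity
  have hAS : volume A ≤ ENNReal.ofReal c + volume S := by
    rw [← lintegral_fibreVolume hA.measurableSet]
    calc ∫⁻ y, fibreVolume A y ≤ ∫⁻ y, ((Icc (0 : Fin n → ℝ) 1).indicator
          (fun _ => ENNReal.ofReal c) y + S.indicator (fun _ => 1) y) := by
          refine lintegral_mono fun y => ?_
          by_cases hy : y ∈ S
          · rw [indicator_of_mem hy]
            exact (fibreVolume_le_one hA1 y).trans le_add_self
          · rw [indicator_of_notMem hy, add_zero]
            by_cases hy1 : y ∈ Icc (0 : Fin n → ℝ) 1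
            · rw [indicator_of_mem hy1]
              exact (not_le.1 hy).le
            · have : (fun s : ℝ => (s, y)) ⁻¹' A = ∅ := by
                ext s
                simp only [mem_preimage, mem_empty_iff_false, iff_false]
                exact fun h => hy1 (hA2 _ h)
              rw [fibreVolume, this, measure_empty]
              exact zero_le
      _ = _ := by
          rw [lintegral_add_left (measurable_const.indicator measurableSet_Icc),
            lintegral_indicator_const measurableSet_Icc, lintegral_indicator_const hSm,
            Real.volume_Icc_pi]
          simp
  have hSc : ENNReal.ofReal c ≤ volume S := by
    have : ENNReal.ofReal c + ENNReal.ofReal c ≤ ENNReal.ofReal c + volume S := by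
      rw [← ENNReal.ofReal_add hc.le hc.le, ← two_mul]
      exact hcA.trans hAS
    exact (ENNReal.add_le_add_iff_left ENNReal.ofReal_ne_top).1 this
  have h_int : volume A + ENNReal.ofReal δ * volume S ≤ volume (t • A + (1 - t) • A) := by
    rw [← lintegral_fibreVolume hA.measurableSet, ← lintegral_fibreVolume hD.measurableSet,
      ← lintegral_indicator_const hSm, ← lintegral_add_left (measurable_fibreVolume
          hA.measurableSet)]
    refine lintegral_mono fun y => ?_
    by_cases hy : y ∈ S
    · rw [indicator_of_mem hy]
      have hfc : IsCompact ((fun s : ℝ => (s, y)) ⁻¹' A) :=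
        isCompact_Icc.of_isClosed_subset (hA.isClosed.preimage (by fun_prop))
          (fun s hs => hA1 _ hs)
      have hne : ((fun s : ℝ => (s, y)) ⁻¹' A).Nonempty := by
        by_contra h
        rw [not_nonempty_iff_eq_empty] at h
        have hy' : ENNReal.ofReal c ≤ fibreVolume A y := hy
        rw [fibreVolume, h, measure_empty] at hy'
        simp only [nonpos_iff_eq_zero, ENNReal.ofReal_eq_zero] at hy'
        linarith
      obtain ⟨a, ha⟩ := hfc.exists_isLeast hne
      obtain ⟨b, hb⟩ := hfc.exists_isGreatest hne
      have h1 := hcon y a b ha hb hy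
      have h2 := volume_add_min_le_volume_combo ht0 ht2 hfc ha hb
      calc fibreVolume A y + ENNReal.ofReal δ ≤ fibreVolume A y + min (ENNReal.ofReal t *
            fibreVolume A y) (ENNReal.ofReal (1 - t) *
              (ENNReal.ofReal (b - a) - fibreVolume A y)) := by
            gcongr
            refine le_min ?_ ?_
            · calc ENNReal.ofReal δ ≤ ENNReal.ofReal (t * c) :=
                    ENNReal.ofReal_le_ofReal (min_le_left _ _)
                _ = ENNReal.ofReal t * ENNReal.ofReal c := ENNReal.ofReal_mul ht0.le
                _ ≤ _ := by gcongr; exact hy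
            · calc ENNReal.ofReal δ ≤ ENNReal.ofReal ((1 - t) * κ) :=
                    ENNReal.ofReal_le_ofReal (min_le_right _ _)
                _ = ENNReal.ofReal (1 - t) * ENNReal.ofReal κ := ENNReal.ofReal_mul hr0.le
                _ ≤ _ := by gcongr
        _ ≤ _ := h2
        _ ≤ fibreVolume (t • A + (1 - t) • A) y := by
            refine measure_mono ?_
            rintro _ ⟨_, ⟨u, hu, rfl⟩, _, ⟨v, hv, rfl⟩, rfl⟩
            refine ⟨_, ⟨_, hu, rfl⟩, _, ⟨_, hv, rfl⟩, ?_⟩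
            ext
            · simp
            · simp
    · rw [indicator_of_notMem hy, add_zero]
      exact measure_mono fun s hs => subset_combo t A hs
  have hsplit : volume (t • A + (1 - t) • A) = volume A + volume ((t • A + (1 - t) • A) \ A) := by
    rw [measure_sdiff (subset_combo t A) hA.measurableSet.nullMeasurableSet hA.measure_lt_top.ne,
      add_tsub_cancel_of_le (measure_mono (subset_combo t A))]
  rw [hsplit] at h_int
  have h3 := (ENNReal.add_le_add_iff_left hA.measure_lt_top.ne).1 h_int
  refine absurd hm (not_lt.2 (le_trans ?_ h3))
  rw [mul_comm c, ENNReal.ofReal_mul hδ0.le]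
  gcongr

theorem volume_short_fibre_part_le {n : ℕ} {A : Set (ℝ × (Fin n → ℝ))} (hA : IsCompact A)
    (c : ℝ≥0∞) :
    volume (A ∩ {p | fibreVolume A p.2 < c}) ≤ c * volume (Prod.snd '' A) := by
  have hmeas : MeasurableSet (A ∩ {p : ℝ × (Fin n → ℝ) | fibreVolume A p.2 < c}) :=
    hA.measurableSet.inter
      (measurableSet_lt ((measurable_fibreVolume hA.measurableSet).comp measurable_snd)
        measurable_const)
  have hB : MeasurableSet (Prod.snd '' A) := (hA.image continuous_snd).measurableSet
  rw [← lintegral_fibreVolume hmeas, ← setLIntegral_const, ← lintegral_indicator hB]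
  refine lintegral_mono fun y => ?_
  by_cases hy : y ∈ Prod.snd '' A ∧ fibreVolume A y < c
  · rw [indicator_of_mem hy.1]
    exact (measure_mono fun s hs => hs.1).trans hy.2.le
  · have : (fun s : ℝ => (s, y)) ⁻¹' (A ∩ {p | fibreVolume A p.2 < c}) = ∅ := by
      ext s
      simp only [mem_preimage, mem_inter_iff, mem_ofPred_eq, mem_empty_iff_false, iff_false]
      exact fun h => hy ⟨⟨_, h.1, rfl⟩, h.2⟩
    rw [fibreVolume, this, measure_empty]; exact zero_le

/-- The combinatorial heart of the Loomis–Whitney inequality, for indicator functions: if most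
points have long fibres in all coordinate directions then the volume is large. -/
theorem volume_ge_of_long_fibres {n : ℕ} {A A' : Set (Fin (n + 1) → ℝ)} (hA : MeasurableSet A)
    (hA' : MeasurableSet A') (hsub : A' ⊆ A) {c : ℝ≥0∞}
    (hlong : ∀ x ∈ A', ∀ k, c ≤ fibreVolume (insertEquiv k ⁻¹' A) (k.removeNth x)) :
    c * volume A' ≤ volume A ^ (1 + (n + 1 : ℝ)⁻¹) := by
  have hp0 : (0 : ℝ) ≤ (n + 1 : ℝ)⁻¹ := by positivity
  have hn : (0 : ℝ) < n + 1 := by positivity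
  have h := lintegral_mul_prod_lintegral_pow_le (fun _ : Fin (n + 1) => (volume : Measure ℝ))
    (p := (n + 1 : ℝ)⁻¹) hp0 (by
      simp only [Fintype.card_fin]; push_cast
      rw [add_sub_cancel_right, mul_inv_le_iff₀ hn]; linarith)
    (f := A.indicator 1) (measurable_one.indicator hA)
  rw [← volume_pi, lintegral_indicator_one hA] at h
  refine le_trans ?_ h
  rw [← setLIntegral_const, ← lintegral_indicator hA']
  refine lintegral_mono fun x => ?_
  by_cases hx : x ∈ A'
  · rw [indicator_of_mem hx, indicator_of_mem (hsub hx), Pi.one_apply, ENNReal.one_rpow, one_mul]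
    calc c = ∏ _i : Fin (n + 1), c ^ (n + 1 : ℝ)⁻¹ := by
          rw [Finset.prod_const, Finset.card_univ, Fintype.card_fin, ← ENNReal.rpow_natCast,
            ← ENNReal.rpow_mul]
          push_cast
          rw [inv_mul_cancel₀ hn.ne', ENNReal.rpow_one]
      _ ≤ _ := by
          refine Finset.prod_le_prod' fun k _ => ?_
          refine ENNReal.rpow_le_rpow ?_ hp0
          refine (hlong x hx k).trans (le_of_eq ?_)
          have hmeas : MeasurableSet ((fun s : ℝ => (s, k.removeNth x)) ⁻¹'
              (insertEquiv k ⁻¹' A)) := by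
            have : Measurable fun s : ℝ => insertEquiv k (s, k.removeNth x) :=
              (continuous_insertEquiv k).measurable.comp (by fun_prop)
            exact this hA
          rw [fibreVolume, ← lintegral_indicator_one hmeas]
          refine lintegral_congr fun s => ?_
          have : insertEquiv k (s, k.removeNth x) = Function.update x k s := by
            rw [insertEquiv_apply, Fin.insertNth_removeNth]
          have hiff : s ∈ (fun s : ℝ => (s, k.removeNth x)) ⁻¹' (insertEquiv k ⁻¹' A) ↔
              Function.update x k s ∈ A := by rw [mem_preimage, mem_preimage, this]
          by_cases hs : Function.update x k s ∈ A
          · rw [indicator_of_mem (hiff.2 hs), indicator_of_mem hs]; rfl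
          · rw [indicator_of_notMem (mt hiff.1 hs), indicator_of_notMem hs]
  · rw [indicator_of_notMem hx]; exact zero_le

theorem exists_volume_ge_of_chords (n : ℕ) {t : ℝ} (ht0 : 0 < t) (ht2 : t ≤ 1 / 2) :
    ∃ c : ℝ, 0 < c ∧ ∀ A : Set (Fin (n + 1) → ℝ), IsCompact A → A ⊆ Icc 0 1 →
      (∀ k, ∃ a ∈ A, ∃ b ∈ A, a - b = Pi.single k 1) →
      volume (t • A + (1 - t) • A) < volume A + ENNReal.ofReal (t ^ (n + 1)) * volume A →
      ENNReal.ofReal c ≤ volume A := by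
  have hr0 : 0 < 1 - t := by linarith
  set q : ℝ := t * (1 - t) ^ (n + 1) with hq
  have hq0 : 0 < q := by positivity
  set c₀ : ℝ := q / (4 * (n + 1)) with hc₀
  have hc₀0 : 0 < c₀ := by positivity
  refine ⟨(c₀ / 2) ^ (n + 1), by positivity, fun A hA hA01 hch hD => ?_⟩
  have hfin := hA.measure_lt_top (μ := volume)
  have hpos : volume A ≠ 0 := by
    rintro h; rw [h] at hD; simp at hD
  have hD2 : volume (t • A + (1 - t) • A) ≤ 2 * volume A := by
    refine hD.le.trans ?_
    rw [two_mul]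
    gcongr
    refine mul_le_of_le_one_left zero_le ?_
    rw [ENNReal.ofReal_le_one]
    exact pow_le_one₀ ht0.le (by linarith)
  have hshadow : ∀ k : Fin (n + 1), ENNReal.ofReal q *
      volume (Prod.snd '' (insertEquiv k ⁻¹' A)) ≤ 2 * volume A := by
    intro k
    have hAk := isCompact_insertEquiv_preimage k hA
    have hDk : volume (t • (insertEquiv k ⁻¹' A) + (1 - t) • (insertEquiv k ⁻¹' A)) =
        volume (t • A + (1 - t) • A) := by
      rw [← preimage_combo, volume_insertEquiv_preimage]
    have : ∃ y₀, ENNReal.ofReal (1 - t) ≤ fibreVolume (insertEquiv k ⁻¹' A) y₀ := by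
      by_contra! hcon
      obtain ⟨a, ha, b, hb, hab⟩ := hch k
      have hak : a k = 1 + b k := by
        have := congrFun hab k; simp at this; linarith
      have hb0 : b k = 0 := by
        have h1 := (hA01 ha).2 k; have h2 := (hA01 hb).1 k
        simp at h1 h2; linarith
      have hrem : k.removeNth a = k.removeNth b := by
        ext j
        have := congrFun hab (k.succAbove j)
        simp [Fin.succAbove_ne] at this
        simp [Fin.removeNth]; linarith
      have h := volume_combo_ge_of_short_fibres ht0 ht2 hAk (b := k.removeNth b)
        (fun p hp => by
          have h1 := hA01 hp
          have h2 := h1.1 k; have h3 := h1.2 k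
          simp [insertEquiv_apply] at h2 h3
          exact ⟨h2, h3⟩)
        (by rw [mem_preimage, insertEquiv_apply]; simp only
            rw [← hb0, Fin.insertNth_self_removeNth]; exact hb)
        (by
          have h1 : (1 : ℝ) = a k := by rw [hak, hb0, add_zero]
          rw [mem_preimage, insertEquiv_apply]; simp only
          rw [← hrem, h1, Fin.insertNth_self_removeNth]; exact ha)
        (fun y => (hcon y).le)
      rw [hDk, volume_insertEquiv_preimage] at h
      exact absurd hD (not_lt.2 h)
    obtain ⟨y₀, hy₀⟩ := this
    have := volume_shadow_le ht0 (by linarith) hAk hy₀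
    rw [hDk] at this
    exact this.trans hD2
  set B : Fin (n + 1) → Set (Fin (n + 1) → ℝ) := fun k =>
    A ∩ {x | fibreVolume (insertEquiv k ⁻¹' A) (k.removeNth x) < ENNReal.ofReal c₀} with hBdef
  have hBm : ∀ k, MeasurableSet (B k) := fun k => by
    refine hA.measurableSet.inter (measurableSet_lt ?_ measurable_const)
    exact (measurable_fibreVolume (isCompact_insertEquiv_preimage k hA).measurableSet).comp
      (measurable_pi_lambda _ fun j => measurable_pi_apply _)
  have hBv : ∀ k, volume (B k) ≤ volume A / (2 * (n + 1)) := by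
    intro k
    rw [← volume_insertEquiv_preimage k (B k)]
    have : insertEquiv k ⁻¹' B k = (insertEquiv k ⁻¹' A) ∩
        {p | fibreVolume (insertEquiv k ⁻¹' A) p.2 < ENNReal.ofReal c₀} := by
      ext p; simp [hBdef, insertEquiv_apply]
    rw [this]
    refine (volume_short_fibre_part_le (isCompact_insertEquiv_preimage k hA) _).trans ?_
    rw [ENNReal.le_div_iff_mul_le (by simp) (by left; finiteness)]
    have : ENNReal.ofReal c₀ * (4 * (n + 1)) = ENNReal.ofReal q := by
      have : (4 * (n + 1) : ℝ≥0∞) = ENNReal.ofReal (4 * (n + 1)) := by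
        rw [ENNReal.ofReal_mul (by norm_num), ENNReal.ofReal_add (by positivity) zero_le_one]
        simp
      rw [this, ← ENNReal.ofReal_mul hc₀0.le]
      congr 1; rw [hc₀]; field_simp
    have h2 := hshadow k
    rw [← this] at h2
    rw [← ENNReal.mul_le_mul_iff_right (a := 2) (by simp) (by simp)]
    refine le_trans (le_of_eq ?_) h2
    ring
  set A' := A \ ⋃ k, B k with hA'def
  have hA'm : MeasurableSet A' := hA.measurableSet.diff (MeasurableSet.iUnion hBm)
  have hU : volume (⋃ k, B k) ≤ volume A / 2 := by
    refine (measure_iUnion_fintype_le _ _).trans ((Finset.sum_le_sum fun k _ => hBv k).trans ?_)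
    rw [Finset.sum_const, Finset.card_univ, Fintype.card_fin, nsmul_eq_mul]
    rw [ENNReal.div_eq_inv_mul, ENNReal.div_eq_inv_mul, ENNReal.mul_inv (by simp) (by simp)]
    push_cast
    rw [mul_comm (2⁻¹ : ℝ≥0∞) (_⁻¹), ← mul_assoc, ← mul_assoc,
        ENNReal.mul_inv_cancel (by simp) (by finiteness), one_mul]
  have hA'v : volume A / 2 ≤ volume A' := by
    have h1 : volume A ≤ volume A' + volume (⋃ k, B k) :=
      (measure_mono (by rw [hA'def, sdiff_union_self]; exact subset_union_left)).trans
        (measure_union_le _ _)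
    have h2 : volume A / 2 + volume A / 2 ≤ volume A' + volume A / 2 := by
      rw [ENNReal.add_halves]; exact h1.trans (by gcongr)
    exact (ENNReal.add_le_add_iff_right (ENNReal.div_lt_top hfin.ne (by simp)).ne).1 h2
  have hfinal := volume_ge_of_long_fibres hA.measurableSet hA'm sdiff_subset
    (c := ENNReal.ofReal c₀) fun x hx k => by
      by_contra! hlt
      exact hx.2 (mem_iUnion.2 ⟨k, hx.1, hlt⟩)
  have h1 : ENNReal.ofReal (c₀ / 2) * volume A ≤ volume A * volume A ^ (n + 1 : ℝ)⁻¹ := by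
    rw [ENNReal.rpow_add _ _ hpos hfin.ne, ENNReal.rpow_one] at hfinal
    refine le_trans (le_of_eq ?_) ((mul_le_mul_right hA'v _).trans hfinal)
    rw [ENNReal.ofReal_div_of_pos (by norm_num)]
    simp only [ENNReal.div_eq_inv_mul, ENNReal.ofReal_ofNat]; ring
  rw [mul_comm, ENNReal.mul_le_mul_iff_right hpos hfin.ne] at h1
  rw [ENNReal.ofReal_pow (by positivity)]
  calc ENNReal.ofReal (c₀ / 2) ^ (n + 1) ≤ (volume A ^ (n + 1 : ℝ)⁻¹) ^ (n + 1) := by gcongr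
    _ = volume A := by
      rw [← ENNReal.rpow_natCast, ← ENNReal.rpow_mul]
      push_cast
      rw [inv_mul_cancel₀ (by positivity), ENNReal.rpow_one]

theorem volume_preimage_affine {d : ℕ} {ρ : ℝ} (hρ : 0 < ρ) (s : Fin d → ℝ)
    (Y : Set (Fin d → ℝ)) :
    volume {x | ρ • x + s ∈ Y} = ENNReal.ofReal ((ρ ^ d)⁻¹) * volume Y := by
  have h1 : {x | ρ • x + s ∈ Y} = (fun x => ρ • x) ⁻¹' ((fun x => x + s) ⁻¹' Y) := rfl
  rw [h1, Measure.addHaar_preimage_smul _ hρ.ne', measure_preimage_add_right,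
    abs_of_pos (by simp; positivity)]
  simp

theorem volume_image_affine {d : ℕ} {ρ : ℝ} (hρ : 0 ≤ ρ) (s : Fin d → ℝ)
    (Y : Set (Fin d → ℝ)) :
    volume ((fun x => s + ρ • x) '' Y) = ENNReal.ofReal (ρ ^ d) * volume Y := by
  have h1 : (fun x => s + ρ • x) '' Y = s +ᵥ (ρ • Y) := by
    ext z; simp [mem_vadd_set, mem_smul_set]
  rw [h1, measure_vadd, Measure.addHaar_smul, abs_of_nonneg (by positivity)]
  simp

theorem exists_volume_iterate_le (d : ℕ) {t : ℝ} (ht1 : t < 1) (n : ℕ) :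
    ∃ C : ℝ≥0∞, C ≠ ⊤ ∧ ∀ (A : Set (Fin d → ℝ)) (v : Fin n → Fin d → ℝ), (∀ i, v i ∈ A) →
      volume {x | x ∈ A ∧ (1 - t) ^ n • x + ∑ i : Fin n, (t * (1 - t) ^ (i : ℕ)) • v i ∉ A} ≤
        C * volume ((t • A + (1 - t) • A) \ A) := by
  have hr0 : 0 < 1 - t := by linarith
  induction n with
  | zero => exact ⟨0, by simp, fun A v _ => by simp⟩
  | succ n ih =>
    obtain ⟨C, hC, ih⟩ := ih
    refine ⟨ENNReal.ofReal (((1 - t) ^ d)⁻¹) * (1 + C),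
      ENNReal.mul_ne_top ENNReal.ofReal_ne_top (by simp [hC]), fun A v hv => ?_⟩
    set D := t • A + (1 - t) • A
    set w := t • v (Fin.last n) with hw
    have ih' := ih A (fun i => v i.castSucc) (fun i => hv _)
    set Y := {x | x ∈ A ∧
      (1 - t) ^ n • x + ∑ i : Fin n, (t * (1 - t) ^ (i : ℕ)) • v i.castSucc ∉ A}
    have hsub : {x | x ∈ A ∧ (1 - t) ^ (n + 1) • x +
        ∑ i : Fin (n + 1), (t * (1 - t) ^ (i : ℕ)) • v i ∉ A} ⊆
          {x | (1 - t) • x + w ∈ (D \ A) ∪ Y} := by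
      rintro x ⟨hx, hx'⟩
      by_cases h : (1 - t) • x + w ∈ A
      · refine Or.inr ⟨h, fun h' => hx' ?_⟩
        convert h' using 1
        rw [Fin.sum_univ_castSucc, hw]
        simp only [Fin.val_castSucc, Fin.val_last]
        module
      · refine Or.inl ⟨?_, h⟩
        exact ⟨_, ⟨_, hv (Fin.last n), rfl⟩, _, ⟨_, hx, rfl⟩, by simp [hw, add_comm]⟩
    refine (measure_mono hsub).trans ?_
    rw [volume_preimage_affine hr0, mul_assoc]
    gcongr
    refine (measure_union_le _ _).trans ?_
    rw [add_mul, one_mul]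
    gcongr

theorem volume_pi_diff_pi_le {d : ℕ} {I S : Fin d → Set ℝ} (hI : ∀ k, volume (I k) ≤ 1) :
    volume (univ.pi I \ univ.pi S) ≤ ∑ k, volume (I k \ S k) := by
  have hsub : univ.pi I \ univ.pi S ⊆ ⋃ k, univ.pi (Function.update I k (I k \ S k)) := by
    rintro x ⟨hx, hxS⟩
    simp only [mem_pi, mem_univ, forall_const, not_forall] at hx hxS
    obtain ⟨k, hk⟩ := hxS
    refine mem_iUnion.2 ⟨k, fun j _ => ?_⟩
    rcases eq_or_ne j k with rfl | hj
    · simpa using ⟨hx j, hk⟩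
    · simpa [hj] using hx j
  refine (measure_mono hsub).trans ((measure_iUnion_fintype_le _ _).trans ?_)
  refine Finset.sum_le_sum fun k _ => ?_
  rw [volume_pi_pi, ← Finset.mul_prod_erase _ _ (Finset.mem_univ k)]
  simp only [Function.update_self]
  refine mul_le_of_le_one_right zero_le (Finset.prod_le_one' fun j hj => ?_)
  rw [Function.update_of_ne (Finset.ne_of_mem_erase hj)]
  exact hI j

theorem volume_image_diagonal_le {d : ℕ} {w : Fin d → ℝ} (hw0 : ∀ k, 0 ≤ w k)
    (hw1 : ∀ k, w k ≤ 1) (s : Fin d → ℝ) (U : Set (Fin d → ℝ)) :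
    volume ((fun u => s + w * u) '' U) ≤ volume U := by
  have h1 : (fun u => s + w * u) '' U = s +ᵥ (Matrix.toLin' (Matrix.diagonal w)) '' U := by
    rw [← image_vadd, image_image]
    refine image_congr fun u _ => ?_
    ext k; simp [Matrix.mulVec_diagonal]
  rw [h1, measure_vadd, Measure.addHaar_image_linearMap, LinearMap.det_toLin',
    Matrix.det_diagonal, abs_of_nonneg (Finset.prod_nonneg fun k _ => hw0 k)]
  refine mul_le_of_le_one_left zero_le ?_
  rw [ENNReal.ofReal_le_one]
  exact Finset.prod_le_one (fun k _ => hw0 k) fun k _ => hw1 k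

/-- A set of large volume and tiny doubling deficit almost contains a cube of controlled size. -/
theorem exists_nearly_full_cube (n : ℕ) {t c : ℝ} (ht0 : 0 < t) (ht2 : t ≤ 1 / 2) (hc : 0 < c) :
    ∃ r : ℝ, 0 < r ∧ ∀ κ : ℝ, 0 < κ → ∃ m₀ : ℝ, 0 < m₀ ∧
      ∀ A : Set (Fin (n + 1) → ℝ), IsCompact A → A ⊆ Icc 0 1 →
        ENNReal.ofReal c ≤ volume A →
        volume ((t • A + (1 - t) • A) \ A) < ENNReal.ofReal m₀ →
        ∃ o, volume (Metric.closedBall o r \ A) ≤ ENNReal.ofReal κ := by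
  have hr0 : 0 < 1 - t := by linarith
  obtain ⟨C, hC, hiter⟩ := exists_volume_iterate_le (n + 1) (t := t) (by linarith) (n + 1)
  refine ⟨t * (1 - t) ^ n * (c / 2) / 2, by positivity, fun κ hκ => ?_⟩
  set r := t * (1 - t) ^ n * (c / 2) / 2 with hr
  set κ₁ := κ / 2 / (n + 1) with hκ₁
  have hκ₁0 : 0 < κ₁ := by positivity
  set β := κ / 2 with hβ
  have hβ0 : 0 < β := by positivity
  set m₁ := (c / 2) * min (t * (c / 2)) ((1 - t) * κ₁) with hm₁
  have hm₁0 : 0 < m₁ := by positivity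
  set m₂ := β * c / (C.toReal + 1) with hm₂
  have hm₂0 : 0 < m₂ := by have := C.toReal_nonneg; positivity
  refine ⟨min m₁ m₂, lt_min hm₁0 hm₂0, fun A hA hA01 hcA hm => ?_⟩
  set D := t • A + (1 - t) • A with hD
  have hfib : ∀ k : Fin (n + 1), ∃ (y : Fin n → ℝ) (a b : ℝ),
      IsLeast ((fun s : ℝ => (s, y)) ⁻¹' (insertEquiv k ⁻¹' A)) a ∧
      IsGreatest ((fun s : ℝ => (s, y)) ⁻¹' (insertEquiv k ⁻¹' A)) b ∧
      ENNReal.ofReal (c / 2) ≤ fibreVolume (insertEquiv k ⁻¹' A) y ∧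
      ENNReal.ofReal (b - a) - fibreVolume (insertEquiv k ⁻¹' A) y < ENNReal.ofReal κ₁ := by
    intro k
    refine exists_nearly_full_fibre ht0 ht2 (isCompact_insertEquiv_preimage k hA) ?_ ?_
      (half_pos hc) hκ₁0 ?_ ?_
    · intro p hp
      have h1 := hA01 hp
      have h2 := h1.1 k; have h3 := h1.2 k
      simp [insertEquiv_apply] at h2 h3
      exact ⟨h2, h3⟩
    · intro p hp
      have h1 := hA01 hp
      constructor <;> intro j
      · have := h1.1 (k.succAbove j); simpa [insertEquiv_apply] using this
      · have := h1.2 (k.succAbove j); simpa [insertEquiv_apply] using this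
    · rwa [volume_insertEquiv_preimage, mul_div_cancel₀ _ two_ne_zero]
    · rw [← preimage_combo, ← preimage_sdiff, volume_insertEquiv_preimage]
      exact hm.trans_le (ENNReal.ofReal_le_ofReal (min_le_left _ _))
  choose y a b hy1 hy2 hy3 hy4 using hfib
  set S : Fin (n + 1) → Set ℝ := fun k => (fun s : ℝ => (s, y k)) ⁻¹' (insertEquiv k ⁻¹' A) with hS
  have hScl : ∀ k, IsClosed (S k) := fun k =>
    hA.isClosed.preimage ((continuous_insertEquiv k).comp (by fun_prop))
  have hSI : ∀ k, S k ⊆ Icc (a k) (b k) := fun k s hs => ⟨(hy1 k).2 hs, (hy2 k).2 hs⟩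
  have hS01 : ∀ k, S k ⊆ Icc 0 1 := by
    intro k s hs
    have h1 := hA01 hs
    have h2 := h1.1 k; have h3 := h1.2 k
    simp [insertEquiv_apply] at h2 h3
    exact ⟨h2, h3⟩
  have hI01 : ∀ k, volume (Icc (a k) (b k)) ≤ 1 := fun k => by
    rw [Real.volume_Icc, ENNReal.ofReal_le_one]
    have := (hS01 k (hy1 k).1).1; have := (hS01 k (hy2 k).1).2; linarith
  have hab : ∀ k, c / 2 ≤ b k - a k := by
    intro k
    have h1 := (hy3 k).trans (measure_mono (hSI k))
    rw [Real.volume_Icc] at h1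
    have hba : a k ≤ b k := (hy1 k).2 (hy2 k).1
    exact (ENNReal.ofReal_le_ofReal_iff (by linarith)).1 h1
  have hIS : ∀ k, volume (Icc (a k) (b k) \ S k) ≤ ENNReal.ofReal κ₁ := by
    intro k
    rw [measure_sdiff (hSI k) (hScl k).measurableSet.nullMeasurableSet
      ((measure_mono (hS01 k)).trans_lt (by simp)).ne, Real.volume_Icc]
    exact (hy4 k).le
  -- Fubini over the choices of chord points
  set w : Fin (n + 1) → ℝ := fun k => t * (1 - t) ^ (k : ℕ) with hw
  have hw0 : ∀ k, 0 < w k := fun k => by positivity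
  have hw1 : ∀ k, w k ≤ 1 := fun k => by
    refine mul_le_one₀ (by linarith) (by positivity) (pow_le_one₀ hr0.le (by linarith))
  set s₀ : Fin (n + 1) → ℝ := ∑ k, w k • insertEquiv k (0, y k) with hs₀
  have hsum : ∀ u : Fin (n + 1) → ℝ, ∑ k, w k • insertEquiv k (u k, y k) = s₀ + w * u := by
    intro u
    have : ∀ k, insertEquiv k (u k, y k) = insertEquiv k (0, y k) + Pi.single k (u k) := by
      intro k
      ext j
      rcases eq_or_ne j k with rfl | hj
      · simp [insertEquiv_apply]
      · obtain ⟨i, rfl⟩ := Fin.exists_succAbove_eq hj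
        simp [insertEquiv_apply, Fin.succAbove_ne]
    simp only [this, smul_add, Finset.sum_add_distrib]
    rw [← hs₀]
    congr 1
    ext j
    simp [Finset.sum_apply, Pi.single_apply]
  set F : (Fin (n + 1) → ℝ) × (Fin (n + 1) → ℝ) → Fin (n + 1) → ℝ :=
    fun p => (1 - t) ^ (n + 1) • p.1 + (s₀ + w * p.2) with hF
  have hFm : Measurable F := by
    have h : Continuous F := by fun_prop
    exact h.measurable
  set P : Set (Fin (n + 1) → ℝ) := univ.pi S with hP
  have hPm : MeasurableSet P := MeasurableSet.univ_pi fun k => (hScl k).measurableSet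
  have hP1 : volume P ≤ 1 := by
    rw [hP, volume_pi_pi]
    exact Finset.prod_le_one' fun k _ => (measure_mono (hSI k)).trans (hI01 k)
  set B : Set ((Fin (n + 1) → ℝ) × (Fin (n + 1) → ℝ)) := (A ×ˢ P) \ F ⁻¹' A with hB
  have hBm : MeasurableSet B := (hA.measurableSet.prod hPm).diff (hFm hA.measurableSet)
  have hBv : volume B ≤ C * volume (D \ A) := by
    rw [Measure.volume_eq_prod, Measure.prod_apply_symm hBm]
    calc ∫⁻ u, volume ((fun x => (x, u)) ⁻¹' B)
        ≤ ∫⁻ u, P.indicator (fun _ => C * volume (D \ A)) u := by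
          refine lintegral_mono fun u => ?_
          by_cases hu : u ∈ P
          · rw [indicator_of_mem hu]
            have h := hiter A (fun k => insertEquiv k (u k, y k)) (fun k => hu k (mem_univ k))
            refine le_trans (measure_mono ?_) h
            rintro x ⟨⟨hx, -⟩, hx'⟩
            refine ⟨hx, ?_⟩
            rw [hsum u]; exact hx'
          · have : (fun x => (x, u)) ⁻¹' B = ∅ := by
              ext x; simp only [mem_preimage, mem_empty_iff_false, iff_false]
              exact fun h => hu h.1.2
            rw [this, measure_empty]; exact zero_le
      _ = C * volume (D \ A) * volume P := by
          rw [lintegral_indicator hPm, setLIntegral_const]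
      _ ≤ _ := mul_le_of_le_one_right zero_le hP1
  obtain ⟨x, hxA, hx⟩ : ∃ x ∈ A, volume (Prod.mk x ⁻¹' B) ≤ ENNReal.ofReal β := by
    by_contra! hcon
    have h1 : ENNReal.ofReal β * volume A ≤ volume B := by
      rw [Measure.volume_eq_prod, Measure.prod_apply hBm, ← setLIntegral_const]
      exact (setLIntegral_mono' hA.measurableSet fun x hx => (hcon x hx).le).trans
        (setLIntegral_le_lintegral _ _)
    have h2 : ENNReal.ofReal β * ENNReal.ofReal c ≤ C * volume (D \ A) :=
      (mul_le_mul_right hcA _).trans (h1.trans hBv)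
    have hm2 : volume (D \ A) < ENNReal.ofReal m₂ :=
      hm.trans_le (ENNReal.ofReal_le_ofReal (min_le_right _ _))
    have hne : volume (D \ A) ≠ ⊤ := hm2.ne_top
    rw [← ENNReal.ofReal_toReal hC, ← ENNReal.ofReal_toReal hne, ← ENNReal.ofReal_mul hβ0.le,
      ← ENNReal.ofReal_mul ENNReal.toReal_nonneg,
          ENNReal.ofReal_le_ofReal_iff (by positivity)] at h2
    rw [← ENNReal.ofReal_toReal hne, ENNReal.ofReal_lt_ofReal_iff hm₂0, hm₂,
      lt_div_iff₀ (by have := C.toReal_nonneg; positivity)] at hm2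
    have := (volume (D \ A)).toReal_nonneg
    nlinarith
  set s₁ := (1 - t) ^ (n + 1) • x + s₀ with hs₁
  set o : Fin (n + 1) → ℝ := s₁ + w * (fun k => (a k + b k) / 2) with ho
  refine ⟨o, ?_⟩
  set U : Set (Fin (n + 1) → ℝ) := (univ.pi fun k => Icc (a k) (b k)) \
    (fun u => s₁ + w * u) ⁻¹' A with hU
  have hsub : Metric.closedBall o r \ A ⊆ (fun u => s₁ + w * u) '' U := by
    rintro z ⟨hz, hzA⟩
    have hzu : s₁ + w * (fun k => (z k - s₁ k) / w k) = z := by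
      ext k
      have := (hw0 k).ne'
      simp only [Pi.add_apply, Pi.mul_apply]; field_simp; ring
    refine ⟨fun k => (z k - s₁ k) / w k, ⟨fun k _ => ?_, ?_⟩, hzu⟩
    · have h1 := (dist_le_pi_dist z o k).trans hz
      rw [Real.dist_eq, abs_le] at h1
      simp only [ho, Pi.add_apply, Pi.mul_apply] at h1
      have h2 : r ≤ w k * ((b k - a k) / 2) := by
        have h3 : t * (1 - t) ^ n ≤ w k := by
          refine mul_le_mul_of_nonneg_left ?_ ht0.le
          exact pow_le_pow_of_le_one hr0.le (by linarith) (by have := k.2; omega)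
        calc r = t * (1 - t) ^ n * (c / 2 / 2) := by rw [hr]; ring
          _ ≤ _ := by
            refine mul_le_mul h3 (by linarith [hab k]) (by positivity) (hw0 k).le
      constructor
      · rw [le_div_iff₀ (hw0 k)]; nlinarith
      · rw [div_le_iff₀ (hw0 k)]; nlinarith
    · rw [mem_preimage, hzu]; exact hzA
  refine (measure_mono hsub).trans
    ((volume_image_diagonal_le (fun k => (hw0 k).le) hw1 s₁ U).trans ?_)
  have hU2 : U ⊆ ((univ.pi fun k => Icc (a k) (b k)) \ P) ∪ Prod.mk x ⁻¹' B := by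
    rintro u ⟨hu, hu'⟩
    by_cases hP' : u ∈ P
    · refine Or.inr ⟨⟨hxA, hP'⟩, fun h => hu' ?_⟩
      simpa [hF, hs₁, add_assoc] using h
    · exact Or.inl ⟨hu, hP'⟩
  refine (measure_mono hU2).trans ((measure_union_le _ _).trans ?_)
  calc _ ≤ ∑ k : Fin (n + 1), ENNReal.ofReal κ₁ + ENNReal.ofReal β :=
        add_le_add ((volume_pi_diff_pi_le hI01).trans (Finset.sum_le_sum fun k _ => hIS k)) hx
    _ = ENNReal.ofReal κ := by
        rw [Finset.sum_const, Finset.card_univ, Fintype.card_fin, nsmul_eq_mul,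
          ← ENNReal.ofReal_natCast, ← ENNReal.ofReal_mul (by positivity),
          ← ENNReal.ofReal_add (by positivity) hβ0.le]
        congr 1
        rw [hκ₁, hβ]; push_cast; field_simp; ring

theorem mem_of_isClosed_of_combo {t : ℝ} (ht0 : 0 < t) (ht1 : t < 1) {L : Set ℝ}
    (hL : IsClosed L) (h0 : (0 : ℝ) ∈ L) (h1 : (1 : ℝ) ∈ L)
    (hc : ∀ a ∈ L, ∀ b ∈ L, t * a + (1 - t) * b ∈ L) {z : ℝ} (hz : z ∈ Icc (0 : ℝ) 1) : z ∈ L := by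
  by_contra hzL
  obtain ⟨a, ⟨haL, ha0, haz⟩, ha⟩ := (isCompact_Icc.inter_left hL).exists_isGreatest
    (s := L ∩ Icc 0 z) ⟨0, h0, le_rfl, hz.1⟩
  obtain ⟨b, ⟨hbL, hbz, hb1⟩, hb⟩ := (isCompact_Icc.inter_left hL).exists_isLeast
    (s := L ∩ Icc z 1) ⟨1, h1, hz.2, le_rfl⟩
  have haz' : a < z := lt_of_le_of_ne haz fun h => hzL (h ▸ haL)
  have hbz' : z < b := lt_of_le_of_ne hbz fun h => hzL (h ▸ hbL)
  have hab := hc a haL b hbL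
  have h2 : a < t * a + (1 - t) * b := by nlinarith
  have h3 : t * a + (1 - t) * b < b := by nlinarith
  rcases le_total (t * a + (1 - t) * b) z with h | h
  · exact absurd (ha ⟨hab, by linarith, h⟩) (not_le.2 h2)
  · exact absurd (hb ⟨hab, h, by linarith⟩) (not_le.2 h3)

/-- The closure of a set stable under `t`-combinations is convex. -/
theorem convex_closure_of_combo {E : Type*} [NormedAddCommGroup E] [NormedSpace ℝ E]
    {t : ℝ} (ht0 : 0 < t) (ht1 : t < 1) {S : Set E}
    (hc : ∀ a ∈ S, ∀ b ∈ S, t • a + (1 - t) • b ∈ S) : Convex ℝ (closure S) := by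
  have hc' : ∀ a ∈ closure S, ∀ b ∈ closure S, t • a + (1 - t) • b ∈ closure S :=
    fun a ha b hb => map_mem_closure₂ (f := fun a b => t • a + (1 - t) • b) (by fun_prop) ha hb hc
  rw [convex_iff_segment_subset]
  intro x hx y hy
  rw [segment_eq_image_lineMap]
  rintro _ ⟨z, hz, rfl⟩
  refine mem_of_isClosed_of_combo ht0 ht1
    (L := (AffineMap.lineMap x y : ℝ →ᵃ[ℝ] E) ⁻¹' closure S)
    (isClosed_closure.preimage AffineMap.lineMap_continuous) (by simpa) (by simpa) ?_ hz
  intro a ha b hb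
  have := hc' _ ha _ hb
  simp only [mem_preimage, AffineMap.lineMap_apply_module] at this ⊢
  convert this using 1
  module

/-- `SpreadBound t ρ p c` says that translating a `ρ`-scaled convex set towards the point with
barycentric coordinates `p` with respect to points of `A` loses at most `c` times the
doubling deficit. -/
def SpreadBound (d : ℕ) {ι : Type*} [Fintype ι] (t ρ : ℝ) (p : ι → ℝ) (c : ℝ≥0∞) : Prop :=
  ∀ (A M G : Set (Fin d → ℝ)) (v : ι → Fin d → ℝ), IsCompact A → MeasurableSet M →
    t • A + (1 - t) • A ⊆ M → (∀ i, v i ∈ A) → IsCompact G → Convex ℝ G →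
    volume ((fun x => (1 - ρ) • ∑ i, p i • v i + ρ • x) '' G \ A) ≤
      ENNReal.ofReal (ρ ^ d) * volume (G \ A) + c * volume (M \ A)

theorem SpreadBound.mono {d : ℕ} {ι : Type*} [Fintype ι] {t ρ : ℝ} {p : ι → ℝ} {c c' : ℝ≥0∞}
    (h : SpreadBound d t ρ p c) (hc : c ≤ c') : SpreadBound d t ρ p c' :=
  fun A M G v h1 h2 h3 h4 h5 h6 => (h A M G v h1 h2 h3 h4 h5 h6).trans (by gcongr)

theorem volume_iterate_homothety_le {d : ℕ} {t : ℝ} (ht0 : 0 < t) (ht1 : t < 1)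
    {A M G : Set (Fin d → ℝ)}
    (hM : t • A + (1 - t) • A ⊆ M) {v : Fin d → ℝ} (hv : v ∈ A) (j : ℕ) :
    volume ((fun x => (1 - (1 - t) ^ j) • v + (1 - t) ^ j • x) '' G \ A) ≤
      ENNReal.ofReal (((1 - t) ^ j) ^ d) * volume (G \ A) + j * volume (M \ A) := by
  have hr0 : 0 < 1 - t := by linarith
  induction j with
  | zero => simp
  | succ j ih =>
    set Q := (fun x => (1 - (1 - t) ^ j) • v + (1 - t) ^ j • x) '' G with hQ
    have hsub : (fun x => (1 - (1 - t) ^ (j + 1)) • v + (1 - t) ^ (j + 1) • x) '' G \ A ⊆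
        ((fun x => t • v + (1 - t) • x) '' (Q \ A)) ∪ (M \ A) := by
      rintro _ ⟨⟨x, hx, rfl⟩, hxA⟩
      have heq : (1 - (1 - t) ^ (j + 1)) • v + (1 - t) ^ (j + 1) • x =
          t • v + (1 - t) • ((1 - (1 - t) ^ j) • v + (1 - t) ^ j • x) := by module
      by_cases h : (1 - (1 - t) ^ j) • v + (1 - t) ^ j • x ∈ A
      · exact Or.inr ⟨hM ⟨_, ⟨v, hv, rfl⟩, _, ⟨_, h, rfl⟩, heq.symm⟩, hxA⟩
      · exact Or.inl ⟨_, ⟨⟨x, hx, rfl⟩, h⟩, heq.symm⟩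
    refine (measure_mono hsub).trans ((measure_union_le _ _).trans ?_)
    rw [volume_image_affine hr0.le]
    have h1 : (1 - t) ^ d ≤ 1 := pow_le_one₀ hr0.le (by linarith)
    calc ENNReal.ofReal ((1 - t) ^ d) * volume (Q \ A) + volume (M \ A)
        ≤ ENNReal.ofReal ((1 - t) ^ d) * (ENNReal.ofReal (((1 - t) ^ j) ^ d) * volume (G \ A) +
            j * volume (M \ A)) + volume (M \ A) := by gcongr
      _ = ENNReal.ofReal (((1 - t) ^ (j + 1)) ^ d) * volume (G \ A) +
            ENNReal.ofReal ((1 - t) ^ d) * (j * volume (M \ A)) + volume (M \ A) := by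
          rw [mul_add, ← mul_assoc, ← ENNReal.ofReal_mul (by positivity), pow_succ, mul_pow,
            mul_comm ((1 - t) ^ d)]
      _ ≤ ENNReal.ofReal (((1 - t) ^ (j + 1)) ^ d) * volume (G \ A) +
            1 * (j * volume (M \ A)) + volume (M \ A) := by
          gcongr
          exact ENNReal.ofReal_le_one.2 h1
      _ = _ := by push_cast; ring

theorem SpreadBound.single (d : ℕ) {ι : Type*} [Fintype ι] [DecidableEq ι] {t : ℝ}
    (ht0 : 0 < t) (ht1 : t < 1)
    (j : ℕ) (i : ι) : SpreadBound d t ((1 - t) ^ j) (Pi.single i 1) j := by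
  intro A M G v hA hM hDM hv hG hGc
  have : ∑ k, (Pi.single i 1 : ι → ℝ) k • v k = v i := by
    simp [Pi.single_apply, ite_smul]
  rw [this]
  exact volume_iterate_homothety_le ht0 ht1 hDM (hv i) j

theorem SpreadBound.combo {d : ℕ} {ι : Type*} [Fintype ι] {t ρ : ℝ} (ht0 : 0 < t) (ht1 : t < 1)
    (hρ : 0 ≤ ρ) {p q : ι → ℝ} {c : ℝ≥0∞} (hp : SpreadBound d t ρ p c)
    (hq : SpreadBound d t ρ q c) : SpreadBound d t ρ (t • p + (1 - t) • q) (c + 1) := by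
  intro A M G v hA hM hDM hv hG hGc
  set P := fun p : ι → ℝ => (fun x => (1 - ρ) • ∑ i, p i • v i + ρ • x) '' G with hP
  have hPc : ∀ p, IsCompact (P p) := fun p => hG.image (by fun_prop)
  have hPv : ∀ p, volume (P p) = ENNReal.ofReal (ρ ^ d) * volume G := fun p =>
    volume_image_affine hρ _ _
  set err := ENNReal.ofReal (ρ ^ d) * volume (G \ A) + c * volume (M \ A) with herr
  have hlow : ∀ p, SpreadBound d t ρ p c →
      ENNReal.ofReal (ρ ^ d) * volume G - err ≤ volume (P p ∩ A) := by
    intro p hp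
    have h := hp A M G v hA hM hDM hv hG hGc
    rw [tsub_le_iff_right, ← hPv p, ← measure_inter_add_sdiff (P p) hA.measurableSet]
    gcongr
  set Z := t • (P p ∩ A) + (1 - t) • (P q ∩ A) with hZ
  have hXc : ∀ p, IsCompact (P p ∩ A) := fun p => (hPc p).inter hA
  have hZc : IsCompact Z := isCompact_combo (hXc p) (hXc q) t
  have hZv : ENNReal.ofReal (ρ ^ d) * volume G - err ≤ volume Z :=
    (mulBrunnMinkowski_pi ht0 ht1 d).le_volume ht0 ht1 (hXc p).measurableSet (hXc q).measurableSet
      (hlow p hp) (hlow q hq)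
  have hZM : Z ⊆ M := by
    refine Subset.trans ?_ hDM
    rintro _ ⟨_, ⟨x, hx, rfl⟩, _, ⟨y, hy, rfl⟩, rfl⟩
    exact ⟨_, ⟨x, hx.2, rfl⟩, _, ⟨y, hy.2, rfl⟩, rfl⟩
  have hZP : Z ⊆ P (t • p + (1 - t) • q) := by
    rintro _ ⟨_, ⟨_, ⟨⟨x, hx, rfl⟩, -⟩, rfl⟩, _, ⟨_, ⟨⟨y, hy, rfl⟩, -⟩, rfl⟩, rfl⟩
    refine ⟨t • x + (1 - t) • y, hGc hx hy ht0.le (by linarith) (by ring), ?_⟩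
    simp only [Pi.add_apply, Pi.smul_apply, add_smul, Finset.sum_add_distrib, smul_assoc,
      ← Finset.smul_sum]
    module
  change volume (P (t • p + (1 - t) • q) \ A) ≤ _
  have hsub : P (t • p + (1 - t) • q) \ A ⊆ (P (t • p + (1 - t) • q) \ Z) ∪ (M \ A) := by
    rintro x ⟨hx, hxA⟩
    by_cases hxZ : x ∈ Z
    · exact Or.inr ⟨hZM hxZ, hxA⟩
    · exact Or.inl ⟨hx, hxZ⟩
  refine (measure_mono hsub).trans ((measure_union_le _ _).trans ?_)
  rw [measure_sdiff hZP hZc.measurableSet.nullMeasurableSet hZc.measure_lt_top.ne, hPv, add_mul,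
    one_mul, ← add_assoc, ← herr]
  gcongr
  exact (tsub_le_tsub_left hZv _).trans tsub_tsub_le

theorem exists_spreadBound_near (d : ℕ) {ι : Type*} [Fintype ι] {t : ℝ} (ht0 : 0 < t) (ht1 : t < 1)
    (j : ℕ) {q : ι → ℝ} (hq : q ∈ stdSimplex ℝ ι) {ε : ℝ} (hε : 0 < ε) :
    ∃ p ∈ stdSimplex ℝ ι, (∃ c, c ≠ ⊤ ∧ SpreadBound d t ((1 - t) ^ j) p c) ∧ dist p q < ε ∧
      ∀ i, q i = 0 → p i = 0 := by
  classical
  have hr0 : 0 < 1 - t := by linarith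
  set S : Set (ι → ℝ) := {p | p ∈ stdSimplex ℝ ι ∧
    (∃ c, c ≠ ⊤ ∧ SpreadBound d t ((1 - t) ^ j) p c) ∧ ∀ i, q i = 0 → p i = 0} with hS
  have hconv : Convex ℝ (closure S) := by
    refine convex_closure_of_combo ht0 ht1 ?_
    rintro p ⟨hp, ⟨c, hc, hpc⟩, hp0⟩ p' ⟨hp', ⟨c', hc', hpc'⟩, hp0'⟩
    refine ⟨convex_stdSimplex ℝ ι hp hp' ht0.le hr0.le (by ring), ⟨max c c' + 1, ?_, ?_⟩, ?_⟩
    · simp [hc, hc']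
    · exact (hpc.mono (le_max_left _ _)).combo ht0 ht1 (by positivity)
        (hpc'.mono (le_max_right _ _))
    · intro i hi; simp [hp0 i hi, hp0' i hi]
  have hmem : q ∈ closure S := by
    have hsum : q = ∑ i ∈ Finset.univ.filter (fun i => q i ≠ 0), q i • (Pi.single i 1 : ι → ℝ) := by
      rw [Finset.sum_filter_of_ne (by intro i _ h hi; simp [hi] at h)]
      ext k; simp [Finset.sum_apply, Pi.single_apply]
    rw [hsum]
    refine hconv.sum_mem (fun i _ => hq.1 i) ?_ fun i hi => subset_closure ?_
    · rw [Finset.sum_filter_ne_zero]; exact hq.2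
    · refine ⟨single_mem_stdSimplex ℝ i, ⟨j, by simp, SpreadBound.single d ht0 ht1 j i⟩,
        fun k hk => ?_⟩
      have : k ≠ i := by rintro rfl; exact (Finset.mem_filter.1 hi).2 hk
      simp [this]
  obtain ⟨p, ⟨h1, h2, h3⟩, h4⟩ := Metric.mem_closure_iff.1 hmem ε hε
  exact ⟨p, h1, h2, by rwa [dist_comm], h3⟩

theorem exists_spreadBound_le (d : ℕ) {ι : Type*} [Fintype ι] {t : ℝ} (ht0 : 0 < t) (ht1 : t < 1)
    (j : ℕ) {q : ι → ℝ} (hq : q ∈ stdSimplex ℝ ι) {δ : ℝ} (hδ : 0 < δ) :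
    ∃ p ∈ stdSimplex ℝ ι, (∃ c, c ≠ ⊤ ∧ SpreadBound d t ((1 - t) ^ j) p c) ∧
      ∀ i, p i ≤ (1 + δ) * q i := by
  obtain ⟨ε, hε, hεq⟩ : ∃ ε > 0, ∀ i, 0 < q i → ε ≤ δ * q i := by
    have h : ∀ᶠ ε in nhdsWithin (0 : ℝ) (Ioi 0), ∀ i, 0 < q i → ε ≤ δ * q i := by
      rw [Filter.eventually_all]
      intro i
      by_cases hi : 0 < q i
      · have : ∀ᶠ ε in nhdsWithin (0 : ℝ) (Ioi 0), ε ≤ δ * q i :=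
          Filter.Eventually.filter_mono nhdsWithin_le_nhds (eventually_le_nhds (by positivity))
        exact this.mono fun ε h _ => h
      · exact Filter.Eventually.of_forall fun ε h => absurd h hi
    obtain ⟨ε, h1, h2⟩ := (h.and self_mem_nhdsWithin).exists
    exact ⟨ε, h2, h1⟩
  obtain ⟨p, h1, h2, h3, h4⟩ := exists_spreadBound_near d ht0 ht1 j hq hε
  refine ⟨p, h1, h2, fun i => ?_⟩
  rcases (hq.1 i).eq_or_lt with h | h
  · rw [h4 i h.symm, ← h]; simp
  · have := (dist_le_pi_dist p q i).trans h3.le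
    rw [Real.dist_eq] at this
    have := (abs_le.1 this).2
    have := hεq i h
    linarith

theorem exists_spreadBound_net (d : ℕ) (ι : Type*) [Fintype ι] {t : ℝ} (ht0 : 0 < t) (ht1 : t < 1)
    (j : ℕ) {η : ℝ} (hη : 0 < η) :
    ∃ c : ℝ≥0∞, c ≠ ⊤ ∧ ∀ q ∈ stdSimplex ℝ ι, ∃ p ∈ stdSimplex ℝ ι,
      SpreadBound d t ((1 - t) ^ j) p c ∧ dist p q < η := by
  choose! f hf1 hf2 hf3 _ using fun q (hq : q ∈ stdSimplex ℝ ι) =>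
    exists_spreadBound_near d ht0 ht1 j hq (half_pos hη)
  choose! c hc1 hc2 using hf2
  obtain ⟨T, hT, hTc⟩ := (isCompact_stdSimplex ℝ ι).elim_nhds_subcover
    (fun q => Metric.ball q (η / 2)) fun q _ => Metric.ball_mem_nhds _ (half_pos hη)
  refine ⟨∑ q ∈ T, c q, ENNReal.sum_ne_top.2 fun q hq => hc1 q (hT q hq), fun x hx => ?_⟩
  obtain ⟨q, hq, hxq⟩ := mem_iUnion₂.1 (hTc hx)
  refine ⟨f q, hf1 q (hT q hq), (hc2 q (hT q hq)).mono ?_, ?_⟩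
  · exact Finset.single_le_sum (f := c) (fun _ _ => zero_le) hq
  · have h1 := hf3 q (hT q hq)
    have h2 : dist q x < η / 2 := by rw [dist_comm]; exact hxq
    linarith [dist_triangle (f q) q x]

theorem exists_barycentric_of_mem_convexHull {d : ℕ} {A : Set (Fin d → ℝ)} {y : Fin d → ℝ}
    (hy : y ∈ convexHull ℝ A) : ∃ (v : Fin (d + 1) → Fin d → ℝ) (q : Fin (d + 1) → ℝ),
      (∀ i, v i ∈ A) ∧ q ∈ stdSimplex ℝ (Fin (d + 1)) ∧ ∑ i, q i • v i = y := by
  obtain ⟨ι, _, z, w, hz, hai, hw, hw1, hwz⟩ := eq_pos_convex_span_of_mem_convexHull hy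
  obtain ⟨a₀, ha₀⟩ : A.Nonempty := convexHull_nonempty_iff.1 ⟨y, hy⟩
  have hcard : Fintype.card ι ≤ Fintype.card (Fin (d + 1)) := by
    have := hai.card_le_finrank_succ
    refine this.trans ?_
    simp only [Fintype.card_fin]
    gcongr
    exact (Submodule.finrank_le _).trans (by simp)
  obtain ⟨e⟩ := Function.Embedding.nonempty_of_card_le hcard
  refine ⟨Function.extend e z fun _ => a₀, Function.extend e w 0, fun i => ?_,
    ⟨fun i => ?_, ?_⟩, ?_⟩
  · by_cases hi : ∃ k, e k = i
    · obtain ⟨k, rfl⟩ := hi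
      rw [e.injective.extend_apply]; exact hz ⟨k, rfl⟩
    · rw [Function.extend_apply' _ _ _ hi]; exact ha₀
  · by_cases hi : ∃ k, e k = i
    · obtain ⟨k, rfl⟩ := hi
      rw [e.injective.extend_apply]; exact (hw k).le
    · rw [Function.extend_apply' _ _ _ hi]; rfl
  · rw [← hw1]
    refine (Fintype.sum_of_injective e e.injective _ _ ?_ ?_).symm
    · intro i hi; rw [Function.extend_apply' _ _ _ hi]; rfl
    · intro k; rw [e.injective.extend_apply]
  · rw [← hwz]
    refine (Fintype.sum_of_injective e e.injective _ _ ?_ ?_).symm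
    · intro i hi
      have : Function.extend e w 0 i = 0 := Function.extend_apply' _ _ _ hi
      rw [this, zero_smul]
    · intro k; rw [e.injective.extend_apply, e.injective.extend_apply]

/-- The centre of a nearly full cube is a `t`-combination of points of the set. -/
theorem mem_combo_of_nearly_full {d : ℕ} {t : ℝ} (ht0 : 0 < t) (ht2 : t ≤ 1 / 2)
    {A : Set (Fin d → ℝ)} {x : Fin d → ℝ} {r : ℝ} (hr : 0 ≤ r)
    (hx : volume (Metric.closedBall x r \ A) < ENNReal.ofReal (t ^ d * (2 * r) ^ d / 2)) :
    x ∈ t • A + (1 - t) • A := by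
  have hr0 : 0 < 1 - t := by linarith
  by_contra hcon
  set Y := Metric.closedBall x r \ A with hY
  set B := Metric.closedBall (0 : Fin d → ℝ) r with hB
  set N : Set (Fin d → ℝ) := {z | t • z + x ∈ Y} with hN
  have hcov : B ⊆ {z | (1 - t) • z + x ∈ Y} ∪ -N := by
    intro z hz
    rw [hB, mem_closedBall_zero_iff] at hz
    by_cases h1 : (1 - t) • z + x ∈ A
    · right
      rw [Set.mem_neg, hN, mem_ofPred_eq]
      refine ⟨?_, fun h2 => hcon ⟨_, ⟨_, h1, rfl⟩, _, ⟨_, h2, rfl⟩, ?_⟩⟩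
      · rw [mem_closedBall_iff_norm, add_sub_cancel_right, norm_smul, norm_neg, Real.norm_eq_abs,
          abs_of_pos ht0]
        nlinarith [norm_nonneg z]
      · simp only; module
    · left
      refine ⟨?_, h1⟩
      rw [mem_closedBall_iff_norm, add_sub_cancel_right, norm_smul, Real.norm_eq_abs,
        abs_of_pos hr0]
      nlinarith [norm_nonneg z]
  have h1 := (measure_mono hcov).trans (measure_union_le (μ := volume) _ _)
  rw [Measure.measure_neg, volume_preimage_affine hr0, hN, volume_preimage_affine ht0, hB,
    Real.volume_pi_closedBall _ hr, Fintype.card_fin] at h1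
  have h2 : ENNReal.ofReal ((1 - t) ^ d)⁻¹ ≤ ENNReal.ofReal (t ^ d)⁻¹ := by
    apply ENNReal.ofReal_le_ofReal
    gcongr
    linarith
  have h3 : ENNReal.ofReal ((2 * r) ^ d) ≤ ENNReal.ofReal (2 * (t ^ d)⁻¹) * volume Y := by
    refine h1.trans ?_
    rw [two_mul, ENNReal.ofReal_add (by positivity) (by positivity), add_mul]
    gcongr
  have h4 : ENNReal.ofReal (2 * (t ^ d)⁻¹) * volume Y < ENNReal.ofReal ((2 * r) ^ d) := by
    have : ENNReal.ofReal ((2 * r) ^ d) =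
        ENNReal.ofReal (2 * (t ^ d)⁻¹) * ENNReal.ofReal (t ^ d * (2 * r) ^ d / 2) := by
      rw [← ENNReal.ofReal_mul (by positivity)]
      congr 1; field_simp
    rw [this]
    exact ENNReal.mul_lt_mul_right (by simp; positivity) ENNReal.ofReal_ne_top hx
  exact absurd h3 (not_le.2 h4)

theorem dist_sum_smul_le {d : ℕ} {v : Fin (d + 1) → Fin d → ℝ}
    (hv : ∀ i, v i ∈ Icc (0 : Fin d → ℝ) 1)
    (p q : Fin (d + 1) → ℝ) : dist (∑ i, p i • v i) (∑ i, q i • v i) ≤ (d + 1) * dist p q := by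
  rw [dist_eq_norm, ← Finset.sum_sub_distrib]
  refine (norm_sum_le _ _).trans ?_
  calc ∑ i, ‖p i • v i - q i • v i‖ ≤ ∑ _i : Fin (d + 1), dist p q := by
        refine Finset.sum_le_sum fun i _ => ?_
        rw [← sub_smul, norm_smul, ← dist_eq_norm, ← mul_one (dist p q)]
        refine mul_le_mul (dist_le_pi_dist p q i) ?_ (norm_nonneg _) dist_nonneg
        rw [pi_norm_le_iff_of_nonneg zero_le_one]
        intro k
        rw [Real.norm_eq_abs, abs_le]
        have h1 := (hv i).1 k; have h2 := (hv i).2 k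
        simp at h1 h2
        constructor <;> linarith
    _ = _ := by simp

/-- The doubled set contains a large homothetic copy of the convex hull. -/
theorem exists_homothetic_hull_subset (n : ℕ) {t c : ℝ} (ht0 : 0 < t) (ht2 : t ≤ 1 / 2)
    (hc : 0 < c) (j : ℕ) : ∃ m₀ : ℝ, 0 < m₀ ∧
      ∀ A : Set (Fin (n + 1) → ℝ), IsCompact A → A ⊆ Icc 0 1 →
        ENNReal.ofReal c ≤ volume A →
        volume ((t • A + (1 - t) • A) \ A) < ENNReal.ofReal m₀ →
        ∃ o, o ∈ interior (t • A + (1 - t) • A) ∧ ∀ y ∈ convexHull ℝ A,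
          o + (1 - (1 - t) ^ j) • (y - o) ∈ t • A + (1 - t) • A := by
  have hr0 : 0 < 1 - t := by linarith
  obtain ⟨r, hr, hcube⟩ := exists_nearly_full_cube n ht0 ht2 hc
  set ρ := (1 - t) ^ j with hρ
  have hρ0 : 0 < ρ := by positivity
  have hρ1 : ρ ≤ 1 := pow_le_one₀ hr0.le (by linarith)
  obtain ⟨C, hC, hnet⟩ := exists_spreadBound_net (n + 1) (Fin (n + 1 + 1)) (t := t)
    ht0 (by linarith) j
    (η := ρ * r / (2 * (n + 2))) (by positivity)
  set κ := t ^ (n + 1) * (2 * (ρ * (r / 2))) ^ (n + 1) / 2 with hκ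
  have hκ0 : 0 < κ := by positivity
  obtain ⟨m₁, hm₁, hcube⟩ := hcube (κ / 2) (by positivity)
  have hC0 := C.toReal_nonneg
  refine ⟨min m₁ (κ / (2 * (C.toReal + 1))), lt_min hm₁ (by positivity), fun A hA hA01 hcA hm => ?_⟩
  obtain ⟨o, ho⟩ := hcube A hA hA01 hcA
    (hm.trans_le (ENNReal.ofReal_le_ofReal (min_le_left _ _)))
  refine ⟨o, ?_, fun y hy => ?_⟩
  · rw [mem_interior_iff_mem_nhds]
    refine Filter.mem_of_superset (Metric.ball_mem_nhds o (half_pos hr)) fun z hz => ?_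
    refine mem_combo_of_nearly_full ht0 ht2 (half_pos hr).le ?_
    refine (measure_mono (sdiff_subset_sdiff_left
      (Metric.closedBall_subset_closedBall' (ε₂ := r) (y := o) ?_))).trans_lt (ho.trans_lt ?_)
    · linarith [Metric.mem_ball.1 hz]
    · refine (ENNReal.ofReal_lt_ofReal_iff (by positivity)).2 ?_
      have : κ ≤ t ^ (n + 1) * (2 * (r / 2)) ^ (n + 1) / 2 := by
        rw [hκ]; gcongr
        exact mul_le_of_le_one_left (by positivity) hρ1
      linarith
  · obtain ⟨v, q, hv, hq, rfl⟩ := exists_barycentric_of_mem_convexHull hy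
    obtain ⟨p, hp, hpC, hpq⟩ := hnet q hq
    have h := hpC A (t • A + (1 - t) • A) (Metric.closedBall o r) v hA
      (isCompact_combo hA hA t).measurableSet subset_rfl hv (isCompact_closedBall _ _)
      (convex_closedBall _ _)
    refine mem_combo_of_nearly_full ht0 ht2 (r := ρ * (r / 2)) (by positivity) ?_
    have hsub : Metric.closedBall (o + (1 - ρ) • (∑ i, q i • v i - o)) (ρ * (r / 2)) ⊆
        (fun x => (1 - ρ) • ∑ i, p i • v i + ρ • x) '' Metric.closedBall o r := by
      intro z hz
      refine ⟨ρ⁻¹ • (z - (1 - ρ) • ∑ i, p i • v i), ?_, ?_⟩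
      · have h1 := dist_sum_smul_le (fun i => hA01 (hv i)) p q
        have h2 : (n + 1 + 1 : ℝ) * dist p q ≤ ρ * (r / 2) := by
          rw [lt_div_iff₀ (by positivity)] at hpq
          nlinarith
        push_cast at h1
        have h3 : ρ⁻¹ • (z - (1 - ρ) • ∑ i, p i • v i) - o = ρ⁻¹ •
            ((z - (o + (1 - ρ) • (∑ i, q i • v i - o))) -
              (1 - ρ) • (∑ i, p i • v i - ∑ i, q i • v i)) := by
          have : o = ρ⁻¹ • (ρ • o) := by rw [inv_smul_smul₀ hρ0.ne']
          nth_rewrite 1 [this]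
          rw [← smul_sub]
          congr 1
          module
        rw [mem_closedBall_iff_norm, h3, norm_smul, norm_inv, Real.norm_eq_abs, abs_of_pos hρ0,
          inv_mul_le_iff₀ hρ0]
        rw [mem_closedBall_iff_norm] at hz
        rw [dist_eq_norm] at h1
        refine (norm_sub_le _ _).trans ?_
        rw [norm_smul, Real.norm_eq_abs, abs_of_nonneg (by linarith : 0 ≤ 1 - ρ)]
        have := norm_nonneg (∑ i, p i • v i - ∑ i, q i • v i)
        nlinarith
      · simp only; rw [smul_inv_smul₀ hρ0.ne']; abel
    refine (measure_mono (sdiff_subset_sdiff_left hsub)).trans_lt (h.trans_lt ?_)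
    have h4 : C * volume ((t • A + (1 - t) • A) \ A) < ENNReal.ofReal (κ / 2) := by
      have hm2 := hm.trans_le (ENNReal.ofReal_le_ofReal (min_le_right _ _))
      have hne := hm2.ne_top
      rw [← ENNReal.ofReal_toReal hC, ← ENNReal.ofReal_toReal hne,
        ← ENNReal.ofReal_mul ENNReal.toReal_nonneg, ENNReal.ofReal_lt_ofReal_iff (by positivity)]
      rw [← ENNReal.ofReal_toReal hne, ENNReal.ofReal_lt_ofReal_iff (by positivity),
        lt_div_iff₀ (by positivity)] at hm2
      have := (volume ((t • A + (1 - t) • A) \ A)).toReal_nonneg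
      nlinarith
    rw [← hκ]
    have h5 : ENNReal.ofReal κ = ENNReal.ofReal (κ / 2) + ENNReal.ofReal (κ / 2) := by
      rw [← ENNReal.ofReal_add (by positivity) (by positivity), add_halves]
    rw [h5]
    refine ENNReal.add_lt_add_of_le_of_lt ?_ ?_ h4
    · exact ENNReal.mul_ne_top ENNReal.ofReal_ne_top (ho.trans_lt ENNReal.ofReal_lt_top).ne
    · refine (mul_le_of_le_one_left zero_le ?_).trans ho
      exact ENNReal.ofReal_le_one.2 (pow_le_one₀ hρ0.le hρ1)

theorem exists_le_sum_eq {k : ℕ} (f : Fin k → ℕ) {m : ℕ} (hm : m ≤ ∑ i, f i) :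
    ∃ g : Fin k → ℕ, g ≤ f ∧ ∑ i, g i = m := by
  induction k generalizing m with
  | zero => exact ⟨f, le_rfl, by simp at hm ⊢; exact hm.symm⟩
  | succ k ih =>
    rw [Fin.sum_univ_succ] at hm
    obtain ⟨g, hg, hgs⟩ := ih (fun i => f i.succ) (m := m - min (f 0) m) (by omega)
    refine ⟨Fin.cons (min (f 0) m) g, fun i => ?_, ?_⟩
    · refine Fin.cases ?_ (fun i => ?_) i
      · simp
      · simpa using hg i
    · rw [Fin.sum_univ_succ]; simp only [Fin.cons_zero, Fin.cons_succ, hgs]; omega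

/-- The simplex spanned by the origin and the standard basis vectors. -/
def cornerSimplex (d : ℕ) : Set (Fin d → ℝ) := {x | (∀ i, 0 ≤ x i) ∧ ∑ i, x i ≤ 1}

theorem isCompact_cornerSimplex (d : ℕ) : IsCompact (cornerSimplex d) := by
  refine isCompact_Icc.of_isClosed_subset (s := Icc 0 1) ?_ fun x hx => ⟨hx.1, fun i => ?_⟩
  · have h : cornerSimplex d = (⋂ i, {x | 0 ≤ x i}) ∩ {x | ∑ i, x i ≤ 1} := by
      ext x; simp [cornerSimplex]
    rw [h]
    exact (isClosed_iInter fun i => isClosed_le continuous_const (continuous_apply i)).inter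
      (isClosed_le (by fun_prop) continuous_const)
  · exact (Finset.single_le_sum (f := x) (fun j _ => hx.1 j) (Finset.mem_univ i)).trans hx.2

theorem convex_cornerSimplex (d : ℕ) : Convex ℝ (cornerSimplex d) := by
  intro x hx y hy a b ha hb hab
  refine ⟨fun i => ?_, ?_⟩
  · have := hx.1 i; have := hy.1 i
    simp only [Pi.add_apply, Pi.smul_apply, smul_eq_mul]; positivity
  · simp only [Pi.add_apply, Pi.smul_apply, smul_eq_mul, Finset.sum_add_distrib, ← Finset.mul_sum]
    nlinarith [hx.2, hy.2]

/-- The part of the corner simplex near the facet opposite the origin is covered by few small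
copies of it. -/
theorem exists_grid_point {n m : ℕ} {x : Fin (n + 1) → ℝ} (hx : x ∈ cornerSimplex (n + 1)) {s : ℝ}
    (hs : 0 < s) (hxs : (m + (n + 1)) * s ≤ ∑ i, x i) (hm : 0 < m) :
    ∃ u : Fin n → Fin (m + 1), ∑ i, (u i : ℕ) ≤ m ∧
      ∀ i, (m * s) * (Fin.cons (((m : ℝ) - ∑ i, (u i : ℝ)) / m) (fun i => (u i : ℝ) / m) :
        Fin (n + 1) → ℝ) i ≤ x i := by
  obtain ⟨g, hg, hgs⟩ := exists_le_sum_eq (fun i => ⌊x i / s⌋₊) (m := m) (by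
    have h1 : ∀ i, x i / s - 1 ≤ (⌊x i / s⌋₊ : ℝ) := fun i => (Nat.sub_one_lt_floor _).le
    have h2 := Finset.sum_le_sum fun i (_ : i ∈ Finset.univ) => h1 i
    rw [Finset.sum_sub_distrib, ← Finset.sum_div] at h2
    have h3 : (m + (n + 1) : ℝ) ≤ (∑ i, x i) / s := by rwa [le_div_iff₀ hs]
    simp at h2
    have : (m : ℝ) ≤ ∑ i, (⌊x i / s⌋₊ : ℝ) := by linarith
    exact_mod_cast this)
  have hgx : ∀ i, s * g i ≤ x i := fun i => by
    have h1 : (g i : ℝ) ≤ x i / s :=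
      (Nat.cast_le.2 (hg i)).trans (Nat.floor_le (div_nonneg (hx.1 i) hs.le))
    rw [le_div_iff₀ hs] at h1; linarith
  rw [Fin.sum_univ_succ] at hgs
  have hm' : (m : ℝ) ≠ 0 := by positivity
  have hle : ∀ i : Fin n, g i.succ < m + 1 := fun i => by
    have := Finset.single_le_sum (f := fun i : Fin n => g i.succ) (fun j _ => Nat.zero_le _)
      (Finset.mem_univ i)
    have := Nat.le_of_eq hgs
    omega
  refine ⟨fun i => ⟨g i.succ, hle i⟩, by simp only; omega, fun i => ?_⟩
  refine Fin.cases ?_ (fun i => ?_) i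
  · have : ((m : ℝ) - ∑ i : Fin n, (g i.succ : ℝ)) = g 0 := by
      rw [← hgs]; push_cast; ring
    simp only [Fin.cons_zero, this]
    calc (m * s) * ((g 0 : ℝ) / m) = s * g 0 := by field_simp
      _ ≤ _ := hgx 0
  · simp only [Fin.cons_succ]
    calc (m * s) * ((g i.succ : ℝ) / m) = s * g i.succ := by field_simp
      _ ≤ _ := hgx i.succ

theorem exists_pow_parameters (n : ℕ) {t : ℝ} (ht0 : 0 < t) (ht1 : t < 1) :
    ∃ j j' m : ℕ, 0 < m ∧ (1 - t) ^ j' ≤ (1 - t) ^ j / 4 ∧ (1 - t) ^ j < 1 ∧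
      2 * (n + 1) ≤ (1 - t) ^ j * m ∧
      (m + 1 : ℝ) ^ n * ((1 - t) ^ j) ^ (n + 1) ≤ 1 / 2 := by
  have hr0 : 0 < 1 - t := by linarith
  obtain ⟨j, hj⟩ := exists_pow_lt_of_lt_one (y := 1 - t)
    (show (0 : ℝ) < 1 / (2 * (2 * (n + 1) + 2) ^ n) by positivity) (by linarith)
  set ρ := (1 - t) ^ j with hρ
  have hρ0 : 0 < ρ := by positivity
  obtain ⟨j', hj'⟩ := exists_pow_lt_of_lt_one (y := 1 - t) (show 0 < ρ / 4 by positivity)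
    (by linarith)
  have hρ1 : ρ < 1 := hj.trans_le (by
    rw [div_le_one (by positivity)]
    have : (1 : ℝ) ≤ (2 * (n + 1) + 2) ^ n := one_le_pow₀ (by linarith [n.cast_nonneg (α := ℝ)])
    linarith)
  set m := ⌈2 * (n + 1) / ρ⌉₊ with hm
  have h1 : 2 * (n + 1) / ρ ≤ m := Nat.le_ceil _
  have h2 : (m : ℝ) < 2 * (n + 1) / ρ + 1 := Nat.ceil_lt_add_one (by positivity)
  have h3 : (m + 1 : ℝ) * ρ ≤ 2 * (n + 1) + 2 := by
    have : (2 * (n + 1) / ρ) * ρ = 2 * (n + 1) := by field_simp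
    nlinarith
  refine ⟨j, j', m, Nat.ceil_pos.2 (by positivity), hj'.le, hρ1, ?_, ?_⟩
  · rw [div_le_iff₀ hρ0] at h1; linarith
  · calc (m + 1 : ℝ) ^ n * ρ ^ (n + 1) = ((m + 1) * ρ) ^ n * ρ := by rw [mul_pow, pow_succ]; ring
      _ ≤ (2 * (n + 1) + 2) ^ n * (1 / (2 * (2 * (n + 1) + 2) ^ n)) := by gcongr
      _ = 1 / 2 := by field_simp

theorem exists_cornerSimplex_stability (n : ℕ) {t : ℝ} (ht0 : 0 < t) (ht1 : t < 1) :
    ∃ (j : ℕ) (C : ℝ≥0∞), C ≠ ⊤ ∧ ∀ A M : Set (Fin (n + 1) → ℝ), IsCompact A → MeasurableSet M →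
      A ⊆ cornerSimplex (n + 1) → (∀ i, Pi.single i 1 ∈ A) → t • A + (1 - t) • A ⊆ M →
      (∀ x ∈ cornerSimplex (n + 1), ∑ i, x i ≤ 1 - (1 - t) ^ j → x ∈ M) →
      volume (cornerSimplex (n + 1) \ A) ≤ C * volume (M \ A) := by
  have hr0 : 0 < 1 - t := by linarith
  obtain ⟨j, j', m, hm, hj', hρ1, hm2, hN⟩ := exists_pow_parameters n ht0 ht1
  set ρ := (1 - t) ^ j with hρ
  have hρ0 : 0 < ρ := by positivity
  have hm' : (0 : ℝ) < m := by positivity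
  set T := cornerSimplex (n + 1) with hT
  set Γ : Finset (Fin n → Fin (m + 1)) :=
    Finset.univ.filter fun u => ∑ i, (u i : ℕ) ≤ m with hΓ
  set q : (Fin n → Fin (m + 1)) → Fin (n + 1) → ℝ := fun u =>
    Fin.cons (((m : ℝ) - ∑ i, (u i : ℝ)) / m) (fun i => (u i : ℝ) / m) with hq
  have hqs : ∀ u ∈ Γ, q u ∈ stdSimplex ℝ (Fin (n + 1)) := by
    intro u hu
    have hu' := (Finset.mem_filter.1 hu).2
    refine ⟨fun i => ?_, ?_⟩
    · refine Fin.cases ?_ (fun i => ?_) i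
      · simp only [hq, Fin.cons_zero]
        refine div_nonneg (sub_nonneg.2 ?_) hm'.le
        exact_mod_cast hu'
      · simp only [hq, Fin.cons_succ]; positivity
    · rw [Fin.sum_univ_succ]
      simp only [hq, Fin.cons_zero, Fin.cons_succ, ← Finset.sum_div]
      field_simp; ring
  choose! p hp hp2 hp3 using fun u (hu : u ∈ Γ) =>
    exists_spreadBound_le (n + 1) ht0 ht1 j (hqs u hu) (δ := ρ / 4) (by positivity)
  choose! c hc1 hc2 using hp2
  refine ⟨j', 2 * (1 + ∑ u ∈ Γ, c u), ENNReal.mul_ne_top (by simp) (ENNReal.add_ne_top.2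
    ⟨by simp, ENNReal.sum_ne_top.2 hc1⟩), fun A M hA hM hAT hv hDM hbulk => ?_⟩
  set P := fun u => (fun x => (1 - ρ) • ∑ i, p u i • (Pi.single i 1 : Fin (n + 1) → ℝ) + ρ • x) '' T
    with hP
  have hcover : T \ A ⊆ (M \ A) ∪ ⋃ u ∈ Γ, P u \ A := by
    rintro x ⟨hx, hxA⟩
    rcases le_or_gt (∑ i, x i) (1 - (1 - t) ^ j') with h | h
    · exact Or.inl ⟨hbulk x hx h, hxA⟩
    · right
      set s := (1 - ρ) * (1 + ρ / 4) / m with hs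
      have hs0 : 0 < s := by have : 0 < 1 - ρ := by linarith
                             positivity
      have hms : m * s = (1 - ρ) * (1 + ρ / 4) := by rw [hs]; field_simp
      obtain ⟨u, hu, hux⟩ := exists_grid_point (m := m) hx hs0 (by
        have h1 : (n + 1 : ℝ) * s ≤ ρ / 2 * (m * s) := by
          have : 2 * (n + 1) * s ≤ ρ * m * s := by gcongr
          linarith
        rw [add_mul]
        rw [hms] at h1 ⊢
        nlinarith [pow_pos hρ0 2, pow_pos hρ0 3]) hm
      have huΓ : u ∈ Γ := Finset.mem_filter.2 ⟨Finset.mem_univ _, hu⟩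
      refine mem_iUnion₂.2 ⟨u, huΓ, ?_, hxA⟩
      have hsum : ∑ i, p u i • (Pi.single i 1 : Fin (n + 1) → ℝ) = p u := by
        ext k; simp [Finset.sum_apply, Pi.single_apply]
      refine ⟨ρ⁻¹ • (x - (1 - ρ) • p u), ⟨fun i => ?_, ?_⟩, ?_⟩
      · have h1 := hp3 u huΓ i
        have h2 := hux i
        rw [hms] at h2
        simp only [Pi.smul_apply, Pi.sub_apply, smul_eq_mul]
        refine mul_nonneg (by positivity) (sub_nonneg.2 ?_)
        refine le_trans ?_ h2
        rw [mul_assoc]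
        exact mul_le_mul_of_nonneg_left h1 (by linarith)
      · simp only [Pi.smul_apply, Pi.sub_apply, smul_eq_mul, ← Finset.mul_sum,
          Finset.sum_sub_distrib, (hp u huΓ).2]
        rw [inv_mul_le_iff₀ hρ0]
        linarith [hx.2]
      · simp only [hsum]; rw [smul_inv_smul₀ hρ0.ne']; abel
  have hTfin : volume (T \ A) ≠ ⊤ :=
    ((measure_mono sdiff_subset).trans_lt (isCompact_cornerSimplex _).measure_lt_top).ne
  have hbound : volume (T \ A) ≤
      volume (M \ A) * (1 + ∑ u ∈ Γ, c u) + 2⁻¹ * volume (T \ A) := by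
    calc volume (T \ A) ≤ volume (M \ A) + ∑ u ∈ Γ, volume (P u \ A) :=
          (measure_mono hcover).trans ((measure_union_le _ _).trans
            (add_le_add le_rfl (measure_biUnion_finset_le _ _)))
      _ ≤ volume (M \ A) + ∑ u ∈ Γ, (ENNReal.ofReal (ρ ^ (n + 1)) * volume (T \ A) +
            c u * volume (M \ A)) := by
          gcongr with u hu
          exact hc2 u hu A M T _ hA hM hDM hv (isCompact_cornerSimplex _) (convex_cornerSimplex _)
      _ = volume (M \ A) * (1 + ∑ u ∈ Γ, c u) +
            (Γ.card * ENNReal.ofReal (ρ ^ (n + 1))) * volume (T \ A) := by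
          rw [Finset.sum_add_distrib, Finset.sum_const, nsmul_eq_mul, ← Finset.sum_mul]; ring
      _ ≤ _ := by
          gcongr
          have hcard : (Γ.card : ℝ) ≤ (m + 1) ^ n := by
            have := Finset.card_filter_le (Finset.univ : Finset (Fin n → Fin (m + 1)))
              fun u => ∑ i, (u i : ℕ) ≤ m
            simp only [Finset.card_univ, Fintype.card_fun, Fintype.card_fin] at this
            exact_mod_cast this
          rw [← ENNReal.ofReal_natCast, ← ENNReal.ofReal_mul (by positivity)]
          have : (2⁻¹ : ℝ≥0∞) = ENNReal.ofReal (1 / 2) := by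
            rw [one_div, ENNReal.ofReal_inv_of_pos (by norm_num)]; simp
          rw [this]
          apply ENNReal.ofReal_le_ofReal
          exact (mul_le_mul_of_nonneg_right hcard (by positivity)).trans hN
  have h1 : 2⁻¹ * volume (T \ A) + 2⁻¹ * volume (T \ A) ≤
      volume (M \ A) * (1 + ∑ u ∈ Γ, c u) + 2⁻¹ * volume (T \ A) := by
    rwa [← add_mul, ENNReal.inv_two_add_inv_two, one_mul]
  have h2 := (ENNReal.add_le_add_iff_right (ENNReal.mul_ne_top (by simp) hTfin)).1 h1
  calc volume (T \ A) = 2 * (2⁻¹ * volume (T \ A)) := by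
        rw [← mul_assoc, ENNReal.mul_inv_cancel (by simp) (by simp), one_mul]
    _ ≤ 2 * (volume (M \ A) * (1 + ∑ u ∈ Γ, c u)) := by gcongr
    _ = _ := by ring

/-- Every finite family of nonzero linear functionals is simultaneously nonzero at some point of
a given nondegenerate cube. -/
theorem exists_generic_weights {V κ : Type*} [Fintype V] [Finite κ] (φ : κ → (V → ℝ) →ₗ[ℝ] ℝ)
    (hφ : ∀ k, φ k ≠ 0) {η : ℝ} (hη : 0 < η) :
    ∃ w : V → ℝ, (∀ v, w v ∈ Icc 1 (1 + η)) ∧ ∀ k, φ k w ≠ 0 := by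
  by_contra! hcon
  have h1 : univ.pi (fun _ : V => Icc (1 : ℝ) (1 + η)) ⊆ ⋃ k,
      (LinearMap.ker (φ k) : Set (V → ℝ)) := by
    intro w hw
    obtain ⟨k, hk⟩ := hcon w fun v => hw v (mem_univ v)
    exact mem_iUnion.2 ⟨k, hk⟩
  have h2 : volume (⋃ k, (LinearMap.ker (φ k) : Set (V → ℝ))) = 0 := by
    have := Fintype.ofFinite κ
    refine measure_iUnion_null fun k => Measure.addHaar_submodule _ _ fun h => hφ k ?_
    exact LinearMap.ker_eq_top.1 h
  have h3 := measure_mono_null h1 h2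
  rw [volume_pi_pi] at h3
  simp [hη.not_ge] at h3

theorem exists_generic_weights_on_finset {d : ℕ} (V : Finset (Fin d → ℝ)) {η : ℝ} (hη : 0 < η) :
    ∃ w : (Fin d → ℝ) → ℝ, (∀ v ∈ V, 1 ≤ w v ∧ w v ≤ 1 + η) ∧
      ∀ b : Module.Basis (Fin d) ℝ (Fin d → ℝ), (∀ i, b i ∈ V) → ∀ v ∈ V, v ∉ range b →
        ∑ i, b.repr v i * w (b i) ≠ w v := by
  classical
  set κ := {p : (Fin d → V) × V // p.2 ∉ range p.1}
  set c : κ → Fin d → ℝ := fun p => if h : ∃ b : Module.Basis (Fin d) ℝ (Fin d → ℝ),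
      ∀ i, b i = p.1.1 i
    then h.choose.repr p.1.2 else 0 with hc
  set φ : κ → (V → ℝ) →ₗ[ℝ] ℝ := fun p =>
    ∑ i, c p i • LinearMap.proj (p.1.1 i) - LinearMap.proj p.1.2 with hφ
  obtain ⟨w, hw, hwφ⟩ := exists_generic_weights φ (fun p h => by
    have h1 := LinearMap.congr_fun h (Pi.single p.1.2 1)
    have h2 : ∀ i, (Pi.single p.1.2 (1 : ℝ) : V → ℝ) (p.1.1 i) = 0 := fun i =>
      Pi.single_eq_of_ne (fun h => p.2 ⟨i, h⟩) _
    simp [hφ, h2] at h1) hη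
  refine ⟨fun x => if h : x ∈ V then w ⟨x, h⟩ else 0, fun v hv => by simpa [hv] using hw ⟨v, hv⟩,
    fun b hb v hv hvb heq => ?_⟩
  have hp : (⟨v, hv⟩ : V) ∉ range fun i => (⟨b i, hb i⟩ : V) := by
    rintro ⟨i, hi⟩; exact hvb ⟨i, congrArg Subtype.val hi⟩
  refine hwφ ⟨(fun i => ⟨b i, hb i⟩, ⟨v, hv⟩), hp⟩ ?_
  have hex : ∃ b' : Module.Basis (Fin d) ℝ (Fin d → ℝ), ∀ i, b' i = b i := ⟨b, fun _ => rfl⟩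
  have hbb : hex.choose = b := Module.Basis.eq_of_apply_eq hex.choose_spec
  have hcp : c ⟨(fun i => ⟨b i, hb i⟩, ⟨v, hv⟩), hp⟩ = b.repr v := by
    simp only [hc]; rw [dif_pos hex, hbb]
  simp only [hφ, LinearMap.sub_apply, LinearMap.sum_apply, LinearMap.smul_apply,
      LinearMap.proj_apply,
    hcp, smul_eq_mul]
  simp only [hb, hv, dif_pos] at heq
  rw [heq, sub_self]

theorem volume_basis_coord_eq_zero {d : ℕ} (b : Module.Basis (Fin d) ℝ (Fin d → ℝ)) (i : Fin d) :
    volume {x | b.repr x i = 0} = 0 := by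
  have h : {x | b.repr x i = 0} = (LinearMap.ker (b.coord i) : Set (Fin d → ℝ)) := by
    ext x; simp
  rw [h]
  refine Measure.addHaar_submodule _ _ fun h => ?_
  have h1 := LinearMap.congr_fun (LinearMap.ker_eq_top.1 h) (b i)
  simp at h1

/-- The simplex spanned by the origin and a basis. -/
def basisSimplex {d : ℕ} (b : Module.Basis (Fin d) ℝ (Fin d → ℝ)) : Set (Fin d → ℝ) :=
  b.equivFun ⁻¹' cornerSimplex d

theorem map_eq_sum_repr {d : ℕ} (b : Module.Basis (Fin d) ℝ (Fin d → ℝ))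
    (l : (Fin d → ℝ) →ₗ[ℝ] ℝ) (x : Fin d → ℝ) : l x = ∑ i, b.repr x i * l (b i) := by
  conv_lhs => rw [← b.sum_repr x]
  rw [map_sum]
  simp only [map_smul, smul_eq_mul]

theorem range_subset_of_optimal {d : ℕ} {V : Finset (Fin d → ℝ)} {w : (Fin d → ℝ) → ℝ}
    (hgen : ∀ b : Module.Basis (Fin d) ℝ (Fin d → ℝ), (∀ i, b i ∈ V) → ∀ v ∈ V, v ∉ range b →
        ∑ i, b.repr v i * w (b i) ≠ w v)
    {b b' : Module.Basis (Fin d) ℝ (Fin d → ℝ)} (hb : ∀ i, b i ∈ V) (hb' : ∀ i, b' i ∈ V)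
    {l l' : (Fin d → ℝ) →ₗ[ℝ] ℝ} (hl : ∀ i, l (b i) = w (b i)) (hlV : ∀ v ∈ V, l v ≤ w v)
    (hl' : ∀ i, l' (b' i) = w (b' i)) (hlV' : ∀ v ∈ V, l' v ≤ w v) {x : Fin d → ℝ}
    (hx : ∀ i, 0 < b.repr x i) (hx' : ∀ i, 0 < b'.repr x i) : range b' ⊆ range b := by
  have h1 : l' x ≤ l x := by
    rw [map_eq_sum_repr b l', map_eq_sum_repr b l]
    exact Finset.sum_le_sum fun i _ => mul_le_mul_of_nonneg_left ((hlV' _ (hb i)).trans (hl i).ge)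
      (hx i).le
  have h2 : ∑ i, b'.repr x i * (w (b' i) - l (b' i)) ≤ 0 := by
    have h3 := map_eq_sum_repr b' l' x
    have h4 := map_eq_sum_repr b' l x
    simp only [hl'] at h3
    simp only [mul_sub, Finset.sum_sub_distrib]
    linarith
  have h3 : ∀ i ∈ Finset.univ, 0 ≤ b'.repr x i * (w (b' i) - l (b' i)) := fun i _ =>
    mul_nonneg (hx' i).le (sub_nonneg.2 (hlV _ (hb' i)))
  have h4 := (Finset.sum_eq_zero_iff_of_nonneg h3).1 (le_antisymm h2 (Finset.sum_nonneg h3))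
  rintro _ ⟨i, rfl⟩
  by_contra hcon
  refine hgen b hb (b' i) (hb' i) hcon ?_
  have h5 := (mul_eq_zero.1 (h4 i (Finset.mem_univ i))).resolve_left (hx' i).ne'
  have h6 := map_eq_sum_repr b l (b' i)
  simp only [hl] at h6
  linarith

theorem sum_smul_mem_of_zero_mem {d : ℕ} {E : Type*} [AddCommGroup E] [Module ℝ E] {K : Set E}
    (hK : Convex ℝ K) (h0 : (0 : E) ∈ K) {v : Fin d → E} (hv : ∀ i, v i ∈ K) {c : Fin d → ℝ}
    (hc : c ∈ cornerSimplex d) : ∑ i, c i • v i ∈ K := by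
  have h := hK.sum_mem (t := Finset.univ) (w := fun o : Option (Fin d) => o.elim (1 - ∑ i, c i) c)
    (z := fun o : Option (Fin d) => o.elim 0 v) (fun o _ => by
      cases o with
      | none => simpa using hc.2
      | some i => exact hc.1 i) (by simp [Fintype.sum_option]) (fun o _ => by
      cases o with
      | none => exact h0
      | some i => exact hv i)
  simpa [Fintype.sum_option] using h

theorem basisSimplex_eq_preimage {d : ℕ} (b : Module.Basis (Fin d) ℝ (Fin d → ℝ)) :
    b.equivFun.symm ⁻¹' basisSimplex b = cornerSimplex d := by
  ext x; rw [mem_preimage, basisSimplex, mem_preimage, LinearEquiv.apply_symm_apply]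

theorem isCompact_basisSimplex {d : ℕ} (b : Module.Basis (Fin d) ℝ (Fin d → ℝ)) :
    IsCompact (basisSimplex b) := by
  have h : basisSimplex b = b.equivFun.symm '' cornerSimplex d := by
    rw [← basisSimplex_eq_preimage b]
    exact (image_preimage_eq _ b.equivFun.symm.surjective).symm
  rw [h]
  exact (isCompact_cornerSimplex d).image
      b.equivFun.symm.toLinearMap.continuous_of_finiteDimensional

theorem convex_basisSimplex {d : ℕ} (b : Module.Basis (Fin d) ℝ (Fin d → ℝ)) :
    Convex ℝ (basisSimplex b) :=
  (convex_cornerSimplex d).is_linear_preimage b.equivFun.toLinearMap.isLinear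

theorem exists_basisSimplex_stability (n : ℕ) {t : ℝ} (ht0 : 0 < t) (ht1 : t < 1) :
    ∃ (j : ℕ) (C : ℝ≥0∞), C ≠ ⊤ ∧ ∀ A : Set (Fin (n + 1) → ℝ), IsCompact A →
      0 ∈ convexHull ℝ A →
      (∀ y ∈ convexHull ℝ A, (1 - (1 - t) ^ j) • y ∈ t • A + (1 - t) • A) →
      ∀ b : Module.Basis (Fin (n + 1)) ℝ (Fin (n + 1) → ℝ), (∀ i, b i ∈ A) →
        volume (basisSimplex b \ A) ≤
          C * volume (((t • A + (1 - t) • A) \ A) ∩ basisSimplex b) := by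
  obtain ⟨j, C, hC, h⟩ := exists_cornerSimplex_stability n ht0 ht1
  refine ⟨j, C, hC, fun A hA h0 hD b hb => ?_⟩
  set D := t • A + (1 - t) • A with hDdef
  set e := b.equivFun.symm with he
  have heq : e ⁻¹' basisSimplex b = cornerSimplex (n + 1) := basisSimplex_eq_preimage b
  have hTc := isCompact_basisSimplex b
  have hec : Continuous e := e.toLinearMap.continuous_of_finiteDimensional
  have hesymm : Continuous e.symm := e.symm.toLinearMap.continuous_of_finiteDimensional
  have hcpt : ∀ X : Set (Fin (n + 1) → ℝ), IsCompact X → IsCompact (e ⁻¹' X) := fun X hX => by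
    have : e ⁻¹' X = e.symm '' X := by
      ext x; constructor
      · intro hx; exact ⟨e x, hx, by simp⟩
      · rintro ⟨y, hy, rfl⟩; simpa using hy
    rw [this]; exact hX.image hesymm
  have hDc : IsCompact D := isCompact_combo hA hA t
  have key := h (e ⁻¹' (A ∩ basisSimplex b)) (e ⁻¹' (D ∩ basisSimplex b))
    (hcpt _ (hA.inter hTc)) (hcpt _ (hDc.inter hTc)).measurableSet
    (by rw [← heq]; exact preimage_mono inter_subset_right)
    (fun i => by
      have h1 : e (Pi.single i 1) = b i := by
        rw [he, Module.Basis.equivFun_symm_apply]; simp [Pi.single_apply]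
      refine ⟨by rw [h1]; exact hb i, ?_⟩
      change Pi.single i 1 ∈ e ⁻¹' basisSimplex b
      rw [heq]
      refine ⟨fun k => ?_, by simp⟩
      by_cases hk : k = i
      · subst hk; simp
      · simp [hk])
    (by
      rw [← preimage_combo]
      refine preimage_mono (subset_inter ?_ ?_)
      · exact add_subset_add (smul_set_mono inter_subset_left) (smul_set_mono inter_subset_left)
      · rintro _ ⟨_, ⟨x, hx, rfl⟩, _, ⟨y, hy, rfl⟩, rfl⟩
        exact convex_basisSimplex b hx.2 hy.2 ht0.le (by linarith) (by ring))
    (fun x hx hxs => by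
      refine ⟨?_, by change x ∈ e ⁻¹' basisSimplex b; rwa [heq]⟩
      have hr0 : 0 ≤ 1 - (1 - t) ^ j := by
        have := pow_le_one₀ (n := j) (by linarith : 0 ≤ 1 - t) (by linarith); linarith
      have hx1 : e x = ∑ i, x i • b i := by rw [he, Module.Basis.equivFun_symm_apply]
      set r := 1 - (1 - t) ^ j
      rcases hr0.eq_or_lt with hr | hr
      · have h1 : ∀ i ∈ Finset.univ, x i = 0 :=
          (Finset.sum_eq_zero_iff_of_nonneg fun i _ => hx.1 i).1
          (le_antisymm (hxs.trans hr.ge) (Finset.sum_nonneg fun i _ => hx.1 i))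
        have h2 : e x = r • 0 := by rw [hx1]; simp [h1]
        rw [h2]; exact hD 0 h0
      · have h2 : e x = r • ∑ i, (r⁻¹ * x i) • b i := by
          rw [hx1, Finset.smul_sum]
          refine Finset.sum_congr rfl fun i _ => ?_
          rw [smul_smul, mul_inv_cancel_left₀ hr.ne']
        rw [h2]
        refine hD _ (sum_smul_mem_of_zero_mem (convex_convexHull ℝ A) h0
          (fun i => subset_convexHull ℝ A (hb i)) ⟨fun i => mul_nonneg (inv_nonneg.2 hr.le)
            (hx.1 i), ?_⟩)
        rw [← Finset.mul_sum, inv_mul_le_iff₀ hr]; simpa using hxs)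
  have h1 : cornerSimplex (n + 1) \ e ⁻¹' (A ∩ basisSimplex b) = e ⁻¹' (basisSimplex b \ A) := by
    rw [← heq]; ext x; simp only [mem_sdiff, mem_preimage, mem_inter_iff]; tauto
  have h2 : e ⁻¹' (D ∩ basisSimplex b) \ e ⁻¹' (A ∩ basisSimplex b) =
      e ⁻¹' ((D \ A) ∩ basisSimplex b) := by
    ext x; simp only [mem_sdiff, mem_preimage, mem_inter_iff]; tauto
  rw [h1, h2, Measure.addHaar_preimage_linearEquiv, Measure.addHaar_preimage_linearEquiv,
    ← mul_assoc, mul_comm C, mul_assoc] at key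
  refine (ENNReal.mul_le_mul_iff_right ?_ ENNReal.ofReal_ne_top).1 key
  simpa using (LinearEquiv.isUnit_det' e.symm).ne_zero

theorem exists_supporting_functional {d : ℕ} {Q : Set (Fin d → ℝ)} (hQ : IsCompact Q)
    (hQc : Convex ℝ Q) (hQ0 : Q ∈ nhds 0) {x : Fin d → ℝ} (hx : x ≠ 0) :
    ∃ (g : ℝ) (l : (Fin d → ℝ) →ₗ[ℝ] ℝ), 0 < g ∧ (∀ q ∈ Q, l q ≤ 1) ∧ g⁻¹ • x ∈ Q ∧
      l (g⁻¹ • x) = 1 := by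
  have hg : 0 < gauge Q x := (gauge_pos (absorbent_nhds_zero hQ0) (hQ.isVonNBounded ℝ)).2 hx
  set g := gauge Q x with hgdef
  have hgy : gauge Q (g⁻¹ • x) = 1 := by
    rw [gauge_smul_of_nonneg (inv_nonneg.2 hg.le), smul_eq_mul, inv_mul_cancel₀ hg.ne']
  have hy : g⁻¹ • x ∈ Q := by
    rw [← hQ.isClosed.closure_eq]
    exact (gauge_le_one_iff_mem_closure hQc hQ0).1 hgy.le
  have hy' : g⁻¹ • x ∉ interior Q := fun h => by
    have h1 : gauge Q (g⁻¹ • x) < 1 := interior_subset_gauge_lt_one Q h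
    exact h1.ne hgy
  obtain ⟨f, hf⟩ := geometric_hahn_banach_open_point hQc.interior isOpen_interior hy'
  have h0 : (0 : Fin d → ℝ) ∈ interior Q := mem_interior_iff_mem_nhds.2 hQ0
  have hpos : 0 < f (g⁻¹ • x) := by simpa using hf 0 h0
  refine ⟨g, (f (g⁻¹ • x))⁻¹ • f.toLinearMap, hg, fun q hq => ?_, hy, ?_⟩
  · have h1 : q ∈ closure (interior Q) := by
      rw [hQc.closure_interior_eq_closure_of_nonempty_interior ⟨0, h0⟩]; exact subset_closure hq
    have h2 : closure (interior Q) ⊆ {z | f z ≤ f (g⁻¹ • x)} :=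
      closure_minimal (fun z hz => (hf z hz).le) (isClosed_le f.continuous continuous_const)
    have h3 : f q ≤ f (g⁻¹ • x) := h2 h1
    simp only [LinearMap.smul_apply, smul_eq_mul, ContinuousLinearMap.coe_coe]
    rwa [inv_mul_le_iff₀ hpos, mul_one]
  · simp only [LinearMap.smul_apply, smul_eq_mul, ContinuousLinearMap.coe_coe]
    exact inv_mul_cancel₀ hpos.ne'

theorem mem_of_mem_convexHull_of_tight {E : Type*} [AddCommGroup E] [Module ℝ E] {S P : Set E}
    {l : E →ₗ[ℝ] ℝ} (hP : Convex ℝ P) (hS : ∀ s ∈ S, l s ≤ 1) (hSP : ∀ s ∈ S, l s = 1 → s ∈ P)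
    {y : E} (hy : y ∈ convexHull ℝ S) (hly : l y = 1) : y ∈ P := by
  have h : convexHull ℝ S ⊆ {y | l y < 1 ∨ (l y = 1 ∧ y ∈ P)} := by
    refine convexHull_min (fun s hs => ?_) ?_
    · rcases (hS s hs).lt_or_eq with h | h
      · exact Or.inl h
      · exact Or.inr ⟨h, hSP s hs h⟩
    · intro u hu v hv a b ha hb hab
      rcases ha.eq_or_lt with rfl | ha'
      · have : b = 1 := by linarith
        subst this; simpa using hv
      rcases hb.eq_or_lt with rfl | hb'
      · have : a = 1 := by linarith
        subst this; simpa using hu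
      have hab' : l (a • u + b • v) = a * l u + b * l v := by simp
      rcases hu with hu | hu <;> rcases hv with hv | hv
      · left; rw [hab']; nlinarith
      · left; rw [hab', hv.1]; nlinarith
      · left; rw [hab', hu.1]; nlinarith
      · right; rw [hab', hu.1, hv.1]; exact ⟨by linarith, hP hu.2 hv.2 ha hb hab⟩
  rcases h hy with h | h
  · exact absurd hly h.ne
  · exact h.2

theorem exists_basis_subset_of_span_eq_top {d : ℕ} {Z : Set (Fin d → ℝ)}
    (hZ : Submodule.span ℝ Z = ⊤) : ∃ b : Module.Basis (Fin d) ℝ (Fin d → ℝ), ∀ i, b i ∈ Z := by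
  obtain ⟨B, hBZ, hB, hli⟩ := exists_linearIndependent ℝ Z
  set b₀ := Module.Basis.mk hli (by rw [Subtype.range_coe, hB, hZ])
  refine ⟨b₀.reindex (b₀.indexEquiv (Pi.basisFun ℝ (Fin d))), fun i => hBZ ?_⟩
  rw [Module.Basis.reindex_apply, Module.Basis.coe_mk]
  exact Subtype.coe_prop _

theorem exists_optimal_basis {d : ℕ} {V : Finset (Fin d → ℝ)} {w : (Fin d → ℝ) → ℝ} {η : ℝ}
    (hη : 0 < η) (hw : ∀ v ∈ V, 1 ≤ w v ∧ w v ≤ 1 + η)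
    (hgen : ∀ b : Module.Basis (Fin d) ℝ (Fin d → ℝ), (∀ i, b i ∈ V) → ∀ v ∈ V, v ∉ range b →
        ∑ i, b.repr v i * w (b i) ≠ w v)
    (h0 : 0 ∈ interior (convexHull ℝ (V : Set (Fin d → ℝ)))) {x : Fin d → ℝ} (hx0 : x ≠ 0)
    (hxV : (1 + η) • x ∈ convexHull ℝ (V : Set (Fin d → ℝ)))
    (hxW : ∀ W ⊆ V, Submodule.span ℝ (W : Set (Fin d → ℝ)) ≠ ⊤ →
      x ∉ Submodule.span ℝ (W : Set (Fin d → ℝ))) :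
    ∃ b : Module.Basis (Fin d) ℝ (Fin d → ℝ), (∀ i, b i ∈ V) ∧
      (∃ l : (Fin d → ℝ) →ₗ[ℝ] ℝ, (∀ i, l (b i) = w (b i)) ∧ ∀ v ∈ V, l v ≤ w v) ∧
      x ∈ basisSimplex b := by
  classical
  have hη1 : 0 < 1 + η := by linarith
  set S : Set (Fin d → ℝ) := insert 0 ((fun v => (w v)⁻¹ • v) '' (V : Set (Fin d → ℝ))) with hS
  set Q := convexHull ℝ S with hQ
  have hwpos : ∀ v ∈ V, 0 < w v := fun v hv => by linarith [(hw v hv).1]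
  have hQcpt : IsCompact Q := Set.Finite.isCompact_convexHull ℝ ((V.finite_toSet.image _).insert _)
  have hQc : Convex ℝ Q := convex_convexHull ℝ S
  have h0Q : (0 : Fin d → ℝ) ∈ Q := subset_convexHull ℝ S (mem_insert _ _)
  have hVQ : (1 + η)⁻¹ • convexHull ℝ (V : Set (Fin d → ℝ)) ⊆ Q := by
    rw [← convexHull_smul]
    refine convexHull_min ?_ hQc
    rintro _ ⟨v, hv, rfl⟩
    have h1 : (w v)⁻¹ • v ∈ Q := subset_convexHull ℝ S (mem_insert_of_mem _ ⟨v, hv, rfl⟩)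
    have h2 := hQc.smul_mem_of_zero_mem h0Q h1 (t := (1 + η)⁻¹ * w v)
      ⟨mul_nonneg (inv_nonneg.2 hη1.le) (hwpos v hv).le, by
        rw [inv_mul_le_iff₀ hη1]; simpa using (hw v hv).2⟩
    rw [smul_smul, mul_assoc, mul_inv_cancel₀ (hwpos v hv).ne', mul_one] at h2
    exact h2
  have hQ0 : Q ∈ nhds 0 := by
    refine mem_interior_iff_mem_nhds.1 (interior_mono hVQ ?_)
    rw [interior_smul₀ (inv_ne_zero hη1.ne')]
    exact ⟨0, h0, by simp⟩
  have hxQ : x ∈ Q := hVQ ⟨_, hxV, by simp only; rw [inv_smul_smul₀ hη1.ne']⟩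
  obtain ⟨g, l, hg, hl, hy, hly⟩ := exists_supporting_functional hQcpt hQc hQ0 hx0
  have hSl : ∀ s ∈ S, l s ≤ 1 := fun s hs => hl s (subset_convexHull ℝ S hs)
  have hlV : ∀ v ∈ V, l v ≤ w v := fun v hv => by
    have := hSl _ (mem_insert_of_mem _ ⟨v, hv, rfl⟩)
    simp only [map_smul, smul_eq_mul] at this
    rwa [inv_mul_le_iff₀ (hwpos v hv), mul_one] at this
  set Z := V.filter fun v => l v = w v with hZ
  have htight : ∀ s ∈ S, l s = 1 → ∃ v ∈ Z, s = (w v)⁻¹ • v := by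
    rintro s (rfl | ⟨v, hv, rfl⟩) hs
    · simp at hs
    · refine ⟨v, Finset.mem_filter.2 ⟨hv, ?_⟩, rfl⟩
      simp only [map_smul, smul_eq_mul] at hs
      rwa [inv_mul_eq_iff_eq_mul₀ (hwpos v hv).ne', mul_one] at hs
  have hyZ : g⁻¹ • x ∈ (Submodule.span ℝ (Z : Set (Fin d → ℝ)) : Set (Fin d → ℝ)) :=
    mem_of_mem_convexHull_of_tight (Submodule.convex _) hSl (fun s hs hs1 => by
      obtain ⟨v, hv, rfl⟩ := htight s hs hs1
      exact Submodule.smul_mem _ _ (Submodule.subset_span hv)) hy hly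
  have hspan : Submodule.span ℝ (Z : Set (Fin d → ℝ)) = ⊤ := by
    by_contra hcon
    exact hxW Z (Finset.filter_subset _ _) hcon
      ((Submodule.smul_mem_iff _ (inv_ne_zero hg.ne')).1 hyZ)
  obtain ⟨b, hb⟩ := exists_basis_subset_of_span_eq_top hspan
  have hbV : ∀ i, b i ∈ V := fun i => (Finset.mem_filter.1 (hb i)).1
  have hbl : ∀ i, l (b i) = w (b i) := fun i => (Finset.mem_filter.1 (hb i)).2
  have hZb : ∀ v ∈ Z, v ∈ range b := fun v hv => by
    by_contra hcon
    refine hgen b hbV v (Finset.mem_filter.1 hv).1 hcon ?_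
    rw [← (Finset.mem_filter.1 hv).2, map_eq_sum_repr b l]
    simp only [hbl]
  have hyb : g⁻¹ • x ∈ {z | ∀ i, 0 ≤ b.repr z i} := by
    refine mem_of_mem_convexHull_of_tight ?_ hSl (fun s hs hs1 => ?_) hy hly
    · intro u hu v hv α β hα hβ _ i
      simp only [map_add, map_smul, Finsupp.add_apply, Finsupp.smul_apply, smul_eq_mul]
      exact add_nonneg (mul_nonneg hα (hu i)) (mul_nonneg hβ (hv i))
    · obtain ⟨v, hv, rfl⟩ := htight s hs hs1
      obtain ⟨k, rfl⟩ := hZb v hv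
      intro i
      simp only [map_smul, Finsupp.smul_apply, smul_eq_mul, Module.Basis.repr_self]
      refine mul_nonneg (inv_nonneg.2 (hwpos _ (hbV k)).le) ?_
      rw [Finsupp.single_apply]; split_ifs <;> norm_num
  have hxb : ∀ i, 0 ≤ b.repr x i := fun i => by
    have := hyb i
    simp only [map_smul, Finsupp.smul_apply, smul_eq_mul] at this
    exact nonneg_of_mul_nonneg_right this (inv_pos.2 hg)
  refine ⟨b, hbV, ⟨l, hbl, hlV⟩, fun i => ?_, ?_⟩
  · simpa using hxb i
  · have h1 : ∑ i, b.repr x i ≤ l x := by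
      rw [map_eq_sum_repr b l]
      refine Finset.sum_le_sum fun i _ => le_mul_of_one_le_right (hxb i) ?_
      rw [hbl]; exact (hw _ (hbV i)).1
    simpa using h1.trans (hl x hxQ)

theorem exists_basisSimplex_cover {n : ℕ} (V : Finset (Fin (n + 1) → ℝ))
    (h0 : 0 ∈ interior (convexHull ℝ (V : Set (Fin (n + 1) → ℝ)))) {η : ℝ} (hη : 0 < η) :
    ∃ (ι : Type) (_ : Finite ι) (b : ι → Module.Basis (Fin (n + 1)) ℝ (Fin (n + 1) → ℝ)),
      (∀ k i, b k i ∈ V) ∧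
      Pairwise (fun k k' => AEDisjoint volume (basisSimplex (b k)) (basisSimplex (b k'))) ∧
      ∀ᵐ x, (1 + η) • x ∈ convexHull ℝ (V : Set (Fin (n + 1) → ℝ)) → ∃ k,
          x ∈ basisSimplex (b k) := by
  classical
  obtain ⟨w, hw, hgen⟩ := exists_generic_weights_on_finset V hη
  set ι := {S : Finset (Fin (n + 1) → ℝ) // S ∈ V.powerset ∧
    ∃ b : Module.Basis (Fin (n + 1)) ℝ (Fin (n + 1) → ℝ), range b = S ∧
      ∃ l : (Fin (n + 1) → ℝ) →ₗ[ℝ] ℝ, (∀ i, l (b i) = w (b i)) ∧ ∀ v ∈ V, l v ≤ w v} with hι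
  have hfin : Finite ι := Finite.of_injective (fun S : ι => (⟨S.1, S.2.1⟩ : V.powerset))
    fun S T h => Subtype.ext (by simpa using h)
  choose b hbr l hbl hlV using fun S : ι => S.2.2
  have hbV : ∀ (S : ι) i, b S i ∈ V := fun S i => by
    have h1 : b S i ∈ (S.1 : Set (Fin (n + 1) → ℝ)) := hbr S ▸ mem_range_self i
    exact Finset.mem_powerset.1 S.2.1 h1
  refine ⟨ι, hfin, b, hbV, fun S T hST => ?_, ?_⟩
  · have h1 : basisSimplex (b S) ∩ basisSimplex (b T) ⊆
        (⋃ i, {x | (b S).repr x i = 0}) ∪ ⋃ i, {x | (b T).repr x i = 0} := by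
      rintro x ⟨hxS, hxT⟩
      by_contra hcon
      simp only [mem_union, mem_iUnion, mem_ofPred_eq, not_or, not_exists] at hcon
      have hS : ∀ i, 0 < (b S).repr x i := fun i => lt_of_le_of_ne (hxS.1 i) (Ne.symm (hcon.1 i))
      have hT : ∀ i, 0 < (b T).repr x i := fun i => lt_of_le_of_ne (hxT.1 i) (Ne.symm (hcon.2 i))
      have h2 := range_subset_of_optimal hgen (hbV S) (hbV T) (hbl S) (hlV S) (hbl T) (hlV T) hS hT
      have h3 := range_subset_of_optimal hgen (hbV T) (hbV S) (hbl T) (hlV T) (hbl S) (hlV S) hT hS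
      rw [hbr, hbr] at h2 h3
      exact hST (Subtype.ext (Finset.coe_injective (h3.antisymm h2)))
    exact measure_mono_null h1 (measure_union_null
      (measure_iUnion_null fun i => volume_basis_coord_eq_zero _ i)
      (measure_iUnion_null fun i => volume_basis_coord_eq_zero _ i))
  · have h1 : ∀ᵐ x : Fin (n + 1) → ℝ, ∀ W ∈ V.powerset,
        Submodule.span ℝ (W : Set (Fin (n + 1) → ℝ)) ≠ ⊤ →
          x ∉ Submodule.span ℝ (W : Set (Fin (n + 1) → ℝ)) := by
      rw [Filter.eventually_all_finset]
      intro W _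
      by_cases hW : Submodule.span ℝ (W : Set (Fin (n + 1) → ℝ)) = ⊤
      · exact Filter.Eventually.of_forall fun x h => absurd hW h
      · have := measure_eq_zero_iff_ae_notMem.1 (Measure.addHaar_submodule volume _ hW)
        filter_upwards [this] with x hx _
        exact hx
    filter_upwards [h1] with x hx hxV
    have hx0 : x ≠ 0 := by
      have h2 := hx ∅ (by simp) (by simp)
      simpa using h2
    obtain ⟨b', hb'V, hl', hxb'⟩ := exists_optimal_basis hη hw hgen h0 hx0 hxV
      fun W hW => hx W (Finset.mem_powerset.2 hW)
    have hr : range b' = ((Finset.univ.image b' : Finset _) : Set (Fin (n + 1) → ℝ)) := by simp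
    set S : ι := ⟨Finset.univ.image b', Finset.mem_powerset.2 fun v hv => by
      obtain ⟨i, _, rfl⟩ := Finset.mem_image.1 hv; exact hb'V i, b', hr, hl'⟩ with hS
    refine ⟨S, ?_⟩
    have hSr : range (b S) = range b' := (hbr S).trans hr.symm
    have hex : ∀ i, ∃ k, b S k = b' i := fun i => by
      have : b' i ∈ range (b S) := hSr ▸ mem_range_self i
      exact this
    choose σ hσ using hex
    have hσi : Function.Injective σ := fun i k h => b'.injective (by rw [← hσ, ← hσ, h])
    have hσb : Function.Bijective σ := Finite.injective_iff_bijective.1 hσi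
    have hb : (b S).reindex (Equiv.ofBijective σ hσb).symm = b' := by
      refine Module.Basis.eq_of_apply_eq fun i => ?_
      rw [Module.Basis.reindex_apply, Equiv.symm_symm, Equiv.ofBijective_apply, hσ]
    rw [← hb] at hxb'
    refine ⟨fun i => ?_, ?_⟩
    · obtain ⟨k, rfl⟩ := hσb.2 i
      have := hxb'.1 k
      simpa using this
    · have := hxb'.2
      simp only [Module.Basis.equivFun_apply, Module.Basis.repr_reindex_apply, Equiv.symm_symm,
        Equiv.ofBijective_apply] at this ⊢
      rwa [hσb.sum_comp (fun i => (b S).repr x i)] at this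

theorem volume_contracted_hull_diff_le {n : ℕ} {A X : Set (Fin (n + 1) → ℝ)} {C : ℝ≥0∞}
    (hX : MeasurableSet X)
    (h : ∀ b : Module.Basis (Fin (n + 1)) ℝ (Fin (n + 1) → ℝ), (∀ i, b i ∈ A) →
      volume (basisSimplex b \ A) ≤ C * volume (X ∩ basisSimplex b))
    {V : Finset (Fin (n + 1) → ℝ)} (hV : (V : Set (Fin (n + 1) → ℝ)) ⊆ A)
    (h0 : 0 ∈ interior (convexHull ℝ (V : Set (Fin (n + 1) → ℝ)))) {η : ℝ} (hη : 0 < η) :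
    volume ({x | (1 + η) • x ∈ convexHull ℝ (V : Set (Fin (n + 1) → ℝ))} \ A) ≤ C * volume X := by
  obtain ⟨ι, hι, b, hbV, hdis, hcov⟩ := exists_basisSimplex_cover V h0 hη
  have hT : ∀ k, MeasurableSet (basisSimplex (b k)) := fun k =>
    (isCompact_basisSimplex _).measurableSet
  calc volume ({x | (1 + η) • x ∈ convexHull ℝ (V : Set (Fin (n + 1) → ℝ))} \ A)
      ≤ volume (⋃ k, basisSimplex (b k) \ A) := by
        refine measure_mono_ae ?_
        filter_upwards [hcov] with x hx hxA
        obtain ⟨k, hk⟩ := hx hxA.1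
        exact mem_iUnion.2 ⟨k, hk, hxA.2⟩
    _ ≤ ∑' k, volume (basisSimplex (b k) \ A) := measure_iUnion_le _
    _ ≤ ∑' k, C * volume (X ∩ basisSimplex (b k)) :=
        ENNReal.tsum_le_tsum fun k => h _ fun i => hV (hbV k i)
    _ = C * volume (⋃ k, X ∩ basisSimplex (b k)) := by
        rw [ENNReal.tsum_mul_left, measure_iUnion₀ ?_ fun k => (hX.inter (hT k)).nullMeasurableSet]
        exact fun k k' hk => (hdis hk).mono inter_subset_right inter_subset_right
    _ ≤ C * volume X := by
        gcongr
        exact iUnion_subset fun k => inter_subset_left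

theorem exists_finset_subset_interior_convexHull {d : ℕ} {A Q : Set (Fin d → ℝ)}
    (hQ : IsCompact Q) (hQA : Q ⊆ interior (convexHull ℝ A)) :
    ∃ V : Finset (Fin d → ℝ), (V : Set (Fin d → ℝ)) ⊆ A ∧
      Q ⊆ interior (convexHull ℝ (V : Set (Fin d → ℝ))) := by
  classical
  refine hQ.induction_on (p := fun S => ∃ V : Finset (Fin d → ℝ), (V : Set (Fin d → ℝ)) ⊆ A ∧
      S ⊆ interior (convexHull ℝ (V : Set (Fin d → ℝ)))) ⟨∅, by simp, by simp⟩
    (fun S T hST ⟨V, hV, hTV⟩ => ⟨V, hV, hST.trans hTV⟩) ?_ ?_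
  · rintro S T ⟨V, hV, hSV⟩ ⟨W, hW, hTW⟩
    refine ⟨V ∪ W, by simp [hV, hW], union_subset (hSV.trans ?_) (hTW.trans ?_)⟩ <;>
      exact interior_mono (convexHull_mono (by simp))
  · intro x hx
    obtain ⟨b, hxb, hb⟩ := exists_mem_interior_convexHull_affineBasis
      (mem_interior_iff_mem_nhds.1 (hQA hx))
    have h1 : ∀ i, ∃ V : Finset (Fin d → ℝ), (V : Set (Fin d → ℝ)) ⊆ A ∧
        b i ∈ convexHull ℝ (V : Set (Fin d → ℝ)) := fun i => by
      have h2 := hb (subset_convexHull ℝ _ (mem_range_self i))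
      rw [convexHull_eq_union_convexHull_finite_subsets] at h2
      simpa using h2
    choose V hVA hbV using h1
    refine ⟨_, mem_nhdsWithin_of_mem_nhds (isOpen_interior.mem_nhds hxb),
      Finset.univ.biUnion V, by simpa using hVA, interior_mono ?_⟩
    refine convexHull_min ?_ (convex_convexHull ℝ _)
    rintro _ ⟨i, rfl⟩
    exact convexHull_mono (by
      intro v hv; exact Finset.mem_coe.2 (Finset.mem_biUnion.2 ⟨i, Finset.mem_univ i, hv⟩)) (hbV i)

theorem volume_convexHull_diff {d : ℕ} (A : Set (Fin d → ℝ)) :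
    volume (convexHull ℝ A \ A) = volume (interior (convexHull ℝ A) \ A) := by
  refine le_antisymm ?_ (measure_mono (sdiff_subset_sdiff_left interior_subset))
  have h1 : convexHull ℝ A \ A ⊆ (interior (convexHull ℝ A) \ A) ∪ frontier (convexHull ℝ A) := by
    rintro x ⟨hx, hxA⟩
    by_cases h : x ∈ interior (convexHull ℝ A)
    · exact Or.inl ⟨h, hxA⟩
    · exact Or.inr ⟨subset_closure hx, h⟩
  refine (measure_mono h1).trans ((measure_union_le _ _).trans ?_)
  rw [(convex_convexHull ℝ A).addHaar_frontier volume, add_zero]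

theorem volume_convexHull_diff_le {n : ℕ} {A X : Set (Fin (n + 1) → ℝ)} {C : ℝ≥0∞}
    (hA : IsCompact A) (hX : MeasurableSet X)
    (h : ∀ b : Module.Basis (Fin (n + 1)) ℝ (Fin (n + 1) → ℝ), (∀ i, b i ∈ A) →
      volume (basisSimplex b \ A) ≤ C * volume (X ∩ basisSimplex b))
    (h0 : 0 ∈ interior (convexHull ℝ A)) :
    volume (convexHull ℝ A \ A) ≤ C * volume X := by
  rw [volume_convexHull_diff, (isOpen_interior.sdiff hA.isClosed).measure_eq_iSup_isCompact]
  refine iSup₂_le fun Q hQ => iSup_le fun hQc => ?_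
  obtain ⟨u, v, hu, -, h1u, hQv, huv⟩ := generalized_tube_lemma (s := {(1 : ℝ)}) (t := Q)
    isCompact_singleton hQc
    (n := (fun p : ℝ × (Fin (n + 1) → ℝ) => p.1 • p.2) ⁻¹' interior (convexHull ℝ A))
    (isOpen_interior.preimage (by fun_prop)) (by
      rintro ⟨r, q⟩ ⟨hr, hq⟩
      obtain rfl : r = 1 := hr
      simpa using (hQ hq).1)
  obtain ⟨ε, hε, hball⟩ := Metric.isOpen_iff.1 hu 1 (h1u rfl)
  set η := ε / 2 with hη
  have hη0 : 0 < η := by positivity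
  have hηu : 1 + η ∈ u := hball (by simp [abs_of_pos hη0]; linarith)
  obtain ⟨V, hVA, hV⟩ := exists_finset_subset_interior_convexHull
    (A := A) (Q := insert 0 ((1 + η) • Q)) ((hQc.smul (1 + η)).insert 0) (by
      rw [insert_subset_iff]
      refine ⟨h0, ?_⟩
      rintro _ ⟨q, hq, rfl⟩
      exact huv (mk_mem_prod hηu (hQv hq)))
  refine (measure_mono ?_).trans
    (volume_contracted_hull_diff_le hX h hVA (hV (mem_insert _ _)) hη0)
  intro q hq
  have h1 : (1 + η) • q ∈ interior (convexHull ℝ (V : Set (Fin (n + 1) → ℝ))) :=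
    hV (mem_insert_of_mem _ ⟨q, hq, rfl⟩)
  have h2 : (1 + η) • q ∈ convexHull ℝ (V : Set (Fin (n + 1) → ℝ)) := interior_subset h1
  exact ⟨h2, (hQ hq).2⟩

theorem combo_vadd {E : Type*} [AddCommGroup E] [Module ℝ E] (t : ℝ) (o : E) (A : Set E) :
    t • (o +ᵥ A) + (1 - t) • (o +ᵥ A) = o +ᵥ (t • A + (1 - t) • A) := by
  ext z; constructor
  · rintro ⟨_, ⟨_, ⟨x, hx, rfl⟩, rfl⟩, _, ⟨_, ⟨y, hy, rfl⟩, rfl⟩, rfl⟩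
    exact ⟨_, ⟨_, ⟨x, hx, rfl⟩, _, ⟨y, hy, rfl⟩, rfl⟩, by simp only [vadd_eq_add]; module⟩
  · rintro ⟨_, ⟨_, ⟨x, hx, rfl⟩, _, ⟨y, hy, rfl⟩, rfl⟩, rfl⟩
    exact ⟨_, ⟨_, ⟨x, hx, rfl⟩, rfl⟩, _, ⟨_, ⟨y, hy, rfl⟩, rfl⟩, by simp only [vadd_eq_add]; module⟩

theorem combo_subset_convexHull {E : Type*} [AddCommGroup E] [Module ℝ E] {t : ℝ} (ht0 : 0 ≤ t)
    (ht1 : t ≤ 1) (A : Set E) : t • A + (1 - t) • A ⊆ convexHull ℝ A := by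
  rintro _ ⟨_, ⟨x, hx, rfl⟩, _, ⟨y, hy, rfl⟩, rfl⟩
  exact convex_convexHull ℝ A (subset_convexHull ℝ A hx) (subset_convexHull ℝ A hy) ht0
    (by linarith) (by ring)

theorem exists_stability_of_homothetic_hull (n : ℕ) {t : ℝ} (ht0 : 0 < t) (ht1 : t < 1) :
    ∃ (j : ℕ) (C : ℝ≥0∞), C ≠ ⊤ ∧ ∀ A : Set (Fin (n + 1) → ℝ), IsCompact A →
      ∀ o ∈ interior (t • A + (1 - t) • A),
      (∀ y ∈ convexHull ℝ A, o + (1 - (1 - t) ^ j) • (y - o) ∈ t • A + (1 - t) • A) →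
        volume (convexHull ℝ A \ A) ≤ C * volume ((t • A + (1 - t) • A) \ A) := by
  obtain ⟨j, C, hC, h⟩ := exists_basisSimplex_stability n ht0 ht1
  refine ⟨j, C, hC, fun A hA o ho hD => ?_⟩
  have hA' : IsCompact (-o +ᵥ A) := hA.vadd (-o)
  have hD' : t • (-o +ᵥ A) + (1 - t) • (-o +ᵥ A) = -o +ᵥ (t • A + (1 - t) • A) := combo_vadd t _ A
  have h0 : 0 ∈ interior (convexHull ℝ (-o +ᵥ A)) := by
    rw [convexHull_vadd, interior_vadd]
    exact ⟨o, interior_mono (combo_subset_convexHull ht0.le ht1.le A) ho, by simp⟩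
  have key := volume_convexHull_diff_le (A := -o +ᵥ A)
    (X := (t • (-o +ᵥ A) + (1 - t) • (-o +ᵥ A)) \ (-o +ᵥ A)) (C := C) hA'
    ((isCompact_combo hA' hA' t).measurableSet.diff hA'.measurableSet)
    (h _ hA' (interior_subset h0) fun y hy => by
      rw [convexHull_vadd] at hy
      obtain ⟨z, hz, rfl⟩ := hy
      rw [hD']
      exact ⟨_, hD z hz, by simp only [vadd_eq_add]; module⟩) h0
  rwa [hD', convexHull_vadd, ← vadd_set_sdiff, ← vadd_set_sdiff, measure_vadd, measure_vadd] at key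

/-- Linear stability for compact sets in the unit cube having unit chords in all coordinate
directions. -/
theorem exists_stability_of_unit_chords (n : ℕ) {t : ℝ} (ht0 : 0 < t) (ht2 : t ≤ 1 / 2) :
    ∃ C : ℝ≥0∞, C ≠ ⊤ ∧ ∀ A : Set (Fin (n + 1) → ℝ), IsCompact A → A ⊆ Icc 0 1 →
      (∀ k, ∃ a ∈ A, ∃ b ∈ A, a - b = Pi.single k 1) →
      volume (t • A + (1 - t) • A) < volume A + ENNReal.ofReal (t ^ (n + 1)) * volume A →
        volume (convexHull ℝ A \ A) ≤ C * volume ((t • A + (1 - t) • A) \ A) := by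
  obtain ⟨c, hc, hcA⟩ := exists_volume_ge_of_chords n ht0 ht2
  obtain ⟨j, C, hC, h⟩ := exists_stability_of_homothetic_hull n ht0 (by linarith)
  obtain ⟨m, hm, hmA⟩ := exists_homothetic_hull_subset n ht0 ht2 hc j
  refine ⟨max C (ENNReal.ofReal m)⁻¹, by simp [hC, hm], fun A hA hAI hch hlt => ?_⟩
  by_cases hD : volume ((t • A + (1 - t) • A) \ A) < ENNReal.ofReal m
  · obtain ⟨o, ho, hoD⟩ := hmA A hA hAI (hcA A hA hAI hch hlt) hD
    exact (h A hA o ho hoD).trans (by gcongr; exact le_max_left _ _)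
  · have h1 : volume (convexHull ℝ A \ A) ≤ 1 := by
      refine (measure_mono (sdiff_subset.trans (convexHull_min hAI (convex_Icc _ _)))).trans ?_
      simp [Real.volume_Icc_pi]
    refine h1.trans ?_
    calc (1 : ℝ≥0∞) = (ENNReal.ofReal m)⁻¹ * ENNReal.ofReal m :=
          (ENNReal.inv_mul_cancel (by simpa using hm) ENNReal.ofReal_ne_top).symm
      _ ≤ _ := mul_le_mul' (le_max_right _ _) (not_lt.1 hD)

theorem exists_basis_repr_abs_le_one {d : ℕ} {S : Set (Fin d → ℝ)} (hS : IsCompact S)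
    (hS0 : S ∈ nhds 0) : ∃ b : Module.Basis (Fin d) ℝ (Fin d → ℝ), (∀ i, b i ∈ S) ∧
      ∀ x ∈ S, ∀ i, |b.repr x i| ≤ 1 := by
  obtain ⟨r, hr, hrS⟩ : ∃ r : ℝ, 0 < r ∧ ∀ i : Fin d, Pi.single i r ∈ S := by
    obtain ⟨ε, hε, hball⟩ := Metric.mem_nhds_iff.1 hS0
    refine ⟨ε / 2, by positivity, fun i => hball ?_⟩
    rw [mem_ball_zero_iff, Pi.norm_single, Real.norm_of_nonneg (by positivity)]
    linarith
  obtain ⟨v, hvS, hv⟩ := (isCompact_univ_pi fun _ : Fin d => hS).exists_isMaxOn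
    ⟨fun i => Pi.single i r, fun i _ => hrS i⟩
    (f := fun v : Fin d → Fin d → ℝ => |(Matrix.of v).det|)
    (Continuous.continuousOn ((continuous_id.matrix_det).abs))
  have hdet : (Matrix.of v).det ≠ 0 := by
    have h1 : |(Matrix.of fun i : Fin d => (Pi.single i r : Fin d → ℝ)).det| ≤
        |(Matrix.of v).det| :=
      hv fun i _ => hrS i
    have h2 : (Matrix.of fun i : Fin d => (Pi.single i r : Fin d → ℝ)) =
        Matrix.diagonal fun _ => r := by
      ext i k; simp [Matrix.diagonal_apply, Pi.single_apply, eq_comm]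
    rw [h2, Matrix.det_diagonal] at h1
    have h3 : 0 < |∏ _i : Fin d, r| := by simp [hr.ne']
    exact abs_pos.1 (h3.trans_le h1)
  have hli : LinearIndependent ℝ v := Matrix.linearIndependent_rows_of_det_ne_zero hdet
  set b := basisOfLinearIndependentOfCardEqFinrank' v hli (by simp) with hb
  have hbv : ∀ i, b i = v i := fun i => by simp [hb]
  refine ⟨b, fun i => hbv i ▸ hvS i (mem_univ i), fun x hx i => ?_⟩
  have h1 : |(Matrix.of (Function.update v i x)).det| ≤ |(Matrix.of v).det| :=
    hv fun k _ => by
      by_cases hk : k = i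
      · subst hk; simpa using hx
      · simpa [hk] using hvS k (mem_univ k)
  have h2 : x = ∑ k, b.repr x k • Matrix.of v k := by
    conv_lhs => rw [← b.sum_repr x]
    simp only [hbv]; rfl
  have h3 : Matrix.of (Function.update v i x) =
      (Matrix.of v).updateRow i (∑ k, b.repr x k • Matrix.of v k) := by
    rw [← h2]; rfl
  rw [h3, Matrix.det_updateRow_sum, smul_eq_mul, abs_mul] at h1
  exact (mul_le_iff_le_one_left (abs_pos.2 hdet)).1 h1

theorem convexHull_preimage_linearEquiv {E F : Type*} [AddCommGroup E] [Module ℝ E]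
    [AddCommGroup F] [Module ℝ F] (e : E ≃ₗ[ℝ] F) (A : Set F) :
    convexHull ℝ (e ⁻¹' A) = e ⁻¹' convexHull ℝ A := by
  rw [← LinearEquiv.image_symm_eq_preimage, ← LinearEquiv.image_symm_eq_preimage]
  exact (e.symm.toLinearMap.image_convexHull A).symm

theorem exists_normalization {d : ℕ} {A : Set (Fin d → ℝ)} (hA : IsCompact A)
    (hA0 : 0 < volume A) : ∃ (e : (Fin d → ℝ) ≃ₗ[ℝ] (Fin d → ℝ)) (o : Fin d → ℝ),
      IsCompact (o +ᵥ e ⁻¹' A) ∧ o +ᵥ e ⁻¹' A ⊆ Icc 0 1 ∧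
      ∀ k, ∃ a ∈ o +ᵥ e ⁻¹' A, ∃ b ∈ o +ᵥ e ⁻¹' A, a - b = Pi.single k 1 := by
  obtain ⟨b, hb, hbA⟩ := exists_basis_repr_abs_le_one (S := A - A)
    (by rw [sub_eq_add_neg]; exact hA.add hA.neg)
    (Measure.sub_mem_nhds_zero_of_addHaar_pos volume A hA.measurableSet hA0)
  have hAne : A.Nonempty := nonempty_of_measure_ne_zero hA0.ne'
  have hcoord : ∀ x ∈ A, ∀ y ∈ A, ∀ i, |b.repr x i - b.repr y i| ≤ 1 := fun x hx y hy i => by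
    have := hbA (x - y) (sub_mem_sub hx hy) i
    simpa using this
  have hmin : ∀ i, ∃ p ∈ A, ∀ x ∈ A, b.equivFun p i ≤ b.equivFun x i := fun i => by
    have hc : Continuous fun x => b.equivFun x i :=
      (continuous_apply i).comp b.equivFun.toLinearMap.continuous_of_finiteDimensional
    obtain ⟨p, hp, hpm⟩ := hA.exists_isMinOn hAne hc.continuousOn
    exact ⟨p, hp, fun x hx => hpm hx⟩
  choose p hp hpm using hmin
  set o : Fin d → ℝ := fun i => -b.equivFun (p i) i with ho
  refine ⟨b.equivFun.symm, o, ?_, ?_, fun k => ?_⟩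
  · rw [← LinearEquiv.image_eq_preimage_symm]
    exact (hA.image b.equivFun.toLinearMap.continuous_of_finiteDimensional).vadd o
  · rintro _ ⟨x, hx, rfl⟩
    obtain ⟨y, hy, rfl⟩ : ∃ y ∈ A, b.equivFun y = x := ⟨_, hx, b.equivFun.apply_symm_apply x⟩
    refine ⟨fun i => ?_, fun i => ?_⟩
    · have := hpm i y hy
      simp only [ho, vadd_eq_add, Pi.add_apply, Pi.zero_apply]; linarith
    · have := (abs_le.1 (hcoord y hy (p i) (hp i) i)).2
      simp only [ho, vadd_eq_add, Pi.add_apply, Pi.one_apply, Module.Basis.equivFun_apply]; linarith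
  · obtain ⟨x, hx, y, hy, hxy⟩ := hb k
    refine ⟨o +ᵥ b.equivFun x, ⟨_, by simpa using hx, rfl⟩, o +ᵥ b.equivFun y,
      ⟨_, by simpa using hy, rfl⟩, ?_⟩
    simp only [vadd_eq_add, add_sub_add_left_eq_sub]
    simp only at hxy
    rw [← map_sub, hxy]
    ext i; simp [Pi.single_apply, eq_comm]

/-- Linear stability below the threshold for compact sets. -/
theorem exists_compact_stability (n : ℕ) {t : ℝ} (ht0 : 0 < t) (ht2 : t ≤ 1 / 2) :
    ∃ C : ℝ≥0∞, C ≠ ⊤ ∧ ∀ A : Set (Fin (n + 1) → ℝ), IsCompact A →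
      volume (t • A + (1 - t) • A) < volume A + ENNReal.ofReal (t ^ (n + 1)) * volume A →
        volume (convexHull ℝ A \ A) ≤ C * volume ((t • A + (1 - t) • A) \ A) := by
  obtain ⟨C, hC, h⟩ := exists_stability_of_unit_chords n ht0 ht2
  refine ⟨C, hC, fun A hA hlt => ?_⟩
  have hA0 : 0 < volume A := by
    rw [pos_iff_ne_zero]; intro h0; simp [h0] at hlt
  obtain ⟨e, o, hc, hI, hch⟩ := exists_normalization hA hA0
  have hκ : ENNReal.ofReal |LinearMap.det (e.symm : (Fin (n + 1) → ℝ) →ₗ[ℝ]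
      (Fin (n + 1) → ℝ))| ≠ 0 := by
    simpa using (LinearEquiv.isUnit_det' e.symm).ne_zero
  have hvol : ∀ X : Set (Fin (n + 1) → ℝ), volume (o +ᵥ e ⁻¹' X) =
      ENNReal.ofReal |LinearMap.det (e.symm : (Fin (n + 1) → ℝ) →ₗ[ℝ]
        (Fin (n + 1) → ℝ))| * volume X :=
    fun X => by rw [measure_vadd, Measure.addHaar_preimage_linearEquiv]
  have key := h (o +ᵥ e ⁻¹' A) hc hI hch
  rw [combo_vadd, ← preimage_combo, convexHull_vadd, convexHull_preimage_linearEquiv,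
    ← vadd_set_sdiff, ← vadd_set_sdiff, ← preimage_sdiff, ← preimage_sdiff, hvol, hvol, hvol, hvol,
    mul_left_comm, ← mul_add, mul_left_comm] at key
  exact (ENNReal.mul_le_mul_iff_right hκ ENNReal.ofReal_ne_top).1
    (key (ENNReal.mul_lt_mul_right hκ ENNReal.ofReal_ne_top hlt))

theorem combo_mono {E : Type*} [AddCommGroup E] [Module ℝ E] (t : ℝ) {A B : Set E} (h : A ⊆ B) :
    t • A + (1 - t) • A ⊆ t • B + (1 - t) • B :=
  add_subset_add (smul_set_mono h) (smul_set_mono h)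

/-- Linear stability below the threshold for measurable sets, in terms of the volume increment. -/
theorem exists_measurable_stability (n : ℕ) {t : ℝ} (ht0 : 0 < t) (ht2 : t ≤ 1 / 2) :
    ∃ C : ℝ≥0∞, C ≠ ⊤ ∧ ∀ A : Set (Fin (n + 1) → ℝ), MeasurableSet A → 0 < volume A →
      volume A < ⊤ →
      volume (t • A + (1 - t) • A) < (1 + ENNReal.ofReal (t ^ (n + 1))) * volume A →
        volume (convexHull ℝ A \ A) ≤ C * (volume (t • A + (1 - t) • A) - volume A) := by
  obtain ⟨C, hC, h⟩ := exists_compact_stability n ht0 ht2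
  refine ⟨C, hC, fun A hA hA0 hAtop hlt => ?_⟩
  set D := t • A + (1 - t) • A with hD
  set τ := ENNReal.ofReal (t ^ (n + 1)) with hτ
  obtain ⟨a, ha, haA⟩ := exists_between (ENNReal.div_lt_of_lt_mul' hlt)
  rw [volume_convexHull_diff, (isOpen_interior.measurableSet.diff hA).measure_eq_iSup_isCompact]
  refine iSup₂_le fun Q hQ => iSup_le fun hQc => ?_
  obtain ⟨V, hVA, hV⟩ := exists_finset_subset_interior_convexHull hQc (hQ.trans sdiff_subset)
  have key : ∀ r < volume A, volume Q + C * r ≤ C * volume D := fun r hr => by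
    obtain ⟨A₀, hA₀A, hA₀, hrA₀⟩ := hA.exists_lt_isCompact (max_lt hr haA)
    set A₁ := A₀ ∪ V with hA₁
    have hA₁A : A₁ ⊆ A := union_subset hA₀A hVA
    have hA₁c : IsCompact A₁ := hA₀.union V.finite_toSet.isCompact
    have hrA₁ : max r a < volume A₁ := hrA₀.trans_le (measure_mono subset_union_left)
    set D₁ := t • A₁ + (1 - t) • A₁ with hD₁
    have hD₁D : volume D₁ ≤ volume D := measure_mono (combo_mono t hA₁A)
    have h1 : volume D₁ < volume A₁ + τ * volume A₁ := by
      refine hD₁D.trans_lt ?_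
      have h2 : volume D / (1 + τ) < volume A₁ := ha.trans ((le_max_right _ _).trans_lt hrA₁)
      rw [ENNReal.div_lt_iff (Or.inl (by simp)) (Or.inl (by simp [hτ]))] at h2
      rwa [mul_add, mul_one, mul_comm _ τ] at h2
    have h3 := h A₁ hA₁c h1
    have h4 : Q ⊆ convexHull ℝ A₁ \ A₁ := fun q hq =>
      ⟨convexHull_mono subset_union_right (interior_subset (hV hq)),
          fun hqA => (hQ hq).2 (hA₁A hqA)⟩
    calc volume Q + C * r ≤ C * volume (D₁ \ A₁) + C * volume A₁ :=
          add_le_add ((measure_mono h4).trans h3)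
            (mul_le_mul_right ((le_max_left _ _).trans hrA₁.le) C)
      _ = C * volume D₁ := by
          rw [← mul_add, measure_sdiff (subset_combo t A₁) hA₁c.measurableSet.nullMeasurableSet
            hA₁c.measure_lt_top.ne, tsub_add_cancel_of_le (measure_mono (subset_combo t A₁))]
      _ ≤ C * volume D := by gcongr
  have hcl : IsClosed {r : ℝ≥0∞ | volume Q + C * r ≤ C * volume D} :=
    isClosed_le (continuous_const.add (ENNReal.continuous_const_mul hC)) continuous_const
  have h5 : volume A ∈ closure (Iio (volume A)) := by
    rw [closure_Iio' ⟨0, hA0⟩]; exact self_mem_Iic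
  have h6 : volume Q + C * volume A ≤ C * volume D := closure_minimal key hcl h5
  rw [ENNReal.mul_sub fun _ _ => hC]
  exact ENNReal.le_sub_of_add_le_right (ENNReal.mul_ne_top hC hAtop.ne) h6

end TDoubling

/-- **Linear stability of the Brunn–Minkowski inequality for homothetic sets
below the sharp threshold.** For every `d ≥ 1` and `t ∈ (0, 1/2]` there is
`C = C_{d,t} > 0` such that if `A ⊆ ℝ^d` is measurable of positive finite
volume with `δ := |tA + (1-t)A|/|A| - 1 < t^d`, then
`|co(A) \ A| ≤ C δ |A|`. -/
theorem linear_stability_below_threshold (d : ℕ) (hd : 1 ≤ d) (t : ℝ)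
    (ht0 : 0 < t) (ht2 : t ≤ 1 / 2) :
    ∃ C : ℝ, 0 < C ∧
      ∀ A : Set (Fin d → ℝ), MeasurableSet A →
        0 < volume A → volume A < ⊤ →
        volume (t • A + (1 - t) • A) / volume A - 1 < ENNReal.ofReal (t ^ d) →
        volume (convexHull ℝ A \ A) ≤
          ENNReal.ofReal C * (volume (t • A + (1 - t) • A) / volume A - 1) *
            volume A := by
  obtain ⟨n, rfl⟩ : ∃ n, d = n + 1 := ⟨d - 1, by omega⟩
  obtain ⟨C, hC, h⟩ := TDoubling.exists_measurable_stability n ht0 ht2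
  refine ⟨C.toReal + 1, by positivity, fun A hA hA0 hAtop hlt => ?_⟩
  have hdiv : volume (t • A + (1 - t) • A) / volume A <
      1 + ENNReal.ofReal (t ^ (n + 1)) :=
    le_add_tsub.trans_lt (ENNReal.add_lt_add_left ENNReal.one_ne_top hlt)
  refine (h A hA hA0 hAtop
    ((ENNReal.div_lt_iff (Or.inl hA0.ne') (Or.inl hAtop.ne)).1 hdiv)).trans ?_
  rw [mul_assoc, ENNReal.sub_mul fun _ _ => hAtop.ne, one_mul,
    ENNReal.div_mul_cancel hA0.ne' hAtop.ne]
  gcongr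
  exact (ENNReal.ofReal_toReal hC).ge.trans (ENNReal.ofReal_le_ofReal (by linarith))
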